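/- For every integer d ≥ 4, every 2-neighborly d-polytope with at least d+4 vertices has at least d+8 facets. -/

import Mathlib

open Set

/-- A polytope is the convex hull of a finite set of points. -/
def IsPolytope {N : ℕ} (P : Set (Fin N → ℝ)) : Prop :=
  ∃ S : Finset (Fin N → ℝ), P = convexHull ℝ (S : Set (Fin N → ℝ))

/-- The dimension of a set: the dimension of its affine span. -/
noncomputable def pdim {N : ℕ} (P : Set (Fin N → ℝ)) : ℕ :=
  Module.finrank ℝ (affineSpan ℝ P).direction

/-- A vertex is a 0-dimensional (exposed) face, i.e. an exposed singleton. -/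
def IsVertex {N : ℕ} (P : Set (Fin N → ℝ)) (v : Fin N → ℝ) : Prop :=
  IsExposed ℝ P {v}

/-- The set of vertices of `P`. -/
def vertexSet {N : ℕ} (P : Set (Fin N → ℝ)) : Set (Fin N → ℝ) :=
  {v | IsVertex P v}

/-- A facet is a nonempty exposed face of dimension one less than the polytope. -/
def IsFacetOf {N : ℕ} (P F : Set (Fin N → ℝ)) : Prop :=
  IsExposed ℝ P F ∧ F.Nonempty ∧ pdim F + 1 = pdim P

/-- The set of facets of `P`. -/
def facetSet {N : ℕ} (P : Set (Fin N → ℝ)) : Set (Set (Fin N → ℝ)) :=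
  {F | IsFacetOf P F}

/-- A polytope is 2-neighborly if every pair of distinct vertices is the vertex set of
an edge (1-dimensional face), i.e. the segment between them is an exposed face. -/
def TwoNeighborly {N : ℕ} (P : Set (Fin N → ℝ)) : Prop :=
  ∀ u v : Fin N → ℝ, IsVertex P u → IsVertex P v → u ≠ v →
    IsExposed ℝ P (convexHull ℝ {u, v}) ∧ pdim (convexHull ℝ ({u, v} : Set (Fin N → ℝ))) = 1

/-- A polytope is 2-simplicial if every 2-dimensional face has exactly 3 vertices. -/
def TwoSimplicial {N : ℕ} (P : Set (Fin N → ℝ)) : Prop :=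
  ∀ F : Set (Fin N → ℝ), IsExposed ℝ P F → F.Nonempty → pdim F = 2 →
    (vertexSet F).ncard = 3

/-- A polytope is a pyramid if some vertex (the apex) is not in the affine span
of the remaining vertices. -/
def IsPyramid {N : ℕ} (P : Set (Fin N → ℝ)) : Prop :=
  ∃ v : Fin N → ℝ, IsVertex P v ∧ v ∉ affineSpan ℝ (vertexSet P \ {v})

/-- `P` is a pyramid over `Q`: `Q` is a facet of `P` and `P` is the convex hull of `Q`
together with one additional point (the apex) not in the affine span of `Q`. -/
def IsPyramidOver {N : ℕ} (P Q : Set (Fin N → ℝ)) : Prop :=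
  IsFacetOf P Q ∧ ∃ a : Fin N → ℝ, a ∉ affineSpan ℝ Q ∧ P = convexHull ℝ (Q ∪ {a})

/-- `P` is a `k`-fold pyramid over `Q`. -/
def IsKFoldPyramidOver {N : ℕ} : ℕ → Set (Fin N → ℝ) → Set (Fin N → ℝ) → Prop
  | 0, P, Q => P = Q
  | k + 1, P, Q => ∃ R : Set (Fin N → ℝ), IsKFoldPyramidOver k R Q ∧ IsPyramidOver P R

set_option linter.unusedSectionVars false

namespace FaceCone

variable {E : Type*} [AddCommGroup E] [Module ℝ E]

/-- The linear rank of a finite set of vectors. -/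
noncomputable def rk (S : Finset E) : ℕ := Module.finrank ℝ (Submodule.span ℝ (S : Set E))

/-- `S` is the part of the finite configuration `V` lying on the zero set of a linear functional
that is nonnegative on `V`. -/
def IsFace (V S : Finset E) : Prop :=
  S ⊆ V ∧ ∃ h : E →ₗ[ℝ] ℝ, ∀ v ∈ V, 0 ≤ h v ∧ (h v = 0 ↔ v ∈ S)

open Classical in
/-- The faces of corank one. -/
noncomputable def facets (V : Finset E) : Finset (Finset E) :=
  V.powerset.filter fun S => IsFace V S ∧ rk S + 1 = rk V

theorem mem_facets {V S : Finset E} : S ∈ facets V ↔ IsFace V S ∧ rk S + 1 = rk V := by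
  classical
  simp only [facets, Finset.mem_filter, Finset.mem_powerset]
  exact ⟨fun h => h.2, fun h => ⟨h.1.1, h⟩⟩

theorem rk_mono {S T : Finset E} (h : S ⊆ T) : rk S ≤ rk T := by
  unfold rk
  exact Submodule.finrank_mono (Submodule.span_mono (by exact_mod_cast h))

theorem rk_le_card (S : Finset E) : rk S ≤ S.card := finrank_span_finset_le_card S

theorem rk_empty : rk (∅ : Finset E) = 0 := by
  simp [rk]

theorem functional_zero_on_span {S : Finset E} {h : E →ₗ[ℝ] ℝ} (hS : ∀ v ∈ S, h v = 0) {x : E}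
    (hx : x ∈ Submodule.span ℝ (S : Set E)) : h x = 0 := by
  have : Submodule.span ℝ (S : Set E) ≤ LinearMap.ker h :=
    Submodule.span_le.2 fun v hv => hS v (by exact_mod_cast hv)
  exact this hx

theorem span_eq_of_rk_le {S T : Finset E} (h : S ⊆ T) (hr : rk T ≤ rk S) :
    Submodule.span ℝ (S : Set E) = Submodule.span ℝ (T : Set E) :=
  Submodule.eq_of_le_of_finrank_le (Submodule.span_mono (by exact_mod_cast h)) hr

theorem exists_functional {S : Finset E} {x : E} (hx : x ∉ Submodule.span ℝ (S : Set E)) :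
    ∃ f : E →ₗ[ℝ] ℝ, 0 < f x ∧ ∀ v ∈ S, f v = 0 := by
  obtain ⟨f, hf, hp⟩ := Submodule.exists_le_ker_of_notMem hx
  have hz : ∀ v ∈ S, f v = 0 := fun v hv => hp (Submodule.subset_span (by exact_mod_cast hv))
  rcases lt_or_gt_of_ne hf with h | h
  · exact ⟨-f, by simpa using h, fun v hv => by simp [hz v hv]⟩
  · exact ⟨f, h, hz⟩

theorem IsFace.self (V : Finset E) : IsFace V V :=
  ⟨Finset.Subset.refl _, 0, fun v hv => by simp [hv]⟩

theorem IsFace.mem_of_mem_span {V S : Finset E} (h : IsFace V S) {v : E} (hv : v ∈ V)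
    (hs : v ∈ Submodule.span ℝ (S : Set E)) : v ∈ S := by
  obtain ⟨hS, f, hf⟩ := h
  exact (hf v hv).2.1 (functional_zero_on_span (fun w hw => (hf w (hS hw)).2.2 hw) hs)

section Facets

variable [DecidableEq E]

theorem rk_union_le (S T : Finset E) : rk (S ∪ T) ≤ rk S + T.card := by
  refine le_trans ?_ (Nat.add_le_add_left (rk_le_card T) _)
  unfold rk
  rw [Finset.coe_union, Submodule.span_union]
  exact Submodule.finrank_add_le_finrank_add_finrank _ _

theorem rk_insert_le (S : Finset E) (x : E) : rk (insert x S) ≤ rk S + 1 := by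
  have h := rk_union_le S {x}
  rwa [Finset.union_comm, ← Finset.insert_eq, Finset.card_singleton] at h

theorem rk_le_inter_add (S T : Finset E) : rk S ≤ rk (S ∩ T) + (S \ T).card := by
  have h := rk_union_le (S ∩ T) (S \ T)
  rwa [Finset.union_comm, Finset.sdiff_union_inter] at h

theorem lt_rk_insert {S : Finset E} {x : E} (hx : x ∉ Submodule.span ℝ (S : Set E)) :
    rk S < rk (insert x S) := by
  by_contra hc
  have := span_eq_of_rk_le (Finset.subset_insert x S) (not_lt.1 hc)
  apply hx
  rw [this]
  exact Submodule.subset_span (by simp)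

theorem rk_insert {S : Finset E} {x : E} (hx : x ∉ Submodule.span ℝ (S : Set E)) :
    rk (insert x S) = rk S + 1 :=
  le_antisymm (rk_insert_le S x) (lt_rk_insert hx)

theorem IsFace.inter {V S T : Finset E} (hS : IsFace V S) (hT : IsFace V T) :
    IsFace V (S ∩ T) := by
  obtain ⟨hS, f, hf⟩ := hS
  obtain ⟨hT, g, hg⟩ := hT
  refine ⟨Finset.inter_subset_left.trans hS, f + g, fun v hv => ?_⟩
  have h1 := hf v hv
  have h2 := hg v hv
  rw [LinearMap.add_apply, Finset.mem_inter, ← h1.2, ← h2.2]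
  refine ⟨add_nonneg h1.1 h2.1, fun h => ?_, fun h => by rw [h.1, h.2, add_zero]⟩
  constructor <;> linarith [h1.1, h2.1]

theorem IsFace.restrict {V S W : Finset E} (hS : IsFace V S) (hW : W ⊆ V) :
    IsFace W (S ∩ W) := by
  obtain ⟨hS, f, hf⟩ := hS
  refine ⟨Finset.inter_subset_right, f, fun v hv => ⟨(hf v (hW hv)).1, ?_⟩⟩
  rw [(hf v (hW hv)).2]
  simp [hv]

theorem IsFace.restrict_of_subset {V S W : Finset E} (hS : IsFace V S) (hW : W ⊆ V) (h : S ⊆ W) :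
    IsFace W S := by
  have := hS.restrict hW
  rwa [Finset.inter_eq_left.2 h] at this

theorem IsFace.trans {V F S : Finset E} (hF : IsFace V F) (hS : IsFace F S) : IsFace V S := by
  obtain ⟨hF, f, hf⟩ := hF
  obtain ⟨hS, g, hg⟩ := hS
  have key : ∀ᶠ K : ℝ in Filter.atTop, ∀ v ∈ V, 0 < f v → 0 < K * f v + g v := by
    rw [Finset.eventually_all]
    intro v _
    by_cases h : 0 < f v
    · filter_upwards [Filter.eventually_gt_atTop (-g v / f v)] with K hK _
      rw [div_lt_iff₀ h] at hK
      linarith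
    · exact Filter.Eventually.of_forall fun K h' => absurd h' h
  obtain ⟨K, hK⟩ := key.exists
  refine ⟨hS.trans hF, K • f + g, fun v hv => ?_⟩
  simp only [LinearMap.add_apply, LinearMap.smul_apply, smul_eq_mul]
  by_cases hvF : v ∈ F
  · rw [(hf v hv).2.2 hvF, mul_zero, zero_add]
    exact hg v hvF
  · have h0 : 0 < f v := lt_of_le_of_ne (hf v hv).1 fun h => hvF ((hf v hv).2.1 h.symm)
    have := hK v hv h0
    exact ⟨this.le, fun h => by linarith, fun h => absurd (hS h) hvF⟩

theorem IsFace.rk_lt {V S : Finset E} (h : IsFace V S) (hne : S ≠ V) : rk S < rk V := by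
  obtain ⟨v, hv, hvS⟩ := Finset.exists_of_ssubset (h.1.ssubset_of_ne hne)
  have h1 : v ∉ Submodule.span ℝ (S : Set E) := fun hs => hvS (h.mem_of_mem_span hv hs)
  have h2 := lt_rk_insert h1
  exact h2.trans_le (rk_mono (Finset.insert_subset hv h.1))

theorem IsFace.eq_of_subset {V S T : Finset E} (hS : IsFace V S) (hT : T ⊆ V) (hST : S ⊆ T)
    (hr : rk T ≤ rk S) : S = T := by
  by_contra hne
  have := (hS.restrict_of_subset hT hST).rk_lt hne
  omega

theorem IsFace.exists_avoiding {V S : Finset E} (hS : IsFace V S) (hr : rk S + 2 ≤ rk V) {x : E}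
    (hx : x ∈ V) (hxS : x ∉ S) : ∃ T, IsFace V T ∧ S ⊂ T ∧ x ∉ T := by
  obtain ⟨y, hy, hys⟩ : ∃ y ∈ V, y ∉ Submodule.span ℝ ((insert x S : Finset E) : Set E) := by
    by_contra! hc
    have : rk V ≤ rk (insert x S) := Submodule.finrank_mono (Submodule.span_le.2 hc)
    have := rk_insert_le S x
    omega
  obtain ⟨k, hk, hk0⟩ := exists_functional hys
  obtain ⟨hSV, h, hh⟩ := hS
  obtain ⟨z, hz, hmin⟩ := Finset.exists_min_image (V.filter fun v => 0 < k v)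
    (fun v => h v / k v) ⟨y, by simp [hy, hk]⟩
  simp only [Finset.mem_filter] at hz hmin
  set t := h z / k z with ht
  have ht0 : 0 ≤ t := div_nonneg (hh z hz.1).1 hz.2.le
  refine ⟨V.filter fun v => h v = t * k v, ⟨Finset.filter_subset _ _, h - t • k, ?_⟩, ?_, ?_⟩
  · intro v hv
    simp only [LinearMap.sub_apply, LinearMap.smul_apply, smul_eq_mul, Finset.mem_filter, hv,
      true_and, sub_eq_zero, sub_nonneg]
    refine ⟨?_, trivial⟩
    by_cases hkv : 0 < k v
    · have := hmin v ⟨hv, hkv⟩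
      rwa [le_div_iff₀ hkv] at this
    · exact (mul_nonpos_of_nonneg_of_nonpos ht0 (not_lt.1 hkv)).trans (hh v hv).1
  · rw [Finset.ssubset_iff_of_subset]
    · refine ⟨z, ?_, ?_⟩
      · simp only [Finset.mem_filter, hz.1, true_and, ht]
        field_simp [hz.2.ne']
      · intro hzS
        have := hk0 z (Finset.mem_insert_of_mem hzS)
        linarith [hz.2]
    · intro v hv
      simp [hSV hv, hk0 v (Finset.mem_insert_of_mem hv), (hh v (hSV hv)).2.2 hv]
  · simp only [Finset.mem_filter, hx, true_and, hk0 x (Finset.mem_insert_self _ _), mul_zero]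
    rw [(hh x hx).2]
    exact hxS

theorem IsFace.exists_facet_avoiding {V S : Finset E} (hS : IsFace V S) {x : E}
    (hx : x ∈ V) (hxS : x ∉ S) : ∃ G ∈ facets V, S ⊆ G ∧ x ∉ G := by
  induction hn : V.card - S.card using Nat.strong_induction_on generalizing S with
  | _ n ih =>
    have hlt : rk S < rk V := hS.rk_lt fun h => hxS (h ▸ hx)
    by_cases hr : rk S + 1 = rk V
    · exact ⟨S, mem_facets.2 ⟨hS, hr⟩, Finset.Subset.refl _, hxS⟩
    · obtain ⟨T, hT, hST, hxT⟩ := hS.exists_avoiding (by omega) hx hxS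
      have h1 := Finset.card_lt_card hST
      have h2 := Finset.card_le_card hT.1
      obtain ⟨G, hG, hTG, hxG⟩ := ih _ (by omega) hT hxT rfl
      exact ⟨G, hG, hST.1.trans hTG, hxG⟩

theorem IsFace.exists_cover {V S : Finset E} (hS : IsFace V S) (hne : S ≠ V) :
    ∃ T, IsFace V T ∧ S ⊆ T ∧ rk T = rk S + 1 := by
  induction hn : V.card using Nat.strong_induction_on generalizing V with
  | _ n ih =>
    have hlt := hS.rk_lt hne
    by_cases hr : rk S + 1 = rk V
    · exact ⟨V, IsFace.self V, hS.1, hr.symm⟩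
    · obtain ⟨x, hx, hxS⟩ := Finset.exists_of_ssubset (hS.1.ssubset_of_ne hne)
      obtain ⟨T, hT, hST, hxT⟩ := hS.exists_avoiding (by omega) hx hxS
      have hc : T.card < V.card :=
        Finset.card_lt_card (hT.1.ssubset_of_ne fun h => hxT (h ▸ hx))
      obtain ⟨T', h1, h2, h3⟩ := ih T.card (by omega) (hS.restrict_of_subset hT.1 hST.1) hST.ne rfl
      exact ⟨T', hT.trans h1, h2, h3⟩

/-- The number of facets containing a given set. -/
noncomputable def deg (V S : Finset E) : ℕ := ((facets V).filter fun G => S ⊆ G).card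

theorem IsFace.rk_le_rk_add_deg {V S : Finset E} (hS : IsFace V S) : rk V ≤ rk S + deg V S := by
  induction hn : rk V - rk S using Nat.strong_induction_on generalizing S with
  | _ n ih =>
    by_cases hne : S = V
    · subst hne; omega
    · have hlt := hS.rk_lt hne
      obtain ⟨T, hT, hST, hrT⟩ := hS.exists_cover hne
      have h1 := ih _ (by omega) hT rfl
      obtain ⟨x, hx, hxS⟩ : ∃ x ∈ T, x ∉ S := by
        by_contra! hc
        have := rk_mono hc
        omega
      obtain ⟨G, hG, hSG, hxG⟩ := hS.exists_facet_avoiding (hT.1 hx) hxS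
      have : deg V T < deg V S := by
        refine Finset.card_lt_card ((Finset.ssubset_iff_of_subset ?_).2 ⟨G, ?_, ?_⟩)
        · intro H hH
          simp only [Finset.mem_filter] at hH ⊢
          exact ⟨hH.1, hST.trans hH.2⟩
        · simp [hG, hSG]
        · simp only [Finset.mem_filter, not_and]
          exact fun _ h => hxG (h hx)
      omega

theorem span_insert_of_rk {V S : Finset E} (hS : IsFace V S) (hr : rk V = rk S + 1) {x : E}
    (hx : x ∈ V) (hxS : x ∉ S) :
    Submodule.span ℝ ((insert x S : Finset E) : Set E) = Submodule.span ℝ (V : Set E) := by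
  refine span_eq_of_rk_le (Finset.insert_subset hx hS.1) ?_
  rw [rk_insert fun h => hxS (hS.mem_of_mem_span hx h), hr]

/-- Diamond property, existence. -/
theorem exists_other_facet {V S T : Finset E} (hS : IsFace V S) (hr : rk V = rk S + 2)
    (hT : T ∈ facets V) (hST : S ⊆ T) : ∃ G ∈ facets V, G ≠ T ∧ S ⊆ G ∧ G ∩ T = S := by
  obtain ⟨hTf, hTr⟩ := mem_facets.1 hT
  have hne : ¬ T ⊆ S := fun h => by have := rk_mono h; omega
  obtain ⟨x, hx, hxS⟩ := Finset.not_subset.1 hne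
  obtain ⟨G, hG, hSG, hxG⟩ := hS.exists_facet_avoiding (hTf.1 hx) hxS
  by_cases hGT : rk (G ∩ T) ≤ rk S
  · refine ⟨G, hG, fun h => hxG (h ▸ hx), hSG, ?_⟩
    exact (hS.eq_of_subset (Finset.inter_subset_right.trans hTf.1)
      (Finset.subset_inter hSG hST) hGT).symm
  · exfalso
    have h1 := ((mem_facets.1 hG).1.inter hTf).eq_of_subset hTf.1 Finset.inter_subset_right
      (by omega)
    exact hxG (Finset.inter_subset_left (h1 ▸ hx))

theorem inter_eq_of_facets {V S T G : Finset E} (hS : IsFace V S) (hr : rk V = rk S + 2)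
    (hT : T ∈ facets V) (hG : G ∈ facets V) (hne : G ≠ T) (hST : S ⊆ T) (hSG : S ⊆ G) :
    G ∩ T = S := by
  obtain ⟨hTf, hTr⟩ := mem_facets.1 hT
  obtain ⟨hGf, hGr⟩ := mem_facets.1 hG
  have hf := hGf.inter hTf
  refine (hS.eq_of_subset hf.1 (Finset.subset_inter hSG hST) ?_).symm
  by_contra hc
  have h1 := hf.eq_of_subset hTf.1 Finset.inter_subset_right (by omega)
  have h2 := hf.eq_of_subset hGf.1 Finset.inter_subset_left (by omega)
  exact hne (h2.symm.trans h1)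

/-- Diamond property, uniqueness. -/
theorem unique_other_facet {V S T₁ T₂ T₃ : Finset E} (hS : IsFace V S) (hr : rk V = rk S + 2)
    (h1 : T₁ ∈ facets V) (h2 : T₂ ∈ facets V) (h3 : T₃ ∈ facets V) (s1 : S ⊆ T₁) (s2 : S ⊆ T₂)
    (s3 : S ⊆ T₃) (h21 : T₂ ≠ T₁) (h31 : T₃ ≠ T₁) : T₂ = T₃ := by
  by_contra h23
  have e21 := inter_eq_of_facets hS hr h1 h2 h21 s1 s2
  have e31 := inter_eq_of_facets hS hr h1 h3 h31 s1 s3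
  have e23 := inter_eq_of_facets hS hr h3 h2 h23 s3 s2
  have pick : ∀ T ∈ facets V, ∃ x ∈ T, x ∉ S := by
    intro T hT
    have hTr := (mem_facets.1 hT).2
    refine Finset.not_subset.1 fun h => ?_
    have := rk_mono h; omega
  obtain ⟨x, hx, hxS⟩ := pick _ h1
  obtain ⟨y, hy, hyS⟩ := pick _ h2
  obtain ⟨z, hz, hzS⟩ := pick _ h3
  obtain ⟨f1, r1⟩ := mem_facets.1 h1
  obtain ⟨f2, r2⟩ := mem_facets.1 h2
  obtain ⟨f3, r3⟩ := mem_facets.1 h3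
  have hy1 : y ∉ T₁ := fun h => hyS (e21 ▸ Finset.mem_inter.2 ⟨hy, h⟩)
  have hz1 : z ∉ T₁ := fun h => hzS (e31 ▸ Finset.mem_inter.2 ⟨hz, h⟩)
  have hy3 : y ∉ T₃ := fun h => hyS (e23 ▸ Finset.mem_inter.2 ⟨hy, h⟩)
  have hz2 : z ∉ T₂ := fun h => hzS (e23 ▸ Finset.mem_inter.2 ⟨h, hz⟩)
  have hx2 : x ∉ T₂ := fun h => hxS (e21 ▸ Finset.mem_inter.2 ⟨h, hx⟩)
  have hx3 : x ∉ T₃ := fun h => hxS (e31 ▸ Finset.mem_inter.2 ⟨h, hx⟩)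
  have hzV : z ∈ Submodule.span ℝ ((insert y T₁ : Finset E) : Set E) := by
    rw [span_insert_of_rk f1 r1.symm (f2.1 hy) hy1]
    exact Submodule.subset_span (by exact_mod_cast f3.1 hz)
  rw [Finset.coe_insert, Submodule.mem_span_insert] at hzV
  obtain ⟨b, w, hw, hzw⟩ := hzV
  rw [← span_insert_of_rk (hS.restrict_of_subset f1.1 s1) (by omega) hx hxS, Finset.coe_insert,
    Submodule.mem_span_insert] at hw
  obtain ⟨a, s, hs, hws⟩ := hw
  obtain ⟨_, g1, hg1⟩ := f1
  obtain ⟨_, g2, hg2⟩ := f2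
  obtain ⟨_, g3, hg3⟩ := f3
  have pos : ∀ {g : E →ₗ[ℝ] ℝ} {T : Finset E}, (∀ v ∈ V, 0 ≤ g v ∧ (g v = 0 ↔ v ∈ T)) →
      ∀ v ∈ V, v ∉ T → 0 < g v := fun hg v hv hvT =>
    lt_of_le_of_ne (hg v hv).1 fun h => hvT ((hg v hv).2.1 h.symm)
  have m1 := (mem_facets.1 h1).1.1
  have m2 := (mem_facets.1 h2).1.1
  have m3 := (mem_facets.1 h3).1.1
  have z1 : g1 s = 0 := functional_zero_on_span (fun v hv => (hg1 v (m1 (s1 hv))).2.2 (s1 hv)) hs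
  have z2 : g2 s = 0 := functional_zero_on_span (fun v hv => (hg2 v (m2 (s2 hv))).2.2 (s2 hv)) hs
  have z3 : g3 s = 0 := functional_zero_on_span (fun v hv => (hg3 v (m3 (s3 hv))).2.2 (s3 hv)) hs
  have hzz : z = b • y + (a • x + s) := by rw [hzw, hws]
  have q1 : g1 z = b * g1 y := by
    rw [hzz]; simp [z1, (hg1 x (m1 hx)).2.2 hx]
  have q2 : g2 z = a * g2 x := by
    rw [hzz]; simp [z2, (hg2 y (m2 hy)).2.2 hy]
  have q3 : g3 z = b * g3 y + a * g3 x := by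
    rw [hzz]; simp [z3]
  have hb : 0 < b := by
    have hp := pos hg1 z (m3 hz) hz1
    rw [q1] at hp
    exact pos_of_mul_pos_left hp (pos hg1 y (m2 hy) hy1).le
  have ha : 0 < a := by
    have hp := pos hg2 z (m3 hz) hz2
    rw [q2] at hp
    exact pos_of_mul_pos_left hp (pos hg2 x (m1 hx) hx2).le
  have : 0 < g3 z := by
    rw [q3]
    exact add_pos (mul_pos hb (pos hg3 y (m2 hy) hy3)) (mul_pos ha (pos hg3 x (m1 hx) hx3))
  rw [(hg3 z (m3 hz)).2.2 hz] at this
  exact lt_irrefl _ this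

end Facets
end FaceCone

namespace FaceCone

variable {E : Type*} [AddCommGroup E] [Module ℝ E]

theorem facets_subset {V G : Finset E} (hG : G ∈ facets V) : G ⊆ V := (mem_facets.1 hG).1.1

theorem facets_isFace {V G : Finset E} (hG : G ∈ facets V) : IsFace V G := (mem_facets.1 hG).1

theorem facets_rk {V G : Finset E} (hG : G ∈ facets V) : rk G + 1 = rk V := (mem_facets.1 hG).2

section Adjacency

variable [DecidableEq E]

theorem facets_eq_of_subset {V G H : Finset E} (hG : G ∈ facets V) (hH : H ∈ facets V)
    (h : G ⊆ H) : G = H := by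
  refine (facets_isFace hG).eq_of_subset (facets_subset hH) h ?_
  have := facets_rk hG
  have := facets_rk hH
  omega

theorem facets_ne_self {V G : Finset E} (hG : G ∈ facets V) : G ≠ V := by
  rintro rfl
  have := facets_rk hG
  omega

theorem facets_antichain {V G H : Finset E} (hG : G ∈ facets V) (hH : H ∈ facets V)
    (hne : G ≠ H) : ∃ x ∈ G, x ∉ H :=
  Finset.not_subset.1 fun h => hne (facets_eq_of_subset hG hH h)

theorem facets_card {V G : Finset E} (hG : G ∈ facets V) : rk V ≤ G.card + 1 := by
  have := facets_rk hG
  have := rk_le_card G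
  omega

/-- `G` and `F` meet in a ridge. -/
theorem exists_opp {V F R : Finset E} (hF : F ∈ facets V) (hR : R ∈ facets F) :
    ∃ G ∈ facets V, G ≠ F ∧ G ∩ F = R := by
  have hRf : IsFace V R := (facets_isFace hF).trans (facets_isFace hR)
  obtain ⟨G, hG, hne, -, h⟩ := exists_other_facet hRf
    (by have := facets_rk hF; have := facets_rk hR; omega) hF (facets_subset hR)
  exact ⟨G, hG, hne, h⟩

theorem opp_unique {V F R G H : Finset E} (hF : F ∈ facets V) (hR : R ∈ facets F)
    (hG : G ∈ facets V) (hGF : G ≠ F) (hRG : R ⊆ G) (hH : H ∈ facets V) (hHF : H ≠ F)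
    (hRH : R ⊆ H) : G = H := by
  have hRf : IsFace V R := (facets_isFace hF).trans (facets_isFace hR)
  exact unique_other_facet hRf
    (by have := facets_rk hF; have := facets_rk hR; omega) hF hG hH (facets_subset hR) hRG hRH
    hGF hHF

open Classical in
/-- The facet of `V` other than `F` that contains the ridge `R` of `V` in `F`. -/
noncomputable def opp (V F R : Finset E) : Finset E :=
  if h : ∃ G ∈ facets V, G ≠ F ∧ G ∩ F = R then h.choose else ∅

theorem opp_spec {V F R : Finset E} (hF : F ∈ facets V) (hR : R ∈ facets F) : opp V F R ∈ facets V ∧ opp V F R ≠ F ∧ opp V F R ∩ F = R := by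
  have h := exists_opp hF hR
  rw [opp, dif_pos h]
  exact h.choose_spec

theorem opp_mem {V F R : Finset E} (hF : F ∈ facets V) (hR : R ∈ facets F) : opp V F R ∈ facets V := (opp_spec hF hR).1

theorem opp_ne {V F R : Finset E} (hF : F ∈ facets V) (hR : R ∈ facets F) : opp V F R ≠ F := (opp_spec hF hR).2.1

theorem opp_inter {V F R : Finset E} (hF : F ∈ facets V) (hR : R ∈ facets F) : opp V F R ∩ F = R := (opp_spec hF hR).2.2

theorem subset_opp {V F R : Finset E} (hF : F ∈ facets V) (hR : R ∈ facets F) : R ⊆ opp V F R := by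
  conv_lhs => rw [← opp_inter hF hR]
  exact Finset.inter_subset_left

theorem eq_opp {V F R : Finset E} (hF : F ∈ facets V) (hR : R ∈ facets F) {G : Finset E} (hG : G ∈ facets V) (hne : G ≠ F) (h : R ⊆ G) :
    G = opp V F R :=
  opp_unique hF hR hG hne h (opp_mem hF hR) (opp_ne hF hR) (subset_opp hF hR)

theorem mem_opp_iff {V F R : Finset E} (hF : F ∈ facets V) (hR : R ∈ facets F) {x : E} (hx : x ∈ F) : x ∈ opp V F R ↔ x ∈ R := by
  conv_rhs => rw [← opp_inter hF hR]
  simp [hx]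

theorem ne_of_inter_mem_facets {F G : Finset E} (h : G ∩ F ∈ facets F) : G ≠ F := by
  rintro rfl
  rw [Finset.inter_self] at h
  exact facets_ne_self h rfl

theorem opp_inter_self {V F G : Finset E} (hF : F ∈ facets V) (hG : G ∈ facets V)
    (h : G ∩ F ∈ facets F) : opp V F (G ∩ F) = G :=
  (eq_opp hF h hG (ne_of_inter_mem_facets h) Finset.inter_subset_left).symm

/-- The facets of `V` adjacent to `F`. -/
noncomputable def adj (V F : Finset E) : Finset (Finset E) :=
  (facets V).filter fun G => G ∩ F ∈ facets F

/-- The facets of `V` other than `F` not adjacent to `F`. -/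
noncomputable def nadj (V F : Finset E) : Finset (Finset E) :=
  (facets V).filter fun G => G ≠ F ∧ G ∩ F ∉ facets F

theorem mem_adj {V F G : Finset E} : G ∈ adj V F ↔ G ∈ facets V ∧ G ∩ F ∈ facets F := by
  simp [adj]

theorem mem_nadj {V F G : Finset E} :
    G ∈ nadj V F ↔ G ∈ facets V ∧ G ≠ F ∧ G ∩ F ∉ facets F := by
  simp [nadj]

theorem opp_mem_adj {V F R : Finset E} (hF : F ∈ facets V) (hR : R ∈ facets F) :
    opp V F R ∈ adj V F :=
  mem_adj.2 ⟨opp_mem hF hR, by rwa [opp_inter hF hR]⟩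

theorem adj_symm {V F G : Finset E} (hF : F ∈ facets V) (hG : G ∈ adj V F) : F ∈ adj V G := by
  obtain ⟨h1, h2⟩ := mem_adj.1 hG
  refine mem_adj.2 ⟨hF, mem_facets.2 ⟨?_, ?_⟩⟩
  · exact (facets_isFace hF).restrict (facets_subset h1)
  · rw [Finset.inter_comm]
    have := facets_rk h2
    have := facets_rk h1
    have := facets_rk hF
    omega

theorem sum_facets {M : Type*} [AddCommMonoid M] {V F : Finset E} (hF : F ∈ facets V)
    (φ : Finset E → M) :
    ∑ G ∈ facets V, φ G = φ F + ∑ R ∈ facets F, φ (opp V F R) + ∑ G ∈ nadj V F, φ G := by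
  have h1 : facets V = insert F (adj V F ∪ nadj V F) := by
    ext G
    simp only [Finset.mem_insert, Finset.mem_union, mem_adj, mem_nadj]
    constructor
    · intro h
      tauto
    · rintro (rfl | h | h)
      exacts [hF, h.1, h.1]
  have hFn : F ∉ adj V F ∪ nadj V F := by
    simp only [Finset.mem_union, mem_adj, mem_nadj, Finset.inter_self]
    rintro (h | h)
    · exact facets_ne_self h.2 rfl
    · exact h.2.1 rfl
  have hd : Disjoint (adj V F) (nadj V F) := by
    rw [Finset.disjoint_left]
    intro G h1 h2
    exact (mem_nadj.1 h2).2.2 (mem_adj.1 h1).2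
  rw [h1, Finset.sum_insert hFn, Finset.sum_union hd, add_assoc]
  congr 2
  refine Finset.sum_nbij' (fun G => G ∩ F) (fun R => opp V F R) ?_ ?_ ?_ ?_ ?_
  · exact fun G hG => (mem_adj.1 hG).2
  · exact fun R hR => opp_mem_adj hF hR
  · exact fun G hG => opp_inter_self hF (mem_adj.1 hG).1 (mem_adj.1 hG).2
  · exact fun R hR => opp_inter hF hR
  · exact fun G hG => by rw [opp_inter_self hF (mem_adj.1 hG).1 (mem_adj.1 hG).2]

theorem card_facets_eq {V F : Finset E} (hF : F ∈ facets V) :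
    (facets V).card = 1 + (facets F).card + (nadj V F).card := by
  have h := sum_facets hF (fun _ => 1)
  simpa using h

theorem deg_eq {V F S : Finset E} (hF : F ∈ facets V) (hS : S ⊆ F) :
    deg V S = 1 + deg F S + ((nadj V F).filter fun G => S ⊆ G).card := by
  unfold deg
  simp only [Finset.card_filter]
  rw [sum_facets hF, if_pos hS]
  congr 2
  refine Finset.sum_congr rfl fun R hR => ?_
  have : S ⊆ opp V F R ↔ S ⊆ R := by
    constructor
    · intro h
      rw [← opp_inter hF hR]
      exact Finset.subset_inter h hS
    · exact fun h => h.trans (subset_opp hF hR)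
  simp only [this]

theorem le_deg_of_subset {V F S : Finset E} (hF : F ∈ facets V) (hS : S ⊆ F) :
    1 + deg F S ≤ deg V S := by
  rw [deg_eq hF hS]; omega

theorem sum_card_pairs (V : Finset E) (D : Finset (E × E)) :
    ∑ G ∈ facets V, (D.filter fun p => p.1 ∈ G ∧ p.2 ∈ G).card =
      ∑ p ∈ D, deg V {p.1, p.2} := by
  unfold deg
  simp only [Finset.card_filter]
  rw [Finset.sum_comm]
  simp [Finset.insert_subset_iff]

theorem sum_offDiag (V X : Finset E) :
    ∑ G ∈ facets V, ((X ∩ G).card * (X ∩ G).card - (X ∩ G).card) =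
      ∑ p ∈ X.offDiag, deg V {p.1, p.2} := by
  rw [← sum_card_pairs]
  refine Finset.sum_congr rfl fun G _ => ?_
  rw [← Finset.offDiag_card]
  congr 1
  ext ⟨a, b⟩
  simp only [Finset.mem_offDiag, Finset.mem_inter, Finset.mem_filter]
  tauto

theorem sum_product (V X Y : Finset E) :
    ∑ G ∈ facets V, (X ∩ G).card * (Y ∩ G).card = ∑ p ∈ X ×ˢ Y, deg V {p.1, p.2} := by
  rw [← sum_card_pairs]
  refine Finset.sum_congr rfl fun G _ => ?_
  rw [← Finset.card_product]
  congr 1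
  ext ⟨a, b⟩
  simp only [Finset.mem_product, Finset.mem_inter, Finset.mem_filter]
  tauto

/-- A facet with at most one vertex outside `F` is adjacent to `F`. -/
theorem inter_mem_facets {V F G : Finset E} (hF : F ∈ facets V) (hG : G ∈ facets V)
    (hne : G ≠ F) (h : (G \ F).card ≤ 1) : G ∩ F ∈ facets F := by
  have hf : IsFace F (G ∩ F) := (facets_isFace hG).restrict (facets_subset hF)
  have h1 := rk_le_inter_add G F
  have h2 : G ∩ F ≠ F := fun hc =>
    hne (facets_eq_of_subset hF hG (Finset.inter_eq_right.1 hc)).symm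
  have := hf.rk_lt h2
  have := facets_rk hF
  have := facets_rk hG
  exact mem_facets.2 ⟨hf, by omega⟩

theorem two_le_card_sdiff {V F G : Finset E} (hF : F ∈ facets V) (hG : G ∈ nadj V F) :
    2 ≤ (G \ F).card := by
  obtain ⟨h1, h2, h3⟩ := mem_nadj.1 hG
  by_contra hc
  exact h3 (inter_mem_facets hF h1 h2 (by omega))

/-- If two facets adjacent to `F` over ridges that meet in corank two have no common vertex outside
`F`, then some facet not adjacent to `F` meets `F` in the intersection of these ridges. -/
theorem exists_nadj_of_conflict {V F R₁ R₂ : Finset E} (hF : F ∈ facets V) (h1 : R₁ ∈ facets F)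
    (h2 : R₂ ∈ facets F) (hne : R₁ ≠ R₂) (hr : rk (R₁ ∩ R₂) + 2 = rk F)
    (hc : opp V F R₁ ∩ opp V F R₂ ⊆ F) : ∃ H ∈ nadj V F, H ∩ F = R₁ ∩ R₂ := by
  have g1 := opp_mem hF h1
  have g2 := opp_mem hF h2
  set G₁ := opp V F R₁ with hG1
  set G₂ := opp V F R₂ with hG2
  have i1 : G₁ ∩ F = R₁ := opp_inter hF h1
  have i2 : G₂ ∩ F = R₂ := opp_inter hF h2
  set S := R₁ ∩ R₂ with hS
  have hSe : G₁ ∩ G₂ = S := by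
    rw [hS, ← i1, ← i2]
    ext x
    simp only [Finset.mem_inter]
    constructor
    · intro h
      have := hc (Finset.mem_inter.2 h)
      tauto
    · tauto
  have hSF : IsFace F S := (facets_isFace h1).inter (facets_isFace h2)
  have hSV : IsFace V S := (facets_isFace hF).trans hSF
  have sG1 : S ⊆ G₁ := hSe ▸ Finset.inter_subset_left
  have sR1 : S ⊆ R₁ := Finset.inter_subset_left
  have sR2 : S ⊆ R₂ := Finset.inter_subset_right
  have rF := facets_rk hF
  have rG1 := facets_rk g1
  have hR1G : R₁ ∈ facets G₁ := by
    have := adj_symm hF (mem_adj.2 ⟨g1, by rwa [i1]⟩)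
    rw [← i1, Finset.inter_comm]
    exact (mem_adj.1 this).2
  obtain ⟨R', hR', hR'ne, sR', hR'i⟩ :=
    exists_other_facet (hSV.restrict_of_subset (facets_subset g1) sG1) (by omega) hR1G sR1
  obtain ⟨H, hH, hHne, hHi⟩ := exists_opp g1 hR'
  have hR'F : ¬ R' ⊆ F := by
    intro h
    have : R' ⊆ R₁ := by
      rw [← i1]
      exact Finset.subset_inter (facets_subset hR') h
    exact hR'ne (facets_eq_of_subset hR' hR1G this)
  have hR'H : R' ⊆ H := hHi ▸ Finset.inter_subset_left
  have hHF : H ≠ F := fun h => hR'F (h ▸ hR'H)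
  have hHG2 : H ≠ G₂ := by
    intro h
    rw [h, Finset.inter_comm, hSe] at hHi
    have := facets_rk hR'
    rw [← hHi] at this
    omega
  have sHF : S ⊆ H ∩ F := Finset.subset_inter (sR'.trans hR'H) hSF.1
  have hnf : H ∩ F ∉ facets F := by
    intro hf
    by_cases h : H ∩ F = R₁
    · have := eq_opp hF h1 hH hHF (h ▸ Finset.inter_subset_left)
      exact hHne this
    · have := unique_other_facet hSF hr.symm h1 hf h2 sR1 sHF sR2 h (fun h => hne h.symm)
      exact hHG2 (eq_opp hF h2 hH hHF (this ▸ Finset.inter_subset_left))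
  refine ⟨H, mem_nadj.2 ⟨hH, hHF, hnf⟩, ?_⟩
  have hHFf : IsFace F (H ∩ F) := (facets_isFace hH).restrict (facets_subset hF)
  have hlt : rk (H ∩ F) < rk F := hHFf.rk_lt fun h =>
    hHF (facets_eq_of_subset hF hH (Finset.inter_eq_right.1 h)).symm
  have : rk (H ∩ F) + 1 ≠ rk F := fun h => hnf (mem_facets.2 ⟨hHFf, h⟩)
  exact (hSF.eq_of_subset hHFf.1 sHF (by omega)).symm

theorem rk_inter_of_sdiff {F R₁ R₂ : Finset E} (h1 : R₁ ∈ facets F)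
    (h2 : R₂ ∈ facets F) (hne : R₁ ≠ R₂) (hc : (R₁ \ R₂).card ≤ 1) :
    rk (R₁ ∩ R₂) + 2 = rk F := by
  have a1 := facets_rk h1
  have a2 := facets_rk h2
  have a3 := rk_le_inter_add R₁ R₂
  have : rk (R₁ ∩ R₂) < rk R₁ := by
    by_contra hcon
    have hi := ((facets_isFace h1).inter (facets_isFace h2)).eq_of_subset (facets_subset h1)
      Finset.inter_subset_left (not_lt.1 hcon)
    exact hne (facets_eq_of_subset h1 h2 (Finset.inter_eq_left.1 hi))
  omega

/-- The empty set and all vertices and pairs of vertices are faces. -/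
def Good (V : Finset E) : Prop :=
  IsFace V ∅ ∧ ∀ x ∈ V, ∀ y ∈ V, IsFace V {x, y}

theorem Good.mono {V W : Finset E} (h : Good V) (hW : W ⊆ V) : Good W := by
  refine ⟨by simpa using h.1.restrict hW, fun x hx y hy => ?_⟩
  refine (h.2 x (hW hx) y (hW hy)).restrict_of_subset hW ?_
  simp [Finset.insert_subset_iff, hx, hy]

theorem Good.le_deg {V : Finset E} (h : Good V) {x y : E} (hx : x ∈ V) (hy : y ∈ V) :
    rk V ≤ deg V {x, y} + 2 := by
  have h1 := (h.2 x hx y hy).rk_le_rk_add_deg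
  have h2 := rk_le_card ({x, y} : Finset E)
  have h3 : ({x, y} : Finset E).card ≤ 2 := Finset.card_le_two
  omega

theorem Good.exists_facet_avoiding {V : Finset E} (h : Good V) {x y z : E} (hx : x ∈ V)
    (hy : y ∈ V) (hz : z ∈ V) (hzx : z ≠ x) (hzy : z ≠ y) :
    ∃ G ∈ facets V, x ∈ G ∧ y ∈ G ∧ z ∉ G := by
  obtain ⟨G, hG, hs, hzG⟩ := (h.2 x hx y hy).exists_facet_avoiding hz (by simp [hzx, hzy])
  rw [Finset.insert_subset_iff, Finset.singleton_subset_iff] at hs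
  exact ⟨G, hG, hs.1, hs.2, hzG⟩

end Adjacency
end FaceCone

namespace FaceCone

variable {E : Type*} [AddCommGroup E] [Module ℝ E]

section Gale

variable [DecidableEq E]

theorem notMem_span_erase {S : Finset E} (hS : S.card ≤ rk S) {v : E} (hv : v ∈ S) :
    v ∉ Submodule.span ℝ ((S.erase v : Finset E) : Set E) := by
  intro h
  have h1 : rk S ≤ rk (S.erase v) := by
    refine Submodule.finrank_mono (Submodule.span_le.2 fun w hw => ?_)
    by_cases hwv : w = v
    · exact hwv ▸ h
    · exact Submodule.subset_span (by simp_all)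
  have h2 := rk_le_card (S.erase v)
  rw [Finset.card_erase_of_mem hv] at h2
  have := Finset.card_pos.2 ⟨v, hv⟩
  omega

theorem rk_erase_of_mem_span {S : Finset E} {v : E}
    (h : v ∈ Submodule.span ℝ ((S.erase v : Finset E) : Set E)) : rk (S.erase v) = rk S := by
  refine le_antisymm (rk_mono (Finset.erase_subset _ _)) ?_
  refine Submodule.finrank_mono (Submodule.span_le.2 fun w hw => ?_)
  by_cases hwv : w = v
  · exact hwv ▸ h
  · exact Submodule.subset_span (by simp_all)

theorem card_le_rk_of_subset {S T : Finset E} (hT : T.card ≤ rk T) (h : S ⊆ T) :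
    S.card ≤ rk S := by
  have h1 := rk_le_inter_add T S
  rw [Finset.inter_eq_right.2 h] at h1
  have := Finset.card_sdiff_add_card_eq_card h
  omega

theorem mem_span_erase {S : Finset E} {l : E → ℝ} (hl : ∑ v ∈ S, l v • v = 0) {v : E} (hv : v ∈ S)
    (hlv : l v ≠ 0) : v ∈ Submodule.span ℝ ((S.erase v : Finset E) : Set E) := by
  rw [← Finset.add_sum_erase _ _ hv] at hl
  have h1 : v = -(l v)⁻¹ • ∑ w ∈ S.erase v, l w • w := by
    rw [eq_neg_of_add_eq_zero_right hl, neg_smul, smul_neg, neg_neg, smul_smul,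
      inv_mul_cancel₀ hlv, one_smul]
  have h2 : -(l v)⁻¹ • ∑ w ∈ S.erase v, l w • w ∈
      Submodule.span ℝ ((S.erase v : Finset E) : Set E) :=
    Submodule.smul_mem _ _ (Submodule.sum_mem _ fun w hw => Submodule.smul_mem _ _
      (Submodule.subset_span (by exact_mod_cast hw)))
  rwa [← h1] at h2

theorem exists_relation {S : Finset E} (h : rk S < S.card) :
    ∃ l : E → ℝ, ∑ v ∈ S, l v • v = 0 ∧ ∃ v ∈ S, l v ≠ 0 := by
  by_contra! hc
  have hi : LinearIndepOn ℝ id (S : Set E) := by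
    rw [linearIndepOn_finset_iff]
    exact fun g hg => hc g hg
  have := finrank_span_finset_eq_card hi
  exact h.ne this

theorem relation_zero {S : Finset E} {l h : E → ℝ} (hl : ∑ v ∈ S, l v * h v = 0)
    (hh : ∀ v ∈ S, 0 ≤ h v) (hp : ∀ v ∈ S, 0 < l v → h v = 0) :
    ∀ v ∈ S, l v < 0 → h v = 0 := by
  have h1 : ∀ v ∈ S, l v * h v ≤ 0 := by
    intro v hv
    rcases lt_or_ge 0 (l v) with h0 | h0
    · rw [hp v hv h0, mul_zero]
    · exact mul_nonpos_of_nonpos_of_nonneg h0 (hh v hv)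
  intro v hv hlv
  have := (Finset.sum_eq_zero_iff_of_nonpos h1).1 hl v hv
  exact (mul_eq_zero.1 this).resolve_left hlv.ne

/-- The combinatorial type of a 2-neighborly configuration with one vertex more than its rank. -/
structure GaleType (F A B C : Finset E) : Prop where
  card_eq : F.card = rk F + 1
  union_eq : A ∪ B ∪ C = F
  disjoint_AB : Disjoint A B
  disjoint_AC : Disjoint A C
  disjoint_BC : Disjoint B C
  three_le_A : 3 ≤ A.card
  three_le_B : 3 ≤ B.card
  mem_facets_iff : ∀ S, S ∈ facets F ↔
    (∃ a ∈ A, ∃ b ∈ B, S = (F.erase a).erase b) ∨ ∃ c ∈ C, S = F.erase c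

theorem pos_part_card {F : Finset E} (hF : Good F) {l : E → ℝ}
    (hl : ∀ h : E →ₗ[ℝ] ℝ, ∑ v ∈ F, l v * h v = 0) (hne : ∃ v ∈ F, l v ≠ 0) :
    3 ≤ (F.filter fun v => 0 < l v).card := by
  set A := F.filter fun v => 0 < l v with hA
  set B := F.filter fun v => l v < 0 with hB
  have neg : ∀ h : E →ₗ[ℝ] ℝ, ∑ v ∈ F, (-l v) * h v = 0 := by
    intro h
    simpa using hl h
  have hdis : Disjoint A B := by
    rw [Finset.disjoint_left]
    intro v h1 h2
    simp only [hA, hB, Finset.mem_filter] at h1 h2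
    linarith
  have face1 : ∀ T, IsFace F T → A ⊆ T → B ⊆ T := by
    rintro T ⟨hT, h, hh⟩ hAT v hv
    simp only [hB, Finset.mem_filter] at hv
    refine (hh v hv.1).2.1 (relation_zero (hl h) (fun w hw => (hh w hw).1) (fun w hw hlw => ?_)
      v hv.1 hv.2)
    exact (hh w hw).2.2 (hAT (by simp [hA, hw, hlw]))
  have face2 : ∀ T, IsFace F T → B ⊆ T → A ⊆ T := by
    rintro T ⟨hT, h, hh⟩ hBT v hv
    simp only [hA, Finset.mem_filter] at hv
    refine (hh v hv.1).2.1 (relation_zero (neg h) (fun w hw => (hh w hw).1) (fun w hw hlw => ?_)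
      v hv.1 (by linarith [hv.2]))
    exact (hh w hw).2.2 (hBT (by simp only [hB, Finset.mem_filter, hw, true_and]; linarith))
  have hAF : A ⊆ F := Finset.filter_subset _ _
  have hBF : B ⊆ F := Finset.filter_subset _ _
  have hAne : A.Nonempty := by
    by_contra hc
    rw [Finset.not_nonempty_iff_eq_empty] at hc
    have hBe := face1 ∅ hF.1 (by rw [hc])
    obtain ⟨v, hv, hlv⟩ := hne
    rcases lt_or_gt_of_ne hlv with h | h
    · exact absurd (hBe (show v ∈ B by simp [hB, hv, h])) (by simp)
    · exact absurd (hc ▸ (show v ∈ A by simp [hA, hv, h])) (by simp)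
  have hBne : B.Nonempty := by
    by_contra hc
    rw [Finset.not_nonempty_iff_eq_empty] at hc
    obtain ⟨v, hv⟩ := hAne
    exact absurd (face2 ∅ hF.1 (by rw [hc]) hv) (by simp)
  by_contra hcard
  have hAxy : ∃ x ∈ F, ∃ y ∈ F, A = {x, y} := by
    have : A.card = 1 ∨ A.card = 2 := by
      have := hAne.card_pos
      omega
    rcases this with h | h
    · obtain ⟨x, hx⟩ := Finset.card_eq_one.1 h
      have : x ∈ F := hAF (by simp [hx])
      exact ⟨x, this, x, this, by simpa using hx⟩
    · obtain ⟨x, y, -, hx⟩ := Finset.card_eq_two.1 h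
      exact ⟨x, hAF (by simp [hx]), y, hAF (by simp [hx]), hx⟩
  obtain ⟨x, hx, y, hy, hxy⟩ := hAxy
  have hBA : B ⊆ A := by
    rw [hxy]
    exact face1 _ (hF.2 x hx y hy) hxy.le
  obtain ⟨v, hv⟩ := hBne
  exact Finset.disjoint_left.1 hdis (hBA hv) hv

theorem Good.exists_galeType {F : Finset E} (hF : Good F) (hc : F.card = rk F + 1) :
    ∃ A B C, GaleType F A B C := by
  obtain ⟨l, hl, hne⟩ := exists_relation (S := F) (by omega)
  have hlh : ∀ h : E →ₗ[ℝ] ℝ, ∑ v ∈ F, l v * h v = 0 := by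
    intro h
    have := congrArg h hl
    simpa using this
  have hlh' : ∀ h : E →ₗ[ℝ] ℝ, ∑ v ∈ F, (-l v) * h v = 0 := by
    intro h
    simpa using hlh h
  have indep : ∀ v ∈ F, l v ≠ 0 → (F.erase v).card ≤ rk (F.erase v) := by
    intro v hv hlv
    rw [rk_erase_of_mem_span (mem_span_erase hl hv hlv), Finset.card_erase_of_mem hv]
    omega
  have apex : ∀ v ∈ F, l v = 0 → v ∉ Submodule.span ℝ ((F.erase v : Finset E) : Set E) := by
    intro v hv hlv hs
    obtain ⟨w, hw, hlw⟩ := hne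
    have hwv : w ≠ v := by rintro rfl; exact hlw hlv
    have h1 : ∑ u ∈ F.erase v, l u • u = 0 := by
      rw [← Finset.add_sum_erase _ _ hv, hlv, zero_smul, zero_add] at hl
      exact hl
    have hwe : w ∈ F.erase v := Finset.mem_erase.2 ⟨hwv, hw⟩
    have h2 := rk_erase_of_mem_span (mem_span_erase h1 hwe hlw)
    have h3 := rk_erase_of_mem_span hs
    have h4 := rk_le_card ((F.erase v).erase w)
    rw [Finset.card_erase_of_mem hwe, Finset.card_erase_of_mem hv] at h4
    have := Finset.card_pos.2 ⟨w, hwe⟩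
    rw [Finset.card_erase_of_mem hv] at this
    omega
  have rk_apex : ∀ v ∈ F, l v = 0 → rk (F.erase v) + 1 = rk F := by
    intro v hv hlv
    rw [← rk_insert (apex v hv hlv), Finset.insert_erase hv]
  refine ⟨F.filter fun v => 0 < l v, F.filter fun v => l v < 0, F.filter fun v => l v = 0, hc,
    ?_, ?_, ?_, ?_, pos_part_card hF hlh hne, ?_, ?_⟩
  · ext v
    simp only [Finset.mem_union, Finset.mem_filter]
    rcases lt_trichotomy (l v) 0 with h | h | h <;> tauto
  · rw [Finset.disjoint_left]
    intro v h1 h2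
    simp only [Finset.mem_filter] at h1 h2
    linarith
  · rw [Finset.disjoint_left]
    intro v h1 h2
    simp only [Finset.mem_filter] at h1 h2
    linarith
  · rw [Finset.disjoint_left]
    intro v h1 h2
    simp only [Finset.mem_filter] at h1 h2
    linarith
  · have := pos_part_card hF hlh' (by simpa using hne)
    simpa using this
  · intro S
    constructor
    · intro hS
      have hSf := facets_isFace hS
      have hSr := facets_rk hS
      obtain ⟨hSF, h, hh⟩ := facets_isFace hS
      by_cases hA : ∀ v ∈ F, 0 < l v → v ∈ S
      · right
        have hB : ∀ v ∈ F, l v < 0 → v ∈ S := fun v hv hlv => (hh v hv).2.1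
          (relation_zero (hlh h) (fun w hw => (hh w hw).1)
            (fun w hw hlw => (hh w hw).2.2 (hA w hw hlw)) v hv hlv)
        obtain ⟨c, hcF, hcS⟩ := Finset.exists_of_ssubset (hSF.ssubset_of_ne (facets_ne_self hS))
        have hlc : l c = 0 := by
          rcases lt_trichotomy (l c) 0 with h | h | h
          · exact absurd (hB c hcF h) hcS
          · exact h
          · exact absurd (hA c hcF h) hcS
        refine ⟨c, by simp [hcF, hlc], hSf.eq_of_subset (Finset.erase_subset _ _) ?_ ?_⟩
        · exact Finset.subset_erase.2 ⟨hSF, hcS⟩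
        · have := rk_apex c hcF hlc
          omega
      · left
        have hB : ¬ ∀ v ∈ F, l v < 0 → v ∈ S := by
          intro hB
          refine hA fun v hv hlv => (hh v hv).2.1
            (relation_zero (hlh' h) (fun w hw => (hh w hw).1)
              (fun w hw hlw => (hh w hw).2.2 (hB w hw (by linarith))) v hv (by linarith))
        push Not at hA hB
        obtain ⟨a, ha, hla, haS⟩ := hA
        obtain ⟨b, hb, hlb, hbS⟩ := hB
        have hba : b ≠ a := by rintro rfl; linarith
        refine ⟨a, by simp [ha, hla], b, by simp [hb, hlb], ?_⟩
        refine Finset.eq_of_subset_of_card_le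
          (Finset.subset_erase.2 ⟨Finset.subset_erase.2 ⟨hSF, haS⟩, hbS⟩) ?_
        rw [Finset.card_erase_of_mem (Finset.mem_erase.2 ⟨hba, hb⟩), Finset.card_erase_of_mem ha]
        have := rk_le_card S
        omega
    · rintro (⟨a, ha, b, hb, rfl⟩ | ⟨c, hcF, rfl⟩)
      · simp only [Finset.mem_filter] at ha hb
        obtain ⟨ha, hla⟩ := ha
        obtain ⟨hb, hlb⟩ := hb
        have hba : b ≠ a := by rintro rfl; linarith
        have hbe : b ∈ F.erase a := Finset.mem_erase.2 ⟨hba, hb⟩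
        have hi := indep a ha hla.ne'
        obtain ⟨f, hfb, hf0⟩ := exists_functional (notMem_span_erase hi hbe)
        have hfa : 0 < f a := by
          have h1 := hlh f
          rw [← Finset.add_sum_erase _ _ ha, ← Finset.add_sum_erase _ _ hbe,
            Finset.sum_eq_zero fun w hw => by rw [hf0 w hw, mul_zero], add_zero] at h1
          have h2 : l b * f b < 0 := mul_neg_of_neg_of_pos hlb hfb
          exact pos_of_mul_pos_right (a := l a) (by linarith) hla.le
        refine mem_facets.2 ⟨⟨(Finset.erase_subset _ _).trans (Finset.erase_subset _ _), f,
          fun v hv => ?_⟩, ?_⟩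
        · by_cases hva : v = a
          · subst hva
            exact ⟨hfa.le, fun h => absurd h hfa.ne', fun h => by simp at h⟩
          by_cases hvb : v = b
          · subst hvb
            exact ⟨hfb.le, fun h => absurd h hfb.ne', fun h => by simp at h⟩
          have hve : v ∈ (F.erase a).erase b := by simp [hva, hvb, hv]
          exact ⟨(hf0 v hve).ge, fun _ => hve, fun _ => hf0 v hve⟩
        · have h1 := card_le_rk_of_subset hi (Finset.erase_subset b _)
          have h2 := rk_le_card ((F.erase a).erase b)
          rw [Finset.card_erase_of_mem hbe, Finset.card_erase_of_mem ha] at h1 h2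
          have h3 := Finset.card_pos.2 ⟨b, hbe⟩
          rw [Finset.card_erase_of_mem ha] at h3
          omega
      · simp only [Finset.mem_filter] at hcF
        obtain ⟨f, hfc, hf0⟩ := exists_functional (apex c hcF.1 hcF.2)
        refine mem_facets.2 ⟨⟨Finset.erase_subset _ _, f, fun v hv => ?_⟩, rk_apex c hcF.1 hcF.2⟩
        by_cases hvc : v = c
        · subst hvc
          exact ⟨hfc.le, fun h => absurd h hfc.ne', fun h => by simp at h⟩
        · have hve : v ∈ F.erase c := by simp [hvc, hv]
          exact ⟨(hf0 v hve).ge, fun _ => hve, fun _ => hf0 v hve⟩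

end Gale
end FaceCone

namespace FaceCone

variable {E : Type*} [AddCommGroup E] [Module ℝ E] [DecidableEq E]

section GaleFacts

variable {F A B C : Finset E}

theorem GaleType.swap (h : GaleType F A B C) : GaleType F B A C := by
  refine ⟨h.card_eq, by rw [Finset.union_comm B A, h.union_eq], h.disjoint_AB.symm, h.disjoint_BC,
    h.disjoint_AC, h.three_le_B, h.three_le_A, fun S => ?_⟩
  rw [h.mem_facets_iff]
  refine or_congr_left ?_
  constructor
  · rintro ⟨a, ha, b, hb, rfl⟩
    exact ⟨b, hb, a, ha, Finset.erase_right_comm⟩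
  · rintro ⟨a, ha, b, hb, rfl⟩
    exact ⟨b, hb, a, ha, Finset.erase_right_comm⟩

theorem GaleType.A_subset (h : GaleType F A B C) : A ⊆ F := by
  rw [← h.union_eq]
  exact Finset.subset_union_left.trans Finset.subset_union_left

theorem GaleType.B_subset (h : GaleType F A B C) : B ⊆ F := h.swap.A_subset

theorem GaleType.C_subset (h : GaleType F A B C) : C ⊆ F := by
  rw [← h.union_eq]
  exact Finset.subset_union_right

theorem GaleType.ne (h : GaleType F A B C) {a b : E} (ha : a ∈ A) (hb : b ∈ B) : a ≠ b :=
  Finset.disjoint_iff_ne.1 h.disjoint_AB a ha b hb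

theorem GaleType.card_sum (h : GaleType F A B C) : F.card = A.card + B.card + C.card := by
  rw [← h.union_eq, Finset.card_union_of_disjoint, Finset.card_union_of_disjoint h.disjoint_AB]
  exact Finset.disjoint_union_left.2 ⟨h.disjoint_AC, h.disjoint_BC⟩

theorem GaleType.cell_mem (h : GaleType F A B C) {a b : E} (ha : a ∈ A) (hb : b ∈ B) :
    (F.erase a).erase b ∈ facets F :=
  (h.mem_facets_iff _).2 (Or.inl ⟨a, ha, b, hb, rfl⟩)

theorem GaleType.erase_mem (h : GaleType F A B C) {c : E} (hc : c ∈ C) :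
    F.erase c ∈ facets F :=
  (h.mem_facets_iff _).2 (Or.inr ⟨c, hc, rfl⟩)

theorem GaleType.card_cell (h : GaleType F A B C) {a b : E} (ha : a ∈ A) (hb : b ∈ B) :
    ((F.erase a).erase b).card + 2 = F.card := by
  have h1 := Finset.card_erase_add_one (h.A_subset ha)
  have h2 := Finset.card_erase_add_one
    (Finset.mem_erase.2 ⟨(h.ne ha hb).symm, h.B_subset hb⟩ : b ∈ F.erase a)
  omega

theorem GaleType.mem_C_of_erase (h : GaleType F A B C) {x : E} (hx : x ∈ F)
    (hR : F.erase x ∈ facets F) : x ∈ C := by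
  have h1 := Finset.card_erase_add_one hx
  rcases (h.mem_facets_iff _).1 hR with ⟨a, ha, b, hb, he⟩ | ⟨c, hc, he⟩
  · have := h.card_cell ha hb
    rw [← he] at this
    omega
  · by_contra hxC
    have hcx : c ≠ x := by rintro rfl; exact hxC hc
    have : c ∈ F.erase x := Finset.mem_erase.2 ⟨hcx, h.C_subset hc⟩
    rw [he] at this
    simp at this

theorem GaleType.cell_inj (h : GaleType F A B C) {a b a' b' : E} (ha : a ∈ A) (hb : b ∈ B)
    (ha' : a' ∈ A) (hb' : b' ∈ B) (he : (F.erase a).erase b = (F.erase a').erase b') :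
    a = a' ∧ b = b' := by
  have h1 : a ∉ (F.erase a).erase b := by simp
  have h2 : b ∉ (F.erase a).erase b := by simp
  rw [he] at h1 h2
  simpa only [Finset.mem_erase, h.A_subset ha, h.B_subset hb, h.ne ha hb',
    (h.ne ha' hb).symm, ne_eq, not_false_eq_true, true_and, and_true, not_not] using And.intro h1 h2

theorem GaleType.sum_facets {M : Type*} [AddCommMonoid M] (h : GaleType F A B C)
    (φ : Finset E → M) :
    ∑ R ∈ facets F, φ R =
      ∑ a ∈ A, ∑ b ∈ B, φ ((F.erase a).erase b) + ∑ c ∈ C, φ (F.erase c) := by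
  have h1 : facets F = ((A ×ˢ B).image fun p => (F.erase p.1).erase p.2) ∪
      C.image fun c => F.erase c := by
    ext S
    rw [h.mem_facets_iff]
    simp only [Finset.mem_union, Finset.mem_image, Finset.mem_product, Prod.exists]
    constructor
    · rintro (⟨a, ha, b, hb, rfl⟩ | ⟨c, hc, rfl⟩)
      · exact Or.inl ⟨a, b, ⟨ha, hb⟩, rfl⟩
      · exact Or.inr ⟨c, hc, rfl⟩
    · rintro (⟨a, b, ⟨ha, hb⟩, rfl⟩ | ⟨c, hc, rfl⟩)
      · exact Or.inl ⟨a, ha, b, hb, rfl⟩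
      · exact Or.inr ⟨c, hc, rfl⟩
  rw [h1, Finset.sum_union, Finset.sum_image, Finset.sum_image, Finset.sum_product]
  · intro c hc c' hc' he
    by_contra hne
    have : c ∈ F.erase c' := Finset.mem_erase.2 ⟨hne, h.C_subset hc⟩
    simp only at he
    rw [← he] at this
    simp at this
  · rintro ⟨a, b⟩ hp ⟨a', b'⟩ hp' he
    simp only [Finset.coe_product, Set.mem_prod, Finset.mem_coe] at hp hp' he
    obtain ⟨rfl, rfl⟩ := h.cell_inj hp.1 hp.2 hp'.1 hp'.2 he
    rfl
  · rw [Finset.disjoint_left]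
    intro S h1 h2
    simp only [Finset.mem_image, Finset.mem_product, Prod.exists] at h1 h2
    obtain ⟨a, b, ⟨ha, hb⟩, rfl⟩ := h1
    obtain ⟨c, hc, he⟩ := h2
    have := h.card_cell ha hb
    rw [← he] at this
    have := Finset.card_erase_add_one (h.C_subset hc)
    omega

theorem GaleType.card_facets (h : GaleType F A B C) :
    (facets F).card = A.card * B.card + C.card := by
  have := h.sum_facets (fun _ => 1)
  simpa using this

theorem GaleType.deg_cross (h : GaleType F A B C) {a b : E} (ha : a ∈ A) (hb : b ∈ B) :
    deg F {a, b} = (A.card - 1) * (B.card - 1) + C.card := by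
  unfold deg
  rw [Finset.card_filter, h.sum_facets]
  congr 1
  · have : ∀ x ∈ A, ∀ y ∈ B, (if ({a, b} : Finset E) ⊆ (F.erase x).erase y then 1 else 0) =
        (if a ≠ x then 1 else 0) * (if b ≠ y then 1 else 0) := by
      intro x hx y hy
      have e : ({a, b} : Finset E) ⊆ (F.erase x).erase y ↔ a ≠ x ∧ b ≠ y := by
        simp [Finset.insert_subset_iff, h.A_subset ha, h.B_subset hb, h.ne ha hy,
          (h.ne hx hb).symm]
      simp only [e]
      split_ifs <;> simp_all
    rw [Finset.sum_congr rfl fun x hx => Finset.sum_congr rfl fun y hy => this x hx y hy,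
      ← Finset.sum_mul_sum, ← Finset.card_filter, ← Finset.card_filter, Finset.filter_ne,
      Finset.filter_ne, Finset.card_erase_of_mem ha, Finset.card_erase_of_mem hb]
  · rw [Finset.sum_congr rfl fun c hc => if_pos ?_]
    · simp
    · have h1 := Finset.disjoint_iff_ne.1 h.disjoint_AC a ha c hc
      have h2 := Finset.disjoint_iff_ne.1 h.disjoint_BC b hb c hc
      simp [Finset.insert_subset_iff, h.A_subset ha, h.B_subset hb, h1, h2]

theorem GaleType.deg_same (h : GaleType F A B C) {a a' : E} (ha : a ∈ A) (ha' : a' ∈ A)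
    (hne : a ≠ a') :
    deg F {a, a'} = (A.card - 2) * B.card + C.card := by
  unfold deg
  rw [Finset.card_filter, h.sum_facets]
  congr 1
  · have : ∀ x ∈ A, ∀ y ∈ B, (if ({a, a'} : Finset E) ⊆ (F.erase x).erase y then 1 else 0) =
        (if a' ≠ x ∧ a ≠ x then 1 else 0) := by
      intro x hx y hy
      have e : ({a, a'} : Finset E) ⊆ (F.erase x).erase y ↔ a' ≠ x ∧ a ≠ x := by
        simp only [Finset.insert_subset_iff, Finset.singleton_subset_iff, Finset.mem_erase,
          h.A_subset ha, h.A_subset ha', ne_eq, h.ne ha hy, h.ne ha' hy, not_false_eq_true,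
          true_and, and_true]
        tauto
      simp only [e]
    rw [Finset.sum_congr rfl fun x hx => Finset.sum_congr rfl fun y hy => this x hx y hy]
    simp only [Finset.sum_const, smul_eq_mul]
    rw [← Finset.mul_sum, ← Finset.card_filter, ← Finset.filter_filter, Finset.filter_ne,
      Finset.filter_ne, Finset.card_erase_of_mem (Finset.mem_erase.2 ⟨hne, ha⟩),
      Finset.card_erase_of_mem ha', Nat.sub_sub, mul_comm]
  · rw [Finset.sum_congr rfl fun c hc => if_pos ?_]
    · simp
    · have h1 := Finset.disjoint_iff_ne.1 h.disjoint_AC a ha c hc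
      have h2 := Finset.disjoint_iff_ne.1 h.disjoint_AC a' ha' c hc
      simp [Finset.insert_subset_iff, h.A_subset ha, h.A_subset ha', h1, h2]

end GaleFacts

theorem Good.card_le_rk {W : Finset E} (h : Good W) (hc : W.card ≤ 5) : W.card ≤ rk W := by
  induction hn : W.card using Nat.strong_induction_on generalizing W with
  | _ n ih =>
    by_contra hcon
    have hne : W.Nonempty := Finset.card_pos.1 (by omega)
    obtain ⟨v, hv⟩ := hne
    have h1 := Finset.card_erase_add_one hv
    have h2 := ih _ (by omega) (h.mono (Finset.erase_subset v W)) (by omega) rfl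
    have h3 := rk_mono (Finset.erase_subset v W)
    obtain ⟨A, B, C, hg⟩ := h.exists_galeType (by omega)
    have := hg.card_sum
    have := hg.three_le_A
    have := hg.three_le_B
    omega

theorem Good.card_eq_four {W : Finset E} (h : Good W) (hr : rk W = 4) : W.card = 4 := by
  have := rk_le_card W
  by_contra hne
  obtain ⟨U, hU, hUc⟩ := Finset.exists_subset_card_eq (show 5 ≤ W.card by omega)
  have h1 := (h.mono hU).card_le_rk (by omega)
  have h2 := rk_mono hU
  omega

theorem Good.mul_le_sum_offDiag {V X : Finset E} (h : Good V) (hX : X ⊆ V) :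
    (X.card * X.card - X.card) * (rk V - 2) ≤
      ∑ G ∈ facets V, ((X ∩ G).card * (X ∩ G).card - (X ∩ G).card) := by
  rw [sum_offDiag, ← Finset.offDiag_card, ← smul_eq_mul]
  refine Finset.card_nsmul_le_sum _ _ _ fun p hp => ?_
  rw [Finset.mem_offDiag] at hp
  have := h.le_deg (hX hp.1) (hX hp.2.1)
  omega

theorem Good.mul_le_sum_product {V X Y : Finset E} (h : Good V) (hX : X ⊆ V) (hY : Y ⊆ V) :
    X.card * Y.card * (rk V - 2) ≤
      ∑ G ∈ facets V, (X ∩ G).card * (Y ∩ G).card := by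
  rw [sum_product, ← Finset.card_product, ← smul_eq_mul]
  refine Finset.card_nsmul_le_sum _ _ _ fun p hp => ?_
  rw [Finset.mem_product] at hp
  have := h.le_deg (hX hp.1) (hY hp.2)
  omega

theorem Good.card_facets_of_simplicial {V : Finset E} {d : ℕ} (h : Good V) (hd : 4 ≤ d)
    (hr : rk V = d + 1) (hs : ∀ G ∈ facets V, G.card = d) (hn : d + 4 ≤ V.card) :
    d + 8 ≤ (facets V).card := by
  have h1 := h.mul_le_sum_offDiag (Finset.Subset.refl V)
  rw [Finset.sum_congr rfl (g := fun _ => d * d - d) ?_] at h1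
  · rw [Finset.sum_const, smul_eq_mul, hr] at h1
    obtain ⟨e, rfl⟩ := Nat.exists_eq_add_of_le hd
    obtain ⟨m, hm⟩ := Nat.exists_eq_add_of_le hn
    have e1 : V.card * V.card - V.card = V.card * (V.card - 1) := by
      rw [Nat.mul_sub, mul_one]
    have e2 : (4 + e) * (4 + e) - (4 + e) = (4 + e) * (3 + e) := by
      rw [show 3 + e = 4 + e - 1 by omega, Nat.mul_sub, mul_one]
    rw [e1, e2, show 4 + e + 1 - 2 = 3 + e by omega, ← mul_assoc] at h1
    have h2 := Nat.le_of_mul_le_mul_right h1 (by omega)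
    rw [hm, show 4 + e + 4 + m - 1 = 4 + e + 3 + m by omega] at h2
    by_contra hc
    have h3 : (facets V).card ≤ e + 11 := by omega
    have h4 := Nat.mul_le_mul_right (4 + e) h3
    nlinarith
  · intro G hG
    rw [Finset.inter_eq_right.2 (facets_subset hG), hs G hG]

end FaceCone

namespace FaceCone

variable {E : Type*} [AddCommGroup E] [Module ℝ E] [DecidableEq E]

theorem sdiff_inter_eq {V F G : Finset E} (hG : G ⊆ V) : (V \ F) ∩ G = G \ F := by
  ext x
  simp only [Finset.mem_inter, Finset.mem_sdiff]
  exact ⟨fun h => ⟨h.2, h.1.2⟩, fun h => ⟨⟨hG h.1, h.2⟩, h.1⟩⟩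

theorem card_sdiff_opp {V F R : Finset E} (hF : F ∈ facets V) (hR : R ∈ facets F) :
    (opp V F R \ F).card + R.card = (opp V F R).card := by
  have := Finset.card_sdiff_add_card_inter (opp V F R) F
  rwa [opp_inter hF hR] at this

theorem one_le_card_sdiff_opp {V F R : Finset E} (hF : F ∈ facets V) (hR : R ∈ facets F) :
    1 ≤ (opp V F R \ F).card := by
  obtain ⟨x, hx, hxF⟩ := facets_antichain (opp_mem hF hR) hF (opp_ne hF hR)
  exact Finset.card_pos.2 ⟨x, Finset.mem_sdiff.2 ⟨hx, hxF⟩⟩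

theorem card_sdiff_of_facet {V G : Finset E} (hG : G ∈ facets V) :
    (V \ G).card + G.card = V.card :=
  Finset.card_sdiff_add_card_eq_card (facets_subset hG)

theorem exists_facet {V : Finset E} (h : Good V) (hr : 0 < rk V) : ∃ F, F ∈ facets V := by
  obtain ⟨x, hx⟩ : V.Nonempty := Finset.card_pos.1 (hr.trans_le (rk_le_card V))
  obtain ⟨F, hF, -⟩ := h.1.exists_facet_avoiding hx (by simp)
  exact ⟨F, hF⟩

theorem Good.card_facets_of_simplicial_of_card_eq {V : Finset E} {d : ℕ} (h : Good V) (hd : 4 ≤ d)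
    (hr : rk V = d + 1) (hs : ∀ G ∈ facets V, G.card = d) (hn : V.card = d + 3) :
    d + 8 ≤ (facets V).card := by
  obtain ⟨F, hF⟩ := exists_facet h (by omega)
  have rF := facets_rk hF
  have hO := card_sdiff_of_facet hF
  rw [hs F hF] at hO
  have hO3 : (V \ F).card = 3 := by omega
  have hRc : ∀ R ∈ facets F, R.card + 1 = d ∧ (opp V F R \ F).card = 1 := by
    intro R hR
    have h1 := facets_card hR
    have h2 := card_sdiff_opp hF hR
    have h3 := hs _ (opp_mem hF hR)
    have h4 := one_le_card_sdiff_opp hF hR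
    omega
  have hfF : (facets F).card = d := by
    refine le_antisymm ?_ ?_
    · have : facets F ⊆ F.powersetCard (d - 1) := by
        intro R hR
        have := hRc R hR
        exact Finset.mem_powersetCard.2 ⟨facets_subset hR, by omega⟩
      have := Finset.card_le_card this
      rw [Finset.card_powersetCard, hs F hF] at this
      rwa [show d - 1 = d - 1 from rfl, Nat.choose_symm (show 1 ≤ d by omega),
        Nat.choose_one_right] at this
    · have := ((h.mono (facets_subset hF)).1).rk_le_rk_add_deg
      rw [rk_empty, zero_add] at this
      have h2 : deg F ∅ ≤ (facets F).card := Finset.card_filter_le _ _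
      omega
  set t2 := ((nadj V F).filter fun G => (G \ F).card = 2).card with ht2
  set t3 := ((nadj V F).filter fun G => ¬ (G \ F).card = 2).card with ht3
  have ht : t2 + t3 = (nadj V F).card := Finset.card_filter_add_card_filter_not _
  have hn3 : ∀ G ∈ nadj V F, (G \ F).card = 2 ∨ (G \ F).card = 3 := by
    intro G hG
    have h1 := two_le_card_sdiff hF hG
    have h2 : (G \ F).card ≤ (V \ F).card :=
      Finset.card_le_card (Finset.sdiff_subset_sdiff (facets_subset (mem_nadj.1 hG).1) le_rfl)
    omega
  have hsum : ∀ φ : ℕ → ℕ, ∑ G ∈ nadj V F, φ (G \ F).card = t2 * φ 2 + t3 * φ 3 := by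
    intro φ
    rw [← Finset.sum_filter_add_sum_filter_not (nadj V F) fun G => (G \ F).card = 2]
    congr 1
    · rw [Finset.sum_congr rfl (g := fun _ => φ 2), Finset.sum_const, smul_eq_mul]
      intro G hG
      rw [(Finset.mem_filter.1 hG).2]
    · rw [Finset.sum_congr rfl (g := fun _ => φ 3), Finset.sum_const, smul_eq_mul]
      intro G hG
      rw [Finset.mem_filter] at hG
      rw [(hn3 G hG.1).resolve_left hG.2]
  have hOO := h.mul_le_sum_offDiag (Finset.sdiff_subset : V \ F ⊆ V)
  rw [Finset.sum_congr rfl (g := fun G => (G \ F).card * (G \ F).card - (G \ F).card)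
    fun G hG => by rw [sdiff_inter_eq (facets_subset hG)],
    sum_facets hF, Finset.sum_congr rfl (g := fun _ => 0) fun R hR => by rw [(hRc R hR).2],
    hsum (fun k => k * k - k), hO3, hr] at hOO
  have hFO := h.mul_le_sum_product (facets_subset hF) (Finset.sdiff_subset : V \ F ⊆ V)
  have hcard : ∀ G ∈ facets V, (F ∩ G).card + (G \ F).card = d := by
    intro G hG
    rw [← hs G hG, Finset.inter_comm, Finset.card_inter_add_card_sdiff]
  rw [Finset.sum_congr rfl (g := fun G => (d - (G \ F).card) * (G \ F).card)
    fun G hG => by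
      rw [sdiff_inter_eq (facets_subset hG), ← hcard G hG, Nat.add_sub_cancel],
    sum_facets hF,
    Finset.sum_congr rfl (g := fun _ => d - 1) fun R hR => by rw [(hRc R hR).2, mul_one],
    hsum (fun k => (d - k) * k), hO3, hr, hs F hF] at hFO
  simp only [Finset.sdiff_self, Finset.card_empty, mul_zero, Finset.sum_const,
    smul_eq_mul, hfF] at hOO hFO
  have htot := card_facets_eq hF
  rw [hfF] at htot
  suffices 7 ≤ t2 + t3 by omega
  obtain ⟨e, rfl⟩ := Nat.exists_eq_add_of_le hd
  rw [show 4 + e + 1 - 2 = 3 + e by omega] at hOO hFO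
  rw [show 4 + e - 1 = 3 + e by omega, show 4 + e - 2 = 2 + e by omega,
    show 4 + e - 3 = 1 + e by omega] at hFO
  clear_value t2 t3
  by_contra hc
  have hc : t2 + t3 ≤ 6 := by omega
  rcases Nat.eq_zero_or_pos e with rfl | he
  · omega
  · obtain ⟨g, rfl⟩ := Nat.exists_eq_add_of_le he
    have h1 : t3 ≤ 6 := by omega
    zify at *
    nlinarith [mul_le_mul_of_nonneg_left hc (by positivity : (0 : ℤ) ≤ 3 + g),
      mul_le_mul_of_nonneg_left h1 (by positivity : (0 : ℤ) ≤ g), sq_nonneg ((g : ℤ) - 1)]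

/-- Every facet of a configuration in dimension four is a simplex. -/
theorem Good.card_facet_of_rk_five {V G : Finset E} (h : Good V) (hr : rk V = 5)
    (hG : G ∈ facets V) : G.card = 4 := by
  have := facets_rk hG
  exact (h.mono (facets_subset hG)).card_eq_four (by omega)

end FaceCone

namespace FaceCone

variable {E : Type*} [AddCommGroup E] [Module ℝ E] [DecidableEq E]

/-- `S` is the intersection of two almost equal ridges in `F` whose second facets have no common
vertex outside `F`. -/
def IsConflict (V F S : Finset E) : Prop :=
  ∃ R₁ ∈ facets F, ∃ R₂ ∈ facets F, R₁ ≠ R₂ ∧ (R₁ \ R₂).card ≤ 1 ∧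
    opp V F R₁ ∩ opp V F R₂ ⊆ F ∧ R₁ ∩ R₂ = S

theorem IsConflict.exists_nadj {V F S : Finset E} (hF : F ∈ facets V) (h : IsConflict V F S) :
    ∃ H ∈ nadj V F, H ∩ F = S := by
  obtain ⟨R₁, h1, R₂, h2, hne, hc, hs, rfl⟩ := h
  exact exists_nadj_of_conflict hF h1 h2 hne (rk_inter_of_sdiff h1 h2 hne hc) hs

theorem card_le_nadj_of_conflicts {V F : Finset E} (hF : F ∈ facets V) (𝒮 : Finset (Finset E))
    (h : ∀ S ∈ 𝒮, IsConflict V F S) : 𝒮.card ≤ (nadj V F).card := by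
  have : 𝒮 ⊆ (nadj V F).image fun H => H ∩ F := by
    intro S hS
    obtain ⟨H, hH, he⟩ := (h S hS).exists_nadj hF
    exact Finset.mem_image.2 ⟨H, hH, he⟩
  exact (Finset.card_le_card this).trans Finset.card_image_le

theorem inter_eq_of_opp_avoid {V F R₁ R₂ : Finset E} {u w : E} (hO : ∀ x ∈ V, x ∉ F → x = u ∨ x = w)
    (hF : F ∈ facets V) (h1 : R₁ ∈ facets F)
    (hw : w ∉ opp V F R₁) (hu : u ∉ opp V F R₂) : opp V F R₁ ∩ opp V F R₂ ⊆ F := by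
  intro x hx
  rw [Finset.mem_inter] at hx
  by_contra hxF
  rcases hO x (facets_subset (opp_mem hF h1) hx.1) hxF with rfl | rfl
  · exact hu hx.2
  · exact hw hx.1

theorem card_sdiff_erase_le {F R : Finset E} (hR : R ⊆ F) (c : E) :
    (R \ F.erase c).card ≤ 1 := by
  have : R \ F.erase c ⊆ {c} := by
    intro x hx
    rw [Finset.mem_sdiff, Finset.mem_erase] at hx
    rw [Finset.mem_singleton]
    by_contra hne
    exact hx.2 ⟨hne, hR hx.1⟩
  simpa using Finset.card_le_card this

theorem injOn_inter_erase {F : Finset E} {c : E} (hc : F.erase c ∈ facets F)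
    {W : Finset (Finset E)} (hW : W ⊆ facets F) (hcW : F.erase c ∉ W) :
    Set.InjOn (fun R => R ∩ F.erase c) (W : Set (Finset E)) := by
  intro R hR R' hR' he
  simp only [Finset.mem_coe] at hR hR' he
  have hne : ∀ R ∈ W, R ≠ F.erase c := by
    rintro R hR rfl
    exact hcW hR
  refine unique_other_facet ((facets_isFace (hW hR)).inter (facets_isFace hc))
    (rk_inter_of_sdiff (hW hR) hc (hne R hR)
      (card_sdiff_erase_le (facets_subset (hW hR)) c)).symm hc (hW hR) (hW hR')
    Finset.inter_subset_right Finset.inter_subset_left ?_ (hne R hR) (hne R' hR')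
  rw [he]
  exact Finset.inter_subset_left

/-- If `F.erase c` is a ridge, there are at most as many ridges whose second facet does not meet
the second facet of `F.erase c` outside `F` as there are facets not adjacent to `F`. -/
theorem card_le_nadj_of_erase {V F : Finset E} {c : E} (hF : F ∈ facets V)
    (hc : F.erase c ∈ facets F) (W : Finset (Finset E)) (hW : W ⊆ facets F)
    (hcW : F.erase c ∉ W)
    (hd : ∀ R ∈ W, opp V F R ∩ opp V F (F.erase c) ⊆ F) : W.card ≤ (nadj V F).card := by
  rw [← Finset.card_image_of_injOn (injOn_inter_erase hc hW hcW)]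
  refine card_le_nadj_of_conflicts hF _ fun S hS => ?_
  obtain ⟨R, hR, rfl⟩ := Finset.mem_image.1 hS
  exact ⟨R, hW hR, _, hc, fun he => hcW (he ▸ hR),
    card_sdiff_erase_le (facets_subset (hW hR)) c, hd R hR, rfl⟩

section TwoOutsiders

/-- The data of a facet with exactly two vertices `u`, `w` outside. -/
structure TwoOut (V F : Finset E) (u w : E) : Prop where
  good : Good V
  facet : F ∈ facets V
  ne : u ≠ w
  sdiff_eq : V \ F = {u, w}

variable {V F : Finset E} {u w : E}

theorem TwoOut.symm (h : TwoOut V F u w) : TwoOut V F w u :=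
  ⟨h.good, h.facet, h.ne.symm, by rw [h.sdiff_eq, Finset.pair_comm]⟩

theorem TwoOut.u_mem (h : TwoOut V F u w) : u ∈ V ∧ u ∉ F := by
  have : u ∈ V \ F := by rw [h.sdiff_eq]; simp
  exact Finset.mem_sdiff.1 this

theorem TwoOut.w_mem (h : TwoOut V F u w) : w ∈ V ∧ w ∉ F := h.symm.u_mem

theorem TwoOut.eq_or (h : TwoOut V F u w) {x : E} (hx : x ∈ V) (hxF : x ∉ F) :
    x = u ∨ x = w := by
  have : x ∈ V \ F := Finset.mem_sdiff.2 ⟨hx, hxF⟩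
  rw [h.sdiff_eq] at this
  simpa using this

theorem TwoOut.mem_of_notMem (h : TwoOut V F u w) {R : Finset E} (hR : R ∈ facets F)
    (hu : u ∉ opp V F R) : w ∈ opp V F R := by
  obtain ⟨x, hx, hxF⟩ := facets_antichain (opp_mem h.facet hR) h.facet (opp_ne h.facet hR)
  rcases h.eq_or (facets_subset (opp_mem h.facet hR) hx) hxF with rfl | rfl
  · exact absurd hx hu
  · exact hx

theorem TwoOut.card_eq (h : TwoOut V F u w) : V.card = F.card + 2 := by
  have := card_sdiff_of_facet h.facet
  rw [h.sdiff_eq, Finset.card_pair h.ne] at this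
  omega

/-- The ridges of `F` whose second facet misses `w`. -/
noncomputable def missing (V F : Finset E) (w : E) : Finset (Finset E) :=
  (facets F).filter fun R => w ∉ opp V F R

theorem mem_missing {R : Finset E} : R ∈ missing V F w ↔ R ∈ facets F ∧ w ∉ opp V F R := by
  simp [missing]

theorem TwoOut.disjoint_missing (h : TwoOut V F u w) {R : Finset E} (hu : R ∈ missing V F u)
    (hw : R ∈ missing V F w) : False :=
  (mem_missing.1 hw).2 (h.mem_of_notMem (mem_missing.1 hu).1 (mem_missing.1 hu).2)

theorem TwoOut.cover (h : TwoOut V F u w) {x : E} (hx : x ∈ F) : ∃ R ∈ missing V F w, x ∈ R := by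
  obtain ⟨G, hG, hxG, huG, hwG⟩ := h.good.exists_facet_avoiding (facets_subset h.facet hx)
    h.u_mem.1 h.w_mem.1 (fun he => h.w_mem.2 (he ▸ hx)) h.ne.symm
  have hGF : G ≠ F := fun he => h.u_mem.2 (he ▸ huG)
  have hc : (G \ F).card ≤ 1 := by
    have : G \ F ⊆ {u} := by
      intro y hy
      rw [Finset.mem_sdiff] at hy
      rcases h.eq_or (facets_subset hG hy.1) hy.2 with rfl | rfl
      · simp
      · exact absurd hy.1 hwG
    simpa using Finset.card_le_card this
  have hR := inter_mem_facets h.facet hG hGF hc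
  refine ⟨G ∩ F, mem_missing.2 ⟨hR, ?_⟩, Finset.mem_inter.2 ⟨hxG, hx⟩⟩
  rwa [opp_inter_self h.facet hG hR]

theorem TwoOut.inter_subset (h : TwoOut V F u w) {R₁ R₂ : Finset E} (h1 : R₁ ∈ missing V F w)
    (h2 : R₂ ∈ missing V F u) : opp V F R₁ ∩ opp V F R₂ ⊆ F :=
  inter_eq_of_opp_avoid (fun _ hx hxF => h.eq_or hx hxF) h.facet (mem_missing.1 h1).1
    (mem_missing.1 h1).2 (mem_missing.1 h2).2

theorem TwoOut.isConflict (h : TwoOut V F u w) {R₁ R₂ : Finset E} (h1 : R₁ ∈ missing V F w)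
    (h2 : R₂ ∈ missing V F u) (hc : (R₁ \ R₂).card ≤ 1) : IsConflict V F (R₁ ∩ R₂) :=
  ⟨R₁, (mem_missing.1 h1).1, R₂, (mem_missing.1 h2).1, fun he =>
    h.disjoint_missing h2 (he ▸ h1), hc, h.inter_subset h1 h2, rfl⟩

theorem TwoOut.two_le_missing (h : TwoOut V F u w) (hF : F.Nonempty) :
    2 ≤ (missing V F w).card := by
  obtain ⟨x, hx⟩ := hF
  obtain ⟨R, hR, -⟩ := h.cover hx
  obtain ⟨y, hy, hyR⟩ := Finset.exists_of_ssubset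
    ((facets_subset (mem_missing.1 hR).1).ssubset_of_ne (facets_ne_self (mem_missing.1 hR).1))
  obtain ⟨R', hR', hyR'⟩ := h.cover hy
  exact Finset.one_lt_card.2 ⟨R, hR, R', hR', fun he => hyR (he ▸ hyR')⟩

theorem TwoOut.card_missing_le (h : TwoOut V F u w) {c : E} (hc : F.erase c ∈ missing V F u) :
    (missing V F w).card ≤ (nadj V F).card := by
  refine card_le_nadj_of_erase h.facet (mem_missing.1 hc).1 _ (Finset.filter_subset _ _) ?_ ?_
  · exact fun hw => h.disjoint_missing hc hw
  · exact fun R hR => h.inter_subset hR hc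

variable {A B C : Finset E}

theorem TwoOut.isConflict_row (h : TwoOut V F u w) {a b b' : E}
    (h1 : (F.erase a).erase b ∈ missing V F w) (h2 : (F.erase a).erase b' ∈ missing V F u) :
    IsConflict V F (((F.erase a).erase b).erase b') := by
  have hc : ((F.erase a).erase b \ (F.erase a).erase b').card ≤ 1 := by
    have : (F.erase a).erase b \ (F.erase a).erase b' ⊆ {b'} := by
      intro x
      simp only [Finset.mem_sdiff, Finset.mem_erase, Finset.mem_singleton]
      tauto
    simpa using Finset.card_le_card this
  have := h.isConflict h1 h2 hc
  rwa [show (F.erase a).erase b ∩ (F.erase a).erase b' = ((F.erase a).erase b).erase b' by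
    ext x
    simp only [Finset.mem_inter, Finset.mem_erase]
    tauto] at this

/-- If no ridge `F.erase c` is missing `u` or `w` and `F` has three rows, some row contains
ridges of both kinds. -/
theorem TwoOut.exists_row (h : TwoOut V F u w) (g : GaleType F A B C) (hA : A.card = 3)
    (hCu : ∀ c, F.erase c ∉ missing V F u) (hCw : ∀ c, F.erase c ∉ missing V F w) :
    ∃ a ∈ A, ∃ b ∈ B, ∃ b' ∈ B, (F.erase a).erase b ∈ missing V F w ∧
      (F.erase a).erase b' ∈ missing V F u := by
  have rows : ∀ {u w : E}, TwoOut V F u w → (∀ c, F.erase c ∉ missing V F w) →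
      2 ≤ (A.filter fun a => ∃ b ∈ B, (F.erase a).erase b ∈ missing V F w).card := by
    intro u w h hCw
    have cov : ∀ x ∈ F, ∃ a ∈ A, (∃ b ∈ B, (F.erase a).erase b ∈ missing V F w) ∧ x ≠ a := by
      intro x hx
      obtain ⟨R, hR, hxR⟩ := h.cover hx
      rcases (g.mem_facets_iff R).1 (mem_missing.1 hR).1 with ⟨a, ha, b, hb, rfl⟩ | ⟨c, -, rfl⟩
      · refine ⟨a, ha, ⟨b, hb, hR⟩, ?_⟩
        simp only [Finset.mem_erase] at hxR
        exact hxR.2.1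
      · exact absurd hR (hCw c)
    obtain ⟨x, hx⟩ : A.Nonempty := Finset.card_pos.1 (by omega)
    obtain ⟨a, ha, h1, -⟩ := cov x (g.A_subset hx)
    obtain ⟨a', ha', h1', hne⟩ := cov a (g.A_subset ha)
    exact Finset.one_lt_card.2 ⟨a, Finset.mem_filter.2 ⟨ha, h1⟩, a',
      Finset.mem_filter.2 ⟨ha', h1'⟩, hne⟩
  have h1 := rows h hCw
  have h2 := rows h.symm hCu
  have h3 := Finset.card_union_add_card_inter
    (A.filter fun a => ∃ b ∈ B, (F.erase a).erase b ∈ missing V F w)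
    (A.filter fun a => ∃ b ∈ B, (F.erase a).erase b ∈ missing V F u)
  have h4 := Finset.card_le_card (Finset.union_subset (Finset.filter_subset _ A)
    (Finset.filter_subset (fun a => ∃ b ∈ B, (F.erase a).erase b ∈ missing V F u) A) :
    (A.filter fun a => ∃ b ∈ B, (F.erase a).erase b ∈ missing V F w) ∪
    (A.filter fun a => ∃ b ∈ B, (F.erase a).erase b ∈ missing V F u) ⊆ A)
  obtain ⟨a, ha⟩ := Finset.card_pos.1 (show 0 <
    ((A.filter fun a => ∃ b ∈ B, (F.erase a).erase b ∈ missing V F w) ∩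
    (A.filter fun a => ∃ b ∈ B, (F.erase a).erase b ∈ missing V F u)).card by omega)
  simp only [Finset.mem_inter, Finset.mem_filter] at ha
  obtain ⟨⟨ha, b, hb, hbw⟩, -, b', hb', hbu⟩ := ha
  exact ⟨a, ha, b, hb, b', hb', hbw, hbu⟩

theorem TwoOut.exists_row_conflict (h : TwoOut V F u w) (g : GaleType F A B C) (hA : A.card = 3)
    (hCu : ∀ c, F.erase c ∉ missing V F u) (hCw : ∀ c, F.erase c ∉ missing V F w) :
    ∃ a ∈ A, ∃ b ∈ B, ∃ b' ∈ B, b ≠ b' ∧ IsConflict V F (((F.erase a).erase b).erase b') := by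
  obtain ⟨a, ha, b, hb, b', hb', h1, h2⟩ := h.exists_row g hA hCu hCw
  refine ⟨a, ha, b, hb, b', hb', ?_, h.isConflict_row h1 h2⟩
  rintro rfl
  exact h.disjoint_missing h2 h1

theorem GaleType.card_erase_three (g : GaleType F A B C) {a b b' : E} (ha : a ∈ A) (hb : b ∈ B)
    (hb' : b' ∈ B) (hne : b ≠ b') : (((F.erase a).erase b).erase b').card + 3 = F.card := by
  have h1 := g.card_cell ha hb
  have h2 : b' ∈ (F.erase a).erase b :=
    Finset.mem_erase.2 ⟨hne.symm, Finset.mem_erase.2 ⟨(g.ne ha hb').symm, g.B_subset hb'⟩⟩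
  have := Finset.card_erase_add_one h2
  omega

theorem TwoOut.exists_two_conflicts (h : TwoOut V F u w) (g : GaleType F A B C)
    (hA : A.card = 3) (hB : B.card = 3)
    (hCu : ∀ c, F.erase c ∉ missing V F u) (hCw : ∀ c, F.erase c ∉ missing V F w) :
    ∃ S S', S ≠ S' ∧ IsConflict V F S ∧ IsConflict V F S' ∧ S.card + 3 = F.card ∧
      S'.card + 3 = F.card := by
  obtain ⟨a, ha, b, hb, b', hb', hbb, h1⟩ := h.exists_row_conflict g hA hCu hCw
  obtain ⟨y, hy, x, hx, x', hx', hxx, h2⟩ := h.exists_row_conflict g.swap hB hCu hCw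
  refine ⟨_, _, ?_, h1, h2, g.card_erase_three ha hb hb' hbb,
    g.swap.card_erase_three hy hx hx' hxx⟩
  intro he
  have e1 : x ∉ ((F.erase a).erase b).erase b' := by rw [he]; simp
  have e2 : x' ∉ ((F.erase a).erase b).erase b' := by rw [he]; simp
  simp only [Finset.mem_erase, g.A_subset hx, g.A_subset hx', g.ne hx hb, g.ne hx hb',
    g.ne hx' hb, g.ne hx' hb', ne_eq, not_false_eq_true, true_and, and_true,
    not_not] at e1 e2
  exact hxx (e1.trans e2.symm)

theorem TwoOut.two_le_nadj (h : TwoOut V F u w) (g : GaleType F A B C) (hA : A.card = 3)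
    (hB : B.card = 3) : 2 ≤ (nadj V F).card := by
  have hne : F.Nonempty := Finset.card_pos.1 (by have := g.card_eq; omega)
  by_cases hCu : ∀ c, F.erase c ∉ missing V F u
  · by_cases hCw : ∀ c, F.erase c ∉ missing V F w
    · obtain ⟨S, S', hS, h1, h2, -⟩ := h.exists_two_conflicts g hA hB hCu hCw
      rw [← Finset.card_pair hS]
      refine card_le_nadj_of_conflicts h.facet _ fun S hS => ?_
      simp only [Finset.mem_insert, Finset.mem_singleton] at hS
      rcases hS with rfl | rfl
      exacts [h1, h2]
    · push Not at hCw
      obtain ⟨c, hc⟩ := hCw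
      exact (h.symm.two_le_missing hne).trans (h.symm.card_missing_le hc)
  · push Not at hCu
    obtain ⟨c, hc⟩ := hCu
    exact (h.two_le_missing hne).trans (h.card_missing_le hc)

end TwoOutsiders

theorem Good.exists_twoOut {V F : Finset E} (h : Good V) (hF : F ∈ facets V)
    (hc : V.card = F.card + 2) : ∃ u w, TwoOut V F u w := by
  have := card_sdiff_of_facet hF
  obtain ⟨u, w, hne, he⟩ := Finset.card_eq_two.1 (show (V \ F).card = 2 by omega)
  exact ⟨u, w, h, hF, hne, he⟩

theorem card_facet_le {V G : Finset E} (hG : G ∈ facets V) : G.card + 1 ≤ V.card := by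
  have := Finset.card_lt_card ((facets_subset hG).ssubset_of_ne (facets_ne_self hG))
  omega

theorem type_cases {a b : ℕ} (ha : 3 ≤ a) (hb : 3 ≤ b) :
    (a = 3 ∧ b = 3) ∨ (a = 3 ∧ b = 4) ∨ (a = 4 ∧ b = 3) ∨ a + b + 7 ≤ a * b := by
  obtain ⟨i, rfl⟩ := Nat.exists_eq_add_of_le ha
  obtain ⟨j, rfl⟩ := Nat.exists_eq_add_of_le hb
  have : (3 + i) * (3 + j) = 9 + 3 * i + 3 * j + i * j := by ring
  rw [this]
  omega

/-- A lower bound for the number of facets of a 2-neighborly polytope with `d + 3` vertices. -/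
theorem Good.card_facets_of_card_eq_add_two {V : Finset E} {d : ℕ} (h : Good V) (hd : 4 ≤ d)
    (hr : rk V = d + 1) (hn : V.card = d + 3) : d + 7 ≤ (facets V).card := by
  induction d, hd using Nat.le_induction generalizing V with
  | base =>
    have := h.card_facets_of_simplicial_of_card_eq le_rfl hr
      (fun G hG => h.card_facet_of_rk_five hr hG) hn
    omega
  | succ d hd ih =>
    by_cases h1 : ∃ G ∈ facets V, G.card = d + 3
    · obtain ⟨G, hG, hGc⟩ := h1
      have := facets_rk hG
      have := ih (h.mono (facets_subset hG)) (by omega) hGc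
      have := card_facets_eq hG
      omega
    · push Not at h1
      have hle : ∀ G ∈ facets V, G.card = d + 1 ∨ G.card = d + 2 := by
        intro G hG
        have := card_facet_le hG
        have := facets_card hG
        have := h1 G hG
        omega
      by_cases h2 : ∃ F ∈ facets V, F.card = d + 2
      · obtain ⟨F, hF, hFc⟩ := h2
        have hFr := facets_rk hF
        obtain ⟨A, B, C, g⟩ := (h.mono (facets_subset hF)).exists_galeType (by omega)
        obtain ⟨u, w, ho⟩ := h.exists_twoOut hF (by omega)
        have e1 := card_facets_eq hF
        have e2 := g.card_facets
        have e3 := g.card_sum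
        have e4 := g.three_le_A
        have e5 := g.three_le_B
        rcases type_cases e4 e5 with ⟨hA, hB⟩ | ⟨hA, hB⟩ | ⟨hA, hB⟩ | hAB
        · have := ho.two_le_nadj g hA hB
          rw [hA, hB] at e2 e3
          omega
        · rw [hA, hB] at e2 e3
          omega
        · rw [hA, hB] at e2 e3
          omega
        · omega
      · push Not at h2
        have := h.card_facets_of_simplicial_of_card_eq (show 4 ≤ d + 1 by omega) hr
          (fun G hG => (hle G hG).resolve_right (h2 G hG)) hn
        omega

end FaceCone

namespace FaceCone

variable {E : Type*} [AddCommGroup E] [Module ℝ E] [DecidableEq E]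

section TwoOutsiders

variable {V F A B C : Finset E} {u w : E}

theorem TwoOut.mem_missing_or (h : TwoOut V F u w) {R : Finset E} (hR : R ∈ facets F)
    (hc : (opp V F R).card ≤ R.card + 1) : R ∈ missing V F u ∨ R ∈ missing V F w := by
  by_contra! hn
  simp only [mem_missing, hR, true_and, not_not] at hn
  have h1 := card_sdiff_opp h.facet hR
  have h2 : ({u, w} : Finset E) ⊆ opp V F R \ F := by
    intro x hx
    simp only [Finset.mem_insert, Finset.mem_singleton] at hx
    rcases hx with rfl | rfl
    exacts [Finset.mem_sdiff.2 ⟨hn.1, h.u_mem.2⟩, Finset.mem_sdiff.2 ⟨hn.2, h.w_mem.2⟩]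
  have h3 := Finset.card_le_card h2
  rw [Finset.card_pair h.ne] at h3
  omega

theorem TwoOut.one_le_nadj (h : TwoOut V F u w) (g : GaleType F A B C) (hA : A.card = 3) :
    1 ≤ (nadj V F).card := by
  have hne : F.Nonempty := Finset.card_pos.1 (by have := g.card_eq; omega)
  by_cases hCu : ∀ c, F.erase c ∉ missing V F u
  · by_cases hCw : ∀ c, F.erase c ∉ missing V F w
    · obtain ⟨a, -, b, -, b', -, -, h1⟩ := h.exists_row_conflict g hA hCu hCw
      obtain ⟨H, hH, -⟩ := h1.exists_nadj h.facet
      exact Finset.card_pos.2 ⟨H, hH⟩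
    · push Not at hCw
      obtain ⟨c, hc⟩ := hCw
      have := (h.symm.two_le_missing hne).trans (h.symm.card_missing_le hc)
      omega
  · push Not at hCu
    obtain ⟨c, hc⟩ := hCu
    have := (h.two_le_missing hne).trans (h.card_missing_le hc)
    omega

/-- If the second facet of a cell contains both outside vertices, it is the complement of a
pair. -/
theorem TwoOut.erase_mem_facets (h : TwoOut V F u w) (g : GaleType F A B C) {a b : E} (ha : a ∈ A)
    (hb : b ∈ B) (hu : (F.erase a).erase b ∉ missing V F u)
    (hw : (F.erase a).erase b ∉ missing V F w) : (V.erase a).erase b ∈ facets V := by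
  have hR := g.cell_mem ha hb
  simp only [mem_missing, hR, true_and, not_not] at hu hw
  have hG := opp_mem h.facet hR
  convert hG using 1
  ext x
  by_cases hx : x ∈ F
  · rw [mem_opp_iff h.facet hR hx]
    simp [hx, facets_subset h.facet hx]
  · have hxa : x ≠ a := fun he => hx (he ▸ g.A_subset ha)
    have hxb : x ≠ b := fun he => hx (he ▸ g.B_subset hb)
    simp only [Finset.mem_erase, hxa, hxb, ne_eq, not_false_eq_true, true_and]
    constructor
    · intro hxV
      rcases h.eq_or hxV hx with rfl | rfl
      exacts [hu, hw]
    · exact fun hxG => facets_subset hG hxG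

end TwoOutsiders

/-- The facets with all but two of the vertices, when there are few facets. -/
theorem Good.exists_galeType_three {V F : Finset E} {d : ℕ} (h : Good V)
    (hr : rk V = d + 1) (hn : V.card = d + 3) (hf : (facets V).card ≤ d + 7) (hF : F ∈ facets V)
    (hFc : F.card = d + 1) : ∃ A B C, GaleType F A B C ∧ A.card = 3 ∧ B.card = 3 ∧
      C.card + 5 = d ∧ (nadj V F).card = 2 := by
  have hFr := facets_rk hF
  obtain ⟨A, B, C, g⟩ := (h.mono (facets_subset hF)).exists_galeType (by omega)
  obtain ⟨u, w, ho⟩ := h.exists_twoOut hF (by omega)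
  have e1 := card_facets_eq hF
  have e2 := g.card_facets
  have e3 := g.card_sum
  rcases type_cases g.three_le_A g.three_le_B with ⟨hA, hB⟩ | ⟨hA, hB⟩ | ⟨hA, hB⟩ | hAB
  · have := ho.two_le_nadj g hA hB
    rw [hA, hB] at e2 e3
    exact ⟨A, B, C, g, hA, hB, by omega, by omega⟩
  · have := ho.one_le_nadj g hA
    rw [hA, hB] at e2 e3
    omega
  · have := ho.one_le_nadj g.swap hB
    rw [hA, hB] at e2 e3
    omega
  · omega

theorem exists_third {A : Finset E} (hA : A.card = 3) (a b : E) : ∃ c ∈ A, c ≠ a ∧ c ≠ b := by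
  have : ¬ A ⊆ {a, b} := by
    intro h
    have := (Finset.card_le_card h).trans Finset.card_le_two
    omega
  obtain ⟨c, hc, hn⟩ := Finset.not_subset.1 this
  simp only [Finset.mem_insert, Finset.mem_singleton, not_or] at hn
  exact ⟨c, hc, hn⟩

/-- Removing a second vertex from the complement of a pair. -/
theorem erase_mem_facets_of_pairs {V : Finset E} {a b b' : E}
    (h1 : (V.erase a).erase b ∈ facets V) (h2 : (V.erase a).erase b' ∈ facets V) (hb : b ∈ V)
    (hba : b ≠ a) (hbb : b ≠ b') :
    ((V.erase a).erase b).erase b' ∈ facets ((V.erase a).erase b) := by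
  have hne : (V.erase a).erase b' ≠ (V.erase a).erase b := by
    intro he
    have : b ∈ (V.erase a).erase b' := by simp [hb, hba, hbb]
    rw [he] at this
    simp at this
  have hc : ((V.erase a).erase b' \ (V.erase a).erase b).card ≤ 1 := by
    have : (V.erase a).erase b' \ (V.erase a).erase b ⊆ {b} := by
      intro x
      simp only [Finset.mem_sdiff, Finset.mem_erase, Finset.mem_singleton]
      tauto
    simpa using Finset.card_le_card this
  have := inter_mem_facets h1 h2 hne hc
  convert this using 1
  ext x
  simp only [Finset.mem_inter, Finset.mem_erase]
  tauto

section TwoNadj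

variable {V F A B C : Finset E} {u w : E}

theorem TwoOut.not_adjacent (h : TwoOut V F u w) (ht : (nadj V F).card ≤ 2) {c : E}
    (hc : F.erase c ∈ missing V F u) (h2 : 2 ≤ (missing V F w).card) {R R' : Finset E}
    (hR : R ∈ missing V F u) (hRc : R ≠ F.erase c) (hR' : R' ∈ missing V F w)
    (ha : (R' \ R).card ≤ 1 ∨ (R \ R').card ≤ 1) : False := by
  have hcf := (mem_missing.1 hc).1
  have hRf := (mem_missing.1 hR).1
  have hRf' := (mem_missing.1 hR').1
  have hcw : F.erase c ∉ missing V F w := fun hw => h.disjoint_missing hc hw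
  have hne : R ≠ R' := by
    rintro rfl
    exact h.disjoint_missing hR hR'
  have hrk : rk F = rk (R' ∩ R) + 2 := by
    rcases ha with ha | ha
    · exact (rk_inter_of_sdiff hRf' hRf hne.symm ha).symm
    · rw [Finset.inter_comm]
      exact (rk_inter_of_sdiff hRf hRf' hne ha).symm
  have hconf : IsConflict V F (R' ∩ R) := by
    rcases ha with ha | ha
    · exact h.isConflict hR' hR ha
    · rw [Finset.inter_comm]
      exact h.symm.isConflict hR hR' ha
  have hcard := card_le_nadj_of_conflicts h.facet
    (insert (R' ∩ R) ((missing V F w).image fun Q => Q ∩ F.erase c)) ?_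
  · rw [Finset.card_insert_of_notMem, Finset.card_image_of_injOn
      (injOn_inter_erase (W := missing V F w) hcf (Finset.filter_subset _ _) hcw)] at hcard
    · omega
    · intro hm
      obtain ⟨Q, hQ, he⟩ := Finset.mem_image.1 hm
      refine hRc (unique_other_facet ((facets_isFace hRf').inter (facets_isFace hRf)) hrk hRf' hRf
        hcf Finset.inter_subset_left Finset.inter_subset_right ?_ hne fun he' => ?_)
      · rw [← he]
        exact Finset.inter_subset_right
      · exact hcw (he' ▸ hR')
  · intro S hS
    rcases Finset.mem_insert.1 hS with rfl | hS
    · exact hconf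
    · obtain ⟨Q, hQ, rfl⟩ := Finset.mem_image.1 hS
      exact h.isConflict hQ hc (card_sdiff_erase_le (facets_subset (mem_missing.1 hQ).1) c)

/-- Two ridges covering `F` that are both cells lie in different rows and columns. -/
theorem TwoOut.exists_cells (h : TwoOut V F u w) (g : GaleType F A B C)
    (h2 : (missing V F w).card = 2) (hC : ∀ c, F.erase c ∉ missing V F w) :
    ∃ a₁ ∈ A, ∃ a₂ ∈ A, ∃ b₁ ∈ B, ∃ b₂ ∈ B, a₁ ≠ a₂ ∧ b₁ ≠ b₂ ∧
      missing V F w = {(F.erase a₁).erase b₁, (F.erase a₂).erase b₂} := by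
  obtain ⟨R₁, R₂, hne, he⟩ := Finset.card_eq_two.1 h2
  have cell : ∀ R ∈ missing V F w, ∃ a ∈ A, ∃ b ∈ B, R = (F.erase a).erase b := by
    intro R hR
    rcases (g.mem_facets_iff R).1 (mem_missing.1 hR).1 with hab | ⟨c, -, rfl⟩
    · exact hab
    · exact absurd hR (hC c)
  obtain ⟨a₁, ha₁, b₁, hb₁, rfl⟩ := cell R₁ (by simp [he])
  obtain ⟨a₂, ha₂, b₂, hb₂, rfl⟩ := cell R₂ (by simp [he])
  refine ⟨a₁, ha₁, a₂, ha₂, b₁, hb₁, b₂, hb₂, ?_, ?_, he⟩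
  · rintro rfl
    obtain ⟨R, hR, hm⟩ := h.cover (g.A_subset ha₁)
    simp only [he, Finset.mem_insert, Finset.mem_singleton] at hR
    rcases hR with rfl | rfl <;> simp at hm
  · rintro rfl
    obtain ⟨R, hR, hm⟩ := h.cover (g.B_subset hb₁)
    simp only [he, Finset.mem_insert, Finset.mem_singleton] at hR
    rcases hR with rfl | rfl <;> simp at hm

theorem card_cell_sdiff_row (F : Finset E) (a b b' : E) :
    ((F.erase a).erase b \ (F.erase a).erase b').card ≤ 1 := by
  have : (F.erase a).erase b \ (F.erase a).erase b' ⊆ {b'} := by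
    intro x
    simp only [Finset.mem_sdiff, Finset.mem_erase, Finset.mem_singleton]
    tauto
  simpa using Finset.card_le_card this

theorem card_cell_sdiff_col (F : Finset E) (a a' b : E) :
    ((F.erase a).erase b \ (F.erase a').erase b).card ≤ 1 := by
  rw [Finset.erase_right_comm, Finset.erase_right_comm (a := a')]
  exact card_cell_sdiff_row F b a a'

theorem TwoOut.C_eq_empty_aux (h : TwoOut V F u w) (g : GaleType F A B C) (hA : A.card = 3)
    (hB : B.card = 3) (ht : (nadj V F).card = 2)
    (hsmall : ∀ G ∈ facets V, G.card ≤ F.card)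
    (hall : ∀ G ∈ facets V, G.card = F.card →
      ∃ A' B' C' : Finset E, GaleType G A' B' C' ∧ C'.card = C.card)
    {c : E} (hcu : F.erase c ∈ missing V F u) : False := by
  have hne : F.Nonempty := Finset.card_pos.1 (by have := g.card_eq; omega)
  have h2 : (missing V F w).card = 2 :=
    le_antisymm (ht ▸ h.card_missing_le hcu) (h.two_le_missing hne)
  have key : ∀ {R R' : Finset E}, R ∈ missing V F u → R ≠ F.erase c → R' ∈ missing V F w →
      ((R' \ R).card ≤ 1 ∨ (R \ R').card ≤ 1) → False :=
    fun hR hRc hR' ha => h.not_adjacent ht.le hcu h2.ge hR hRc hR' ha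
  have mem_F : ∀ {c}, F.erase c ∈ facets F → c ∈ F := by
    intro c hc
    by_contra hn
    rw [Finset.erase_eq_of_notMem hn] at hc
    exact facets_ne_self hc rfl
  have hcF : c ∈ F := mem_F (mem_missing.1 hcu).1
  have hCw : ∀ c', F.erase c' ∉ missing V F w := by
    intro c' hc'
    obtain ⟨R, hR, hcR⟩ := h.symm.cover hcF
    refine key hR ?_ hc' (Or.inr (card_sdiff_erase_le (facets_subset (mem_missing.1 hR).1) c'))
    rintro rfl
    simp at hcR
  obtain ⟨a₁, ha₁, a₂, ha₂, b₁, hb₁, b₂, hb₂, haa, hbb, he⟩ := h.exists_cells g h2 hCw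
  have hm1 : (F.erase a₁).erase b₁ ∈ missing V F w := by simp [he]
  have hm2 : (F.erase a₂).erase b₂ ∈ missing V F w := by simp [he]
  have hC1 : C.card ≤ 1 := by
    rw [Finset.card_le_one_iff_subset_singleton]
    refine ⟨c, fun c' hc' => ?_⟩
    rw [Finset.mem_singleton]
    by_contra hcc
    have hR := g.erase_mem hc'
    have h3 := Finset.card_erase_add_one (g.C_subset hc')
    rcases h.mem_missing_or hR (by have := hsmall _ (opp_mem h.facet hR); omega) with hu | hw
    · refine key hu ?_ hm1 (Or.inl (card_sdiff_erase_le (facets_subset (mem_missing.1 hm1).1) c'))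
      intro h4
      have : c ∈ F.erase c' := Finset.mem_erase.2 ⟨fun h5 => hcc h5.symm, hcF⟩
      rw [h4] at this
      simp at this
    · exact hCw _ hw
  obtain ⟨a₃, ha₃, ha31, ha32⟩ := exists_third hA a₁ a₂
  obtain ⟨b₃, hb₃, hb31, hb32⟩ := exists_third hB b₁ b₂
  have full : ∀ {a b}, a ∈ A → b ∈ B → ¬ (a = a₁ ∧ b = b₁) → ¬ (a = a₂ ∧ b = b₂) →
      (a = a₁ ∨ b = b₂) → (V.erase a).erase b ∈ facets V := by
    intro a b ha hb hn1 hn2 hor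
    refine h.erase_mem_facets g ha hb (fun hu => ?_) fun hw => ?_
    · have hRc : (F.erase a).erase b ≠ F.erase c := by
        intro h4
        have h5 := g.card_cell ha hb
        have h6 := Finset.card_erase_add_one hcF
        rw [h4] at h5
        omega
      rcases hor with rfl | rfl
      · exact key hu hRc hm1 (Or.inl (card_cell_sdiff_row F a b₁ b))
      · exact key hu hRc hm2 (Or.inl (card_cell_sdiff_col F a₂ a b))
    · rw [he] at hw
      simp only [Finset.mem_insert, Finset.mem_singleton] at hw
      rcases hw with hw | hw
      · exact hn1 (g.cell_inj ha hb ha₁ hb₁ hw)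
      · exact hn2 (g.cell_inj ha hb ha₂ hb₂ hw)
  have f12 := full ha₁ hb₂ (by simp [hbb.symm]) (by simp [haa]) (by simp)
  have f13 := full ha₁ hb₃ (by simp [hb31]) (by simp [haa]) (by simp)
  have f32 := full ha₃ hb₂ (by simp [ha31]) (by simp [ha32]) (by simp)
  have V_of_A : ∀ {a}, a ∈ A → a ∈ V := fun ha => facets_subset h.facet (g.A_subset ha)
  have V_of_B : ∀ {b}, b ∈ B → b ∈ V := fun hb => facets_subset h.facet (g.B_subset hb)
  obtain ⟨A', B', C', g', hC'⟩ := hall _ f12 (by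
    rw [Finset.card_erase_of_mem (Finset.mem_erase.2 ⟨(g.ne ha₁ hb₂).symm, V_of_B hb₂⟩),
      Finset.card_erase_of_mem (V_of_A ha₁), h.card_eq]
    omega)
  have m1 : b₃ ∈ C' := g'.mem_C_of_erase
    (by simp [hb32, V_of_B hb₃, (g.ne ha₁ hb₃).symm])
    (erase_mem_facets_of_pairs f12 f13 (V_of_B hb₂) (g.ne ha₁ hb₂).symm hb32.symm)
  have m2 : a₃ ∈ C' := by
    refine g'.mem_C_of_erase (by simp [V_of_A ha₃, ha31, g.ne ha₃ hb₂]) ?_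
    have := erase_mem_facets_of_pairs (b' := a₃) (by rwa [Finset.erase_right_comm] at f12)
      (by rwa [Finset.erase_right_comm] at f32) (V_of_A ha₁) (g.ne ha₁ hb₂) ha31.symm
    rwa [Finset.erase_right_comm (a := b₂)] at this
  have : 1 < C'.card := Finset.one_lt_card.2 ⟨b₃, m1, a₃, m2, (g.ne ha₃ hb₃).symm⟩
  omega

end TwoNadj

end FaceCone

namespace FaceCone

variable {E : Type*} [AddCommGroup E] [Module ℝ E] [DecidableEq E]

/-- In a polytope with `d + 3` vertices and at most `d + 7` facets, none of them a pyramid base,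
every facet with `d + 1` vertices is a sum of two triangles. -/
theorem Good.exists_galeType_empty {V F : Finset E} {d : ℕ} (h : Good V)
    (hr : rk V = d + 1) (hn : V.card = d + 3) (hf : (facets V).card ≤ d + 7)
    (hs : ∀ G ∈ facets V, G.card ≤ d + 1) (hF : F ∈ facets V) (hFc : F.card = d + 1) :
    ∃ A B, GaleType F A B ∅ ∧ A.card = 3 ∧ B.card = 3 ∧ d = 5 ∧ (nadj V F).card = 2 := by
  obtain ⟨A, B, C, g, hA, hB, hC, ht⟩ := h.exists_galeType_three hr hn hf hF hFc
  obtain ⟨u, w, ho⟩ := h.exists_twoOut hF (by omega)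
  have hall : ∀ G ∈ facets V, G.card = F.card →
      ∃ A' B' C' : Finset E, GaleType G A' B' C' ∧ C'.card = C.card := by
    intro G hG hGc
    obtain ⟨A', B', C', g', -, -, hC', -⟩ := h.exists_galeType_three hr hn hf hG (by omega)
    exact ⟨A', B', C', g', by omega⟩
  obtain rfl : C = ∅ := by
    by_contra hne
    obtain ⟨c, hc⟩ := Finset.nonempty_iff_ne_empty.2 hne
    have hR := g.erase_mem hc
    have h3 := Finset.card_erase_add_one (g.C_subset hc)
    have hs' : ∀ G ∈ facets V, G.card ≤ F.card := fun G hG => by rw [hFc]; exact hs G hG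
    rcases ho.mem_missing_or hR (by have := hs _ (opp_mem hF hR); omega) with hu | hw
    · exact ho.C_eq_empty_aux g hA hB ht hs' hall hu
    · exact ho.symm.C_eq_empty_aux g hA hB ht hs' hall hw
  exact ⟨A, B, g, hA, hB, by simpa using hC.symm, ht⟩

/-- The combinatorial properties of a 2-neighborly 5-polytope with 8 vertices and 12 facets that
is not a pyramid. -/
structure Extremal (V : Finset E) : Prop where
  good : Good V
  card_eq : V.card = 8
  card_facets : (facets V).card = 12
  card_or : ∀ G ∈ facets V, G.card = 5 ∨ G.card = 6
  card_six : ((facets V).filter fun G => G.card = 6).card = 4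
  mem_or : ∀ F ∈ facets V, ∀ G ∈ facets V, F.card = 6 → G.card = 6 → F ≠ G →
    ∀ x ∈ V, x ∈ F ∨ x ∈ G
  card_avoid : ∀ x ∈ V, ((facets V).filter fun G => x ∉ G).card = 4
  nadj : ∀ F ∈ facets V, F.card = 6 → ∀ G ∈ nadj V F, G.card = 5 ∧ V \ G ⊆ F

section Empty

variable {V F A B : Finset E} {u w : E}

theorem GaleType.erase_notMem_facets (g : GaleType F A B ∅) (c : E) : F.erase c ∉ facets F := by
  intro hc
  by_cases hcF : c ∈ F
  · simpa using g.mem_C_of_erase hcF hc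
  · rw [Finset.erase_eq_of_notMem hcF] at hc
    exact facets_ne_self hc rfl

theorem GaleType.card_of_mem_facets (g : GaleType F A B ∅) {R : Finset E} (hR : R ∈ facets F) :
    R.card + 2 = F.card := by
  rcases (g.mem_facets_iff R).1 hR with ⟨a, ha, b, hb, rfl⟩ | ⟨c, hc, -⟩
  · exact g.card_cell ha hb
  · simp at hc

theorem TwoOut.card_inter_of_nadj (h : TwoOut V F u w) (g : GaleType F A B ∅) (hA : A.card = 3)
    (hB : B.card = 3) (ht : (FaceCone.nadj V F).card = 2) :
    ∀ G ∈ FaceCone.nadj V F, (G ∩ F).card + 3 = F.card := by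
  obtain ⟨S, S', hne, h1, h2, hS, hS'⟩ := h.exists_two_conflicts g hA hB
    (fun c hc => g.erase_notMem_facets c (mem_missing.1 hc).1)
    (fun c hc => g.erase_notMem_facets c (mem_missing.1 hc).1)
  obtain ⟨H, hH, rfl⟩ := h1.exists_nadj h.facet
  obtain ⟨H', hH', rfl⟩ := h2.exists_nadj h.facet
  have hHH : H ≠ H' := fun he => hne (he ▸ rfl)
  have : ({H, H'} : Finset (Finset E)) = FaceCone.nadj V F := by
    refine Finset.eq_of_subset_of_card_le ?_ (by rw [ht, Finset.card_pair hHH])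
    intro G hG
    simp only [Finset.mem_insert, Finset.mem_singleton] at hG
    rcases hG with rfl | rfl
    exacts [hH, hH']
  intro G hG
  rw [← this] at hG
  simp only [Finset.mem_insert, Finset.mem_singleton] at hG
  rcases hG with rfl | rfl
  exacts [hS, hS']

/-- If the complements of any two cells in the same row are not both facets, every row that meets
`missing V F w` in a single cell contains a conflict. -/
theorem TwoOut.exists_conflict_in_row {C : Finset E} (h : TwoOut V F u w) (g : GaleType F A B C)
    (hB : B.card = 3)
    (hp : ∀ a b b', b ∈ V → b' ∈ V → b ≠ a → b' ≠ a → b ≠ b' → a ∈ V →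
      (V.erase a).erase b ∈ facets V → (V.erase a).erase b' ∈ facets V → False)
    {a b : E} (ha : a ∈ A) (hm : (F.erase a).erase b ∈ missing V F w)
    (hn : ∀ b' ∈ B, b' ≠ b → (F.erase a).erase b' ∉ missing V F w) :
    ∃ b' ∈ B, b' ≠ b ∧ IsConflict V F (((F.erase a).erase b).erase b') := by
  by_contra! hcon
  have full : ∀ b' ∈ B, b' ≠ b → (V.erase a).erase b' ∈ facets V := by
    intro b' hb' hne
    exact h.erase_mem_facets g ha hb' (fun hu => hcon b' hb' hne (h.isConflict_row hm hu))
      (hn b' hb' hne)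
  obtain ⟨b₂, hb₂, hb2, -⟩ := exists_third hB b b
  obtain ⟨b₃, hb₃, hb3, hb32⟩ := exists_third hB b b₂
  have hVB : ∀ {b}, b ∈ B → b ∈ V := fun hb => facets_subset h.facet (g.B_subset hb)
  exact hp a b₂ b₃ (hVB hb₂) (hVB hb₃) (g.ne ha hb₂).symm (g.ne ha hb₃).symm hb32.symm
    (facets_subset h.facet (g.A_subset ha)) (full b₂ hb₂ hb2) (full b₃ hb₃ hb3)

theorem TwoOut.three_le_missing (h : TwoOut V F u w) (g : GaleType F A B ∅) (hA : A.card = 3)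
    (hB : B.card = 3) (ht : (FaceCone.nadj V F).card = 2)
    (hp : ∀ a b b', b ∈ V → b' ∈ V → b ≠ a → b' ≠ a → b ≠ b' → a ∈ V →
      (V.erase a).erase b ∈ facets V → (V.erase a).erase b' ∈ facets V → False) :
    3 ≤ (missing V F w).card := by
  have hne : F.Nonempty := Finset.card_pos.1 (by have := g.card_eq; omega)
  have hC : ∀ c, F.erase c ∉ missing V F w :=
    fun c hc => g.erase_notMem_facets c (mem_missing.1 hc).1
  by_contra hlt
  have h2 : (missing V F w).card = 2 := by
    have := h.two_le_missing hne
    omega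
  obtain ⟨a₁, ha₁, a₂, ha₂, b₁, hb₁, b₂, hb₂, haa, hbb, he⟩ := h.exists_cells g h2 hC
  have hm : ∀ {a b}, a ∈ A → b ∈ B → (F.erase a).erase b ∈ missing V F w →
      (a = a₁ ∧ b = b₁) ∨ (a = a₂ ∧ b = b₂) := by
    intro a b ha hb hab
    rw [he] at hab
    simp only [Finset.mem_insert, Finset.mem_singleton] at hab
    rcases hab with hab | hab
    · exact Or.inl (g.cell_inj ha hb ha₁ hb₁ hab)
    · exact Or.inr (g.cell_inj ha hb ha₂ hb₂ hab)
  have hm1 : (F.erase a₁).erase b₁ ∈ missing V F w := by simp [he]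
  have hm2 : (F.erase a₂).erase b₂ ∈ missing V F w := by simp [he]
  obtain ⟨x, hx, hxb, c1⟩ := h.exists_conflict_in_row g hB hp ha₁ hm1 fun b' hb' hne hw => by
    rcases hm ha₁ hb' hw with ⟨-, h⟩ | ⟨h, -⟩
    exacts [hne h, haa h]
  obtain ⟨y, hy, hyb, c2⟩ := h.exists_conflict_in_row g hB hp ha₂ hm2 fun b' hb' hne hw => by
    rcases hm ha₂ hb' hw with ⟨h, -⟩ | ⟨-, h⟩
    exacts [haa h.symm, hne h]
  obtain ⟨z, hz, hza, c3⟩ := h.exists_conflict_in_row g.swap hA hp hb₁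
    (by rwa [Finset.erase_right_comm]) fun a' ha' hne hw => by
    rw [Finset.erase_right_comm] at hw
    rcases hm ha' hb₁ hw with ⟨h, -⟩ | ⟨-, h⟩
    exacts [hne h, hbb h]
  have n12 : ((F.erase a₁).erase b₁).erase x ≠ ((F.erase a₂).erase b₂).erase y := by
    intro h
    have : a₁ ∈ ((F.erase a₂).erase b₂).erase y := by
      simp [haa, g.ne ha₁ hb₂, g.ne ha₁ hy, g.A_subset ha₁]
    rw [← h] at this
    simp at this
  have n13 : ((F.erase a₁).erase b₁).erase x ≠ ((F.erase b₁).erase a₁).erase z := by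
    intro h
    have : z ∈ ((F.erase a₁).erase b₁).erase x := by
      simp [hza, g.ne hz hb₁, g.ne hz hx, g.A_subset hz]
    rw [h] at this
    simp at this
  have n23 : ((F.erase a₂).erase b₂).erase y ≠ ((F.erase b₁).erase a₁).erase z := by
    intro h
    have : a₁ ∈ ((F.erase a₂).erase b₂).erase y := by
      simp [haa, g.ne ha₁ hb₂, g.ne ha₁ hy, g.A_subset ha₁]
    rw [h] at this
    simp at this
  have := card_le_nadj_of_conflicts h.facet
    {((F.erase a₁).erase b₁).erase x, ((F.erase a₂).erase b₂).erase y,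
      ((F.erase b₁).erase a₁).erase z} (by
    intro S hS
    simp only [Finset.mem_insert, Finset.mem_singleton] at hS
    rcases hS with rfl | rfl | rfl
    exacts [c1, c2, c3])
  rw [Finset.card_insert_of_notMem (by simp [n12, n13]), Finset.card_pair n23, ht] at this
  omega

theorem card_missing_lt {w : E} (hF : F ∈ facets V) (hw : w ∉ F) :
    (missing V F w).card + 1 ≤ ((facets V).filter fun G => w ∉ G).card := by
  have hinj : Set.InjOn (opp V F) (missing V F w : Set (Finset E)) := by
    intro R hR R' hR' he
    have h1 := opp_inter hF (mem_missing.1 (Finset.mem_coe.1 hR)).1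
    have h2 := opp_inter hF (mem_missing.1 (Finset.mem_coe.1 hR')).1
    rw [← h1, he, h2]
  have hFn : F ∉ (missing V F w).image (opp V F) := by
    intro h
    obtain ⟨R, hR, he⟩ := Finset.mem_image.1 h
    exact opp_ne hF (mem_missing.1 hR).1 he
  rw [← Finset.card_image_of_injOn hinj, ← Finset.card_insert_of_notMem hFn]
  refine Finset.card_le_card fun G hG => ?_
  rcases Finset.mem_insert.1 hG with rfl | hG
  · exact Finset.mem_filter.2 ⟨hF, hw⟩
  · obtain ⟨R, hR, rfl⟩ := Finset.mem_image.1 hG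
    exact Finset.mem_filter.2 ⟨opp_mem hF (mem_missing.1 hR).1, (mem_missing.1 hR).2⟩

/-- A pair of vertices outside an adjacent facet lies on at least five facets. -/
theorem GaleType.five_le_deg {G : Finset E} (hG : G ∈ facets V) (g : GaleType G A B ∅)
    (hA : A.card = 3) (hB : B.card = 3) (hR : F ∩ G ∈ facets G) (hu : u ∈ G) (hw : w ∈ G)
    (huF : u ∉ F) (hwF : w ∉ F) (hne : u ≠ w) : 5 ≤ deg V {u, w} := by
  have h4 : deg G {u, w} = 4 := by
    rcases (g.mem_facets_iff _).1 hR with ⟨a, ha, b, hb, he⟩ | ⟨c, hc, -⟩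
    · have hin : ∀ x ∈ G, x ∉ F → x = a ∨ x = b := by
        intro x hx hxF
        by_contra! hcon
        have : x ∈ (G.erase a).erase b := by simp [hcon, hx]
        rw [← he] at this
        exact hxF (Finset.mem_inter.1 this).1
      have h5 := g.deg_cross ha hb
      have h6 : ({u, w} : Finset E) = {a, b} := by
        rcases hin u hu huF with rfl | rfl <;> rcases hin w hw hwF with rfl | rfl
        · exact absurd rfl hne
        · rfl
        · exact Finset.pair_comm _ _
        · exact absurd rfl hne
      rw [h6, h5, hA, hB]
      simp
    · simp at hc
  have h7 := le_deg_of_subset (S := {u, w}) hG (by simp [Finset.insert_subset_iff, hu, hw])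
  omega

end Empty

theorem sum_card_sdiff (V : Finset E) (𝒢 : Finset (Finset E)) :
    ∑ x ∈ V, (𝒢.filter fun G => x ∉ G).card = ∑ G ∈ 𝒢, (V \ G).card := by
  simp only [Finset.card_eq_sum_ones, Finset.sum_filter, Finset.sdiff_eq_filter]
  exact Finset.sum_comm

theorem Good.extremal {V : Finset E} {d : ℕ} (h : Good V) (hd : 4 ≤ d)
    (hr : rk V = d + 1) (hn : V.card = d + 3) (hf : (facets V).card ≤ d + 7)
    (hs : ∀ G ∈ facets V, G.card ≤ d + 1) : d = 5 ∧ Extremal V := by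
  have hge := h.card_facets_of_card_eq_add_two hd hr hn
  obtain ⟨F, hF, hFc⟩ : ∃ F ∈ facets V, F.card = d + 1 := by
    by_contra! hcon
    have := h.card_facets_of_simplicial_of_card_eq hd hr (fun G hG => by
      have := hs G hG
      have := facets_card hG
      have := hcon G hG
      omega) hn
    omega
  have typ := fun {F : Finset E} (hF : F ∈ facets V) (hFc : F.card = d + 1) =>
    h.exists_galeType_empty hr hn hf hs hF hFc
  obtain ⟨A, B, g, hA, hB, rfl, ht⟩ := typ hF hFc
  refine ⟨rfl, ?_⟩
  norm_num at hn hs hf hge hFc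
  have typ := fun {F : Finset E} (hF : F ∈ facets V) (hFc : F.card = 6) => typ hF hFc
  have hor : ∀ G ∈ facets V, G.card = 5 ∨ G.card = 6 := by
    intro G hG
    have := hs G hG
    have := facets_card hG
    omega
  have hdisj : ∀ F ∈ facets V, ∀ G ∈ facets V, F.card = 6 → G.card = 6 → F ≠ G →
      ∀ x ∈ V, x ∈ F ∨ x ∈ G := by
    intro F hF G hG hFc hGc hne x hx
    by_contra! hcon
    obtain ⟨A, B, g, -⟩ := typ hF hFc
    have h1 := card_sdiff_of_facet hF
    have h2 : (G \ F).card + 1 ≤ (V \ F).card := by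
      refine Finset.card_lt_card (Finset.ssubset_iff_subset_ne.2 ⟨?_, fun he => ?_⟩)
      · exact Finset.sdiff_subset_sdiff (facets_subset hG) le_rfl
      · have : x ∈ V \ F := Finset.mem_sdiff.2 ⟨hx, hcon.1⟩
        rw [← he] at this
        exact hcon.2 (Finset.mem_sdiff.1 this).1
    have h3 := g.card_of_mem_facets (inter_mem_facets hF hG hne.symm (by omega))
    have h4 := Finset.card_inter_add_card_sdiff G F
    omega
  have hp : ∀ a b b', b ∈ V → b' ∈ V → b ≠ a → b' ≠ a → b ≠ b' → a ∈ V →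
      (V.erase a).erase b ∈ facets V → (V.erase a).erase b' ∈ facets V → False := by
    intro a b b' hb hb' hba hba' hbb ha h1 h2
    have hc : ∀ b ∈ V, b ≠ a → ((V.erase a).erase b).card = 6 := by
      intro b hb hba
      rw [Finset.card_erase_of_mem (Finset.mem_erase.2 ⟨hba, hb⟩), Finset.card_erase_of_mem ha, hn]
    have := hdisj _ h1 _ h2 (hc b hb hba) (hc b' hb' hba') (fun he => ?_) a ha
    · simp at this
    · have : b ∈ (V.erase a).erase b' := by simp [hb, hba, hbb]
      rw [← he] at this
      simp at this
  have hnadj : ∀ F ∈ facets V, F.card = 6 → ∀ G ∈ nadj V F, G.card = 5 ∧ V \ G ⊆ F := by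
    intro F hF hFc G hG
    obtain ⟨A, B, g, hA, hB, -, ht⟩ := typ hF hFc
    obtain ⟨u, w, ho⟩ := h.exists_twoOut hF (by omega)
    have h1 := ho.card_inter_of_nadj g hA hB ht G hG
    have hGV := (mem_nadj.1 hG).1
    have h2 := Finset.card_inter_add_card_sdiff G F
    have h3 := card_sdiff_of_facet hF
    have h4 : G \ F ⊆ V \ F := Finset.sdiff_subset_sdiff (facets_subset hGV) le_rfl
    have h5 := Finset.card_le_card h4
    have h6 := facets_card hGV
    refine ⟨by omega, fun x hx => ?_⟩
    rw [Finset.mem_sdiff] at hx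
    by_contra hxF
    have : x ∈ V \ F := Finset.mem_sdiff.2 ⟨hx.1, hxF⟩
    rw [← Finset.eq_of_subset_of_card_le h4 (by omega)] at this
    exact hx.2 (Finset.mem_sdiff.1 this).1
  have hfour : ∀ F ∈ facets V, F.card = 6 → ∀ x ∈ V, x ∉ F →
      4 ≤ ((facets V).filter fun G => x ∉ G).card := by
    intro F hF hFc x hx hxF
    obtain ⟨A, B, g, hA, hB, -, ht⟩ := typ hF hFc
    obtain ⟨u, w, ho⟩ := h.exists_twoOut hF (by omega)
    have := card_missing_lt hF hxF
    rcases ho.eq_or hx hxF with rfl | rfl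
    · have := ho.symm.three_le_missing g hA hB ht hp
      omega
    · have := ho.three_le_missing g hA hB ht hp
      omega
  have hsix : 4 ≤ ((facets V).filter fun G => G.card = 6).card := by
    obtain ⟨u, w, ho⟩ := h.exists_twoOut hF (by omega)
    have hdeg : deg V {u, w} + 1 ≤ ((facets V).filter fun G => G.card = 6).card + 2 := by
      have h1 : ((facets V).filter fun G => ({u, w} : Finset E) ⊆ G) ⊆
          (((facets V).filter fun G => G.card = 6).erase F) ∪ nadj V F := by
        intro G hG
        obtain ⟨hGV, huw⟩ := Finset.mem_filter.1 hG
        have hu : u ∈ G := huw (by simp)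
        have hw : w ∈ G := huw (by simp)
        have hGF : G ≠ F := fun he => ho.u_mem.2 (he ▸ hu)
        by_cases hGn : G ∈ nadj V F
        · exact Finset.mem_union_right _ hGn
        · have hR : G ∩ F ∈ facets F := by
            by_contra hR
            exact hGn (mem_nadj.2 ⟨hGV, hGF, hR⟩)
          have h2 := g.card_of_mem_facets hR
          have h3 := Finset.card_inter_add_card_sdiff G F
          have h4 : ({u, w} : Finset E) ⊆ G \ F := by
            intro x hx
            simp only [Finset.mem_insert, Finset.mem_singleton] at hx
            rcases hx with rfl | rfl
            exacts [Finset.mem_sdiff.2 ⟨hu, ho.u_mem.2⟩, Finset.mem_sdiff.2 ⟨hw, ho.w_mem.2⟩]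
          have h5 := Finset.card_le_card h4
          rw [Finset.card_pair ho.ne] at h5
          have := hs G hGV
          exact Finset.mem_union_left _
            (Finset.mem_erase.2 ⟨hGF, Finset.mem_filter.2 ⟨hGV, by omega⟩⟩)
      have h2 := (Finset.card_le_card h1).trans (Finset.card_union_le _ _)
      have h3 := Finset.card_erase_add_one (Finset.mem_filter.2 ⟨hF, hFc⟩ :
        F ∈ (facets V).filter fun G => G.card = 6)
      rw [deg]
      omega
    have h0 := h.le_deg ho.u_mem.1 ho.w_mem.1
    obtain ⟨H, hH, hHF⟩ := Finset.exists_mem_ne (show 1 < ((facets V).filter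
      fun G => G.card = 6).card by omega) F
    obtain ⟨hHV, hHc⟩ := Finset.mem_filter.1 hH
    have hu : u ∈ H := (hdisj F hF H hHV hFc hHc hHF.symm u ho.u_mem.1).resolve_left ho.u_mem.2
    have hw : w ∈ H := (hdisj F hF H hHV hFc hHc hHF.symm w ho.w_mem.1).resolve_left ho.w_mem.2
    have hadj : H ∈ adj V F := by
      refine mem_adj.2 ⟨hHV, ?_⟩
      by_contra hR
      have := (hnadj F hF hFc H (mem_nadj.2 ⟨hHV, hHF, hR⟩)).1
      omega
    have hR := (mem_adj.1 (adj_symm hF hadj)).2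
    obtain ⟨A', B', g', hA', hB', -, -⟩ := typ hHV hHc
    have h7 := g'.five_le_deg hHV hA' hB' hR hu hw ho.u_mem.2 ho.w_mem.2 ho.ne
    omega
  have hdisj' : (((facets V).filter fun G => G.card = 6 : Finset (Finset E)) :
      Set (Finset E)).PairwiseDisjoint fun G => V \ G := by
    intro F hF G hG hne
    simp only [Finset.coe_filter, Set.mem_ofPred_eq] at hF hG
    rw [Function.onFun, Finset.disjoint_left]
    intro x hx hx'
    rw [Finset.mem_sdiff] at hx hx'
    rcases hdisj F hF.1 G hG.1 hF.2 hG.2 hne x hx.1 with h | h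
    exacts [hx.2 h, hx'.2 h]
  have hcard : (((facets V).filter fun G => G.card = 6).biUnion fun G => V \ G).card =
      2 * ((facets V).filter fun G => G.card = 6).card := by
    rw [Finset.card_biUnion hdisj', mul_comm]
    refine Finset.sum_const_nat fun G hG => ?_
    obtain ⟨hGV, hGc⟩ := Finset.mem_filter.1 hG
    have := card_sdiff_of_facet hGV
    omega
  have hsub : (((facets V).filter fun G => G.card = 6).biUnion fun G => V \ G) ⊆ V :=
    Finset.biUnion_subset.2 fun G _ => Finset.sdiff_subset
  have hle := Finset.card_le_card hsub
  have hcov := Finset.eq_of_subset_of_card_le hsub (by omega)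
  have hcf : (facets V).card = 12 := by omega
  have hc6 : ((facets V).filter fun G => G.card = 6).card = 4 := by omega
  have havoid : ∀ x ∈ V, 4 ≤ ((facets V).filter fun G => x ∉ G).card := by
    intro x hx
    have hx' := hx
    rw [← hcov] at hx'
    obtain ⟨G, hG, hxG⟩ := Finset.mem_biUnion.1 hx'
    obtain ⟨hGV, hGc⟩ := Finset.mem_filter.1 hG
    exact hfour G hGV hGc x hx (Finset.mem_sdiff.1 hxG).2
  refine ⟨h, hn, hcf, hor, hc6, hdisj, ?_, hnadj⟩
  have hsum : ∑ x ∈ V, 4 = ∑ x ∈ V, ((facets V).filter fun G => x ∉ G).card := by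
    rw [sum_card_sdiff, Finset.sum_const, hn,
      ← Finset.sum_filter_add_sum_filter_not _ fun G => G.card = 6]
    have hc5 := Finset.card_filter_add_card_filter_not (s := facets V) (fun G => G.card = 6)
    rw [Finset.sum_const_nat (m := 2) fun G hG => ?_,
      Finset.sum_const_nat (m := 3) fun G hG => ?_]
    · rw [smul_eq_mul]
      omega
    · obtain ⟨hGV, hGc⟩ := Finset.mem_filter.1 hG
      have := card_sdiff_of_facet hGV
      have := hor G hGV
      omega
    · obtain ⟨hGV, hGc⟩ := Finset.mem_filter.1 hG
      have := card_sdiff_of_facet hGV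
      omega
  intro x hx
  exact ((Finset.sum_eq_sum_iff_of_le havoid).1 hsum x hx).symm

end FaceCone

namespace FaceCone

variable {E : Type*} [AddCommGroup E] [Module ℝ E] [DecidableEq E]

theorem GaleType.cases_of_card_facets_le {V F A B C : Finset E} {d : ℕ} (hF : F ∈ facets V)
    (hFc : F.card = d + 1) (hf : (facets V).card ≤ d + 7) (g : GaleType F A B C) :
    (A.card = 3 ∧ B.card = 3 ∧ C.card + 5 = d ∧ (nadj V F).card ≤ 2) ∨
      (A.card * B.card = 12 ∧ C.card + 6 = d ∧ (nadj V F).card = 0) := by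
  have e1 := card_facets_eq hF
  have e2 := g.card_facets
  have e3 := g.card_sum
  rcases type_cases g.three_le_A g.three_le_B with ⟨hA, hB⟩ | ⟨hA, hB⟩ | ⟨hA, hB⟩ | hAB
  · rw [hA, hB] at e2 e3
    exact Or.inl ⟨hA, hB, by omega, by omega⟩
  · rw [hA, hB] at e2 e3
    exact Or.inr ⟨by rw [hA, hB], by omega, by omega⟩
  · rw [hA, hB] at e2 e3
    exact Or.inr ⟨by rw [hA, hB], by omega, by omega⟩
  · omega

theorem sub_self_sq_mono {a b : ℕ} (h : a ≤ b) : a * a - a ≤ b * b - b := by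
  rw [← Nat.mul_sub_one, ← Nat.mul_sub_one]
  exact Nat.mul_le_mul h (by omega)

theorem pair_subset_opp {V F R : Finset E} (v w : E) :
    (({v, w} : Finset E) ⊆ opp V F R) ↔ v ∈ opp V F R ∧ w ∈ opp V F R := by
  simp [Finset.insert_subset_iff]

/-- The degree of a pair of vertices outside a facet. -/
theorem deg_le_of_outside {V F : Finset E} (hF : F ∈ facets V) {v w : E} (hv : v ∉ F) :
    deg V {v, w} ≤ ((facets F).filter fun R => v ∈ opp V F R ∧ w ∈ opp V F R).card +
      (nadj V F).card := by
  unfold deg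
  simp only [Finset.card_filter]
  rw [sum_facets hF, if_neg (by simp [Finset.insert_subset_iff, hv]), zero_add]
  gcongr ?_ + ?_
  · simp [pair_subset_opp]
  · rw [Finset.card_eq_sum_ones]
    exact Finset.sum_le_sum fun G _ => by split_ifs <;> omega

theorem eq_pair_of_mem {V F R : Finset E} {v w : E} (hv : v ∈ opp V F R) (hw : w ∈ opp V F R)
    (hvF : v ∉ F) (hwF : w ∉ F) (hne : v ≠ w) (hc : (opp V F R \ F).card ≤ 2) :
    ({v, w} : Finset E) = opp V F R \ F := by
  refine Finset.eq_of_subset_of_card_le ?_ (by rwa [Finset.card_pair hne])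
  intro x hx
  simp only [Finset.mem_insert, Finset.mem_singleton] at hx
  rcases hx with rfl | rfl
  exacts [Finset.mem_sdiff.2 ⟨hv, hvF⟩, Finset.mem_sdiff.2 ⟨hw, hwF⟩]

/-- If every facet has at most two vertices outside `F` and `F.erase c` is a ridge on a facet with
a single vertex outside `F`, there are many facets not adjacent to `F`. -/
theorem Good.rk_le_of_erase_mem_facets {V F : Finset E} (h : Good V) (hF : F ∈ facets V) {c : E}
    (hc : F.erase c ∈ facets F) (hc1 : (opp V F (F.erase c) \ F).card = 1)
    (h2 : ∀ R ∈ facets F, (opp V F R \ F).card ≤ 2) (hO : 3 ≤ (V \ F).card) :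
    rk V ≤ 2 * (nadj V F).card + 2 := by
  obtain ⟨u, hu⟩ := Finset.card_eq_one.1 hc1
  have h3 : 1 < ((V \ F).erase u).card := by
    have := Finset.pred_card_le_card_erase (s := V \ F) (a := u)
    omega
  obtain ⟨v, hv, w, hw, hne⟩ := Finset.one_lt_card.1 h3
  simp only [Finset.mem_erase, Finset.mem_sdiff] at hv hw
  have h4 := h.le_deg hv.2.1 hw.2.1
  have h5 := deg_le_of_outside hF (v := v) (w := w) hv.2.2
  have hdis : ∀ R ∈ (facets F).filter fun R => v ∈ opp V F R ∧ w ∈ opp V F R,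
      opp V F R ∩ opp V F (F.erase c) ⊆ F := by
    intro R hR x hx
    obtain ⟨hRF, hvR, hwR⟩ := Finset.mem_filter.1 hR
    rw [Finset.mem_inter] at hx
    by_contra hxF
    have h6 : x ∈ opp V F (F.erase c) \ F := Finset.mem_sdiff.2 ⟨hx.2, hxF⟩
    have h7 : x ∈ opp V F R \ F := Finset.mem_sdiff.2 ⟨hx.1, hxF⟩
    rw [hu, Finset.mem_singleton] at h6
    rw [← eq_pair_of_mem hvR hwR hv.2.2 hw.2.2 hne (h2 R hRF)] at h7
    simp only [Finset.mem_insert, Finset.mem_singleton] at h7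
    rcases h7 with h7 | h7
    exacts [hv.1 (h7.symm.trans h6), hw.1 (h7.symm.trans h6)]
  have h6 := card_le_nadj_of_erase hF hc _ (Finset.filter_subset _ _) (fun hm => ?_) hdis
  · omega
  · have h7 := hdis _ hm
    rw [Finset.inter_self] at h7
    have h8 : u ∈ opp V F (F.erase c) \ F := by simp [hu]
    exact (Finset.mem_sdiff.1 h8).2 (h7 (Finset.mem_sdiff.1 h8).1)

theorem sum_offDiag_outside {V F : Finset E} (hF : F ∈ facets V) :
    ∑ p ∈ (V \ F).offDiag, deg V {p.1, p.2} =
      ∑ R ∈ facets F, ((opp V F R \ F).card * (opp V F R \ F).card - (opp V F R \ F).card) +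
      ∑ G ∈ nadj V F, ((G \ F).card * (G \ F).card - (G \ F).card) := by
  rw [← sum_offDiag, sum_facets hF, sdiff_inter_eq (facets_subset hF), Finset.sdiff_self,
    Finset.card_empty]
  simp only [Nat.zero_mul, Nat.zero_sub, zero_add]
  congr 1
  · exact Finset.sum_congr rfl fun R hR => by rw [sdiff_inter_eq (facets_subset (opp_mem hF hR))]
  · exact Finset.sum_congr rfl fun G hG => by
      rw [sdiff_inter_eq (facets_subset (mem_nadj.1 hG).1)]

/-- The shape of a facet with `d + 1` vertices in a polytope with few facets, each with at most
`d + 1` of the vertices. -/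
theorem Good.exists_galeType_nine {V F : Finset E} {d : ℕ} (h : Good V)
    (hr : rk V = d + 1) (hn : d + 4 ≤ V.card) (hf : (facets V).card ≤ d + 7)
    (hs : ∀ G ∈ facets V, G.card ≤ d + 1) (hF : F ∈ facets V) (hFc : F.card = d + 1) :
    ∃ A B, GaleType F A B ∅ ∧ A.card = 3 ∧ B.card = 3 ∧ d = 5 ∧ V.card = 9 ∧
      (nadj V F).card ≤ 2 := by
  have hFr := facets_rk hF
  have hO := card_sdiff_of_facet hF
  obtain ⟨A, B, C, g⟩ := (h.mono (facets_subset hF)).exists_galeType (by omega)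
  have h2 : ∀ R ∈ facets F, (opp V F R \ F).card ≤ 2 := by
    intro R hR
    have := card_sdiff_opp hF hR
    have := facets_card hR
    have := hs _ (opp_mem hF hR)
    omega
  have hcases := g.cases_of_card_facets_le hF hFc hf
  have hC : C = ∅ := by
    by_contra hne
    obtain ⟨c, hc⟩ := Finset.nonempty_iff_ne_empty.2 hne
    have hR := g.erase_mem hc
    have h3 := Finset.card_erase_add_one (g.C_subset hc)
    have h4 := card_sdiff_opp hF hR
    have h5 := hs _ (opp_mem hF hR)
    have h6 := one_le_card_sdiff_opp hF hR
    have h7 := h.rk_le_of_erase_mem_facets hF hR (by omega) h2 (by omega)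
    have h8 := Finset.card_pos.2 ⟨c, hc⟩
    omega
  subst hC
  rw [Finset.card_empty] at hcases
  have e2 := g.card_facets
  rw [Finset.card_empty] at e2
  have h3 := h.mul_le_sum_offDiag (X := V \ F) Finset.sdiff_subset
  rw [sum_offDiag, sum_offDiag_outside hF] at h3
  have h4 : ∑ R ∈ facets F, ((opp V F R \ F).card * (opp V F R \ F).card -
      (opp V F R \ F).card) ≤ (facets F).card * 2 := by
    rw [← smul_eq_mul]
    exact Finset.sum_le_card_nsmul _ _ _ fun R hR => sub_self_sq_mono (h2 R hR)
  have h5 : ∑ G ∈ nadj V F, ((G \ F).card * (G \ F).card - (G \ F).card) ≤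
      (nadj V F).card * ((V \ F).card * (V \ F).card - (V \ F).card) := by
    rw [← smul_eq_mul]
    exact Finset.sum_le_card_nsmul _ _ _ fun G hG => sub_self_sq_mono
      (Finset.card_le_card (Finset.sdiff_subset_sdiff (facets_subset (mem_nadj.1 hG).1) le_rfl))
  obtain ⟨m, hm⟩ : ∃ m, m = (V \ F).card * (V \ F).card - (V \ F).card := ⟨_, rfl⟩
  have hm3 : 6 ≤ m := by
    have := sub_self_sq_mono (show 3 ≤ (V \ F).card by omega)
    omega
  rw [← hm] at h3 h5
  rcases hcases with ⟨hA, hB, rfl, ht⟩ | ⟨hAB, rfl, ht⟩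
  · refine ⟨A, B, g, hA, hB, rfl, ?_, ht⟩
    rw [hA, hB] at e2
    rw [e2] at h4
    rw [hr] at h3
    have h6 : (nadj V F).card * m ≤ 2 * m := Nat.mul_le_mul_right _ ht
    by_contra hcon
    have := sub_self_sq_mono (show 4 ≤ (V \ F).card by omega)
    omega
  · rw [ht] at h5
    rw [hr] at h3
    omega

end FaceCone

namespace FaceCone

variable {E : Type*} [AddCommGroup E] [Module ℝ E] [DecidableEq E]

theorem IsFace.rk_le_card_facets {V : Finset E} (h : IsFace V ∅) : rk V ≤ (facets V).card := by
  have h1 := h.rk_le_rk_add_deg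
  rw [rk_empty, zero_add] at h1
  exact h1.trans (Finset.card_filter_le _ _)

theorem card_adj {V F : Finset E} (hF : F ∈ facets V) : (facets F).card ≤ (adj V F).card := by
  refine Finset.card_le_card_of_injOn (opp V F) (fun R hR => opp_mem_adj hF hR) ?_
  intro R hR R' hR' he
  rw [← opp_inter hF hR, he, opp_inter hF hR']

theorem eq_two_of_sub_eq {a : ℕ} (ha : a ≤ 2) (h : a * a - a = 2) : a = 2 := by
  interval_cases a <;> simp_all

/-- Equality in the counting of pairs outside a facet with six of nine vertices. -/
theorem Good.nine_counting {V F : Finset E} (h : Good V) (hr : rk V = 6) (hn : V.card = 9)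
    (hf : (facets V).card ≤ 12) (hs : ∀ G ∈ facets V, G.card ≤ 6) (hF : F ∈ facets V)
    (hFc : F.card = 6) :
    (nadj V F).card = 2 ∧ (∀ R ∈ facets F, (opp V F R).card = 6) ∧
      (∀ G ∈ nadj V F, V \ F ⊆ G) ∧
      ∀ v ∈ V \ F, ∀ w ∈ V \ F, v ≠ w → deg V {v, w} = 5 := by
  have typ := fun {F : Finset E} (hF : F ∈ facets V) (hFc : F.card = 6) =>
    h.exists_galeType_nine hr (by omega) hf hs hF hFc
  obtain ⟨A, B, g, hA, hB, -, -, ht⟩ := typ hF hFc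
  have hO := card_sdiff_of_facet hF
  have h1 : ∀ R ∈ facets F, (opp V F R \ F).card ≤ 2 := by
    intro R hR
    have := card_sdiff_opp hF hR
    have := g.card_of_mem_facets hR
    have := hs _ (opp_mem hF hR)
    omega
  have hsub : ∀ G ∈ nadj V F, G \ F ⊆ V \ F := fun G hG =>
    Finset.sdiff_subset_sdiff (facets_subset (mem_nadj.1 hG).1) le_rfl
  have h2 : ∀ G ∈ nadj V F, (G \ F).card ≤ 3 := fun G hG =>
    (Finset.card_le_card (hsub G hG)).trans (by omega)
  have h3 : ∀ p ∈ (V \ F).offDiag, 5 ≤ deg V {p.1, p.2} := by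
    rintro ⟨v, w⟩ hp
    simp only [Finset.mem_offDiag, Finset.mem_sdiff] at hp
    obtain ⟨⟨hv, hvF⟩, ⟨hw, hwF⟩, hne⟩ := hp
    have h4 := h.le_deg hv hw
    have h5 := deg_le_of_outside hF (v := v) (w := w) hvF
    obtain ⟨R, hR⟩ := Finset.card_pos.1 (show 0 <
      ((facets F).filter fun R => v ∈ opp V F R ∧ w ∈ opp V F R).card by omega)
    obtain ⟨hR, hvR, hwR⟩ := Finset.mem_filter.1 hR
    have h6 := eq_pair_of_mem hvR hwR hvF hwF hne (h1 R hR)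
    have h7 := card_sdiff_opp hF hR
    rw [← h6, Finset.card_pair hne] at h7
    have h8 := g.card_of_mem_facets hR
    obtain ⟨A', B', g', hA', hB', -⟩ := typ (opp_mem hF hR) (by omega)
    exact g'.five_le_deg (opp_mem hF hR) hA' hB' (mem_adj.1 (adj_symm hF (opp_mem_adj hF hR))).2
      hvR hwR hvF hwF hne
  have h4 := sum_offDiag_outside hF
  have k5 : ∀ R ∈ facets F, (opp V F R \ F).card * (opp V F R \ F).card -
      (opp V F R \ F).card ≤ 2 := fun R hR => sub_self_sq_mono (h1 R hR)
  have k6 : ∀ G ∈ nadj V F, (G \ F).card * (G \ F).card - (G \ F).card ≤ 6 :=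
    fun G hG => sub_self_sq_mono (h2 G hG)
  have h5 := Finset.sum_le_sum k5
  have h6 := Finset.sum_le_sum k6
  have h7 := Finset.sum_le_sum h3
  have e1 : ∑ _p ∈ (V \ F).offDiag, 5 = 30 := by
    rw [Finset.sum_const, Finset.offDiag_card, show (V \ F).card = 3 by omega]
    rfl
  have e2 : ∑ _R ∈ facets F, 2 = 18 := by
    rw [Finset.sum_const, g.card_facets, hA, hB]
    rfl
  have e3 : ∑ _G ∈ nadj V F, 6 = (nadj V F).card * 6 := by
    rw [Finset.sum_const, smul_eq_mul]
  have ht2 : (nadj V F).card = 2 := by omega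
  rw [ht2] at e3
  refine ⟨ht2, ?_, ?_, ?_⟩
  · intro R hR
    have h8 := (Finset.sum_eq_sum_iff_of_le k5).1 (by omega) R hR
    have h9 := eq_two_of_sub_eq (h1 R hR) h8
    have := card_sdiff_opp hF hR
    have := g.card_of_mem_facets hR
    omega
  · intro G hG
    have h8 := (Finset.sum_eq_sum_iff_of_le k6).1 (by omega) G hG
    have h9 : 3 ≤ (G \ F).card := by
      by_contra hlt
      have := sub_self_sq_mono (show (G \ F).card ≤ 2 by omega)
      omega
    rw [← Finset.eq_of_subset_of_card_le (hsub G hG) (by omega)]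
    exact Finset.sdiff_subset
  · intro v hv w hw hne
    exact ((Finset.sum_eq_sum_iff_of_le h3).1 (show ∑ _p ∈ (V \ F).offDiag, 5 = _ by omega) (v, w)
      (Finset.mem_offDiag.2 ⟨hv, hw, hne⟩)).symm

theorem GaleType.false_of_nadj {V F A B G₁ G₂ : Finset E} (hF : F ∈ facets V)
    (g : GaleType F A B ∅) (hA : A.card = 3) (hB : B.card = 3) (hn : nadj V F = {G₁, G₂})
    (hdeg : ∀ G ∈ facets V, ∀ v ∈ V \ G, ∀ w ∈ V \ G, v ≠ w → deg V {v, w} = 5)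
    (hc : (F \ G₂).card = 3)
    {α α' β : E} (hα : α ∈ A) (hα' : α' ∈ A) (hαα : α ≠ α') (hβ : β ∈ B) (h1 : α ∉ G₁)
    (h2 : α' ∉ G₁) (h3 : β ∉ G₁) : False := by
  have hG₁ : G₁ ∈ facets V := (mem_nadj.1 (show G₁ ∈ nadj V F by simp [hn])).1
  have hG₂ : G₂ ∈ facets V := (mem_nadj.1 (show G₂ ∈ nadj V F by simp [hn])).1
  have hVF : ∀ {x}, x ∈ F → x ∈ V := fun hx => facets_subset hF hx
  have out : ∀ {G x}, x ∈ F → x ∉ G → x ∈ V \ G := fun hx hxG =>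
    Finset.mem_sdiff.2 ⟨hVF hx, hxG⟩
  have pair : ∀ {x y : E}, x ∈ F → y ∈ F → ({x, y} : Finset E) ⊆ F := by
    intro x y hx hy
    simp [Finset.insert_subset_iff, hx, hy]
  have d1 := hdeg G₁ hG₁ α (out (g.A_subset hα) h1) α' (out (g.A_subset hα') h2) hαα
  rw [deg_eq hF (pair (g.A_subset hα) (g.A_subset hα')), g.deg_same hα hα' hαα, hA, hB] at d1
  have d2 := hdeg G₁ hG₁ α (out (g.A_subset hα) h1) β (out (g.B_subset hβ) h3) (g.ne hα hβ)
  rw [deg_eq hF (pair (g.A_subset hα) (g.B_subset hβ)), g.deg_cross hα hβ, hA, hB] at d2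
  simp only [Finset.card_empty] at d1 d2
  obtain ⟨H, hH⟩ := Finset.card_pos.1 (show 0 <
    ((nadj V F).filter fun G => ({α, α'} : Finset E) ⊆ G).card by omega)
  simp only [hn, Finset.mem_filter, Finset.mem_insert, Finset.mem_singleton,
    Finset.insert_subset_iff, Finset.singleton_subset_iff] at hH
  obtain ⟨hH, hαH, hαH'⟩ := hH
  obtain rfl : H = G₂ := hH.resolve_left fun he => h1 (he ▸ hαH)
  have hβ2 : β ∉ H := by
    intro hβH
    have : 0 < ((nadj V F).filter fun G => ({α, β} : Finset E) ⊆ G).card :=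
      Finset.card_pos.2 ⟨H, by simp [hn, Finset.insert_subset_iff, hαH, hβH]⟩
    omega
  obtain ⟨β', hβ', hne, hβH'⟩ : ∃ β' ∈ B, β' ≠ β ∧ β' ∉ H := by
    by_contra! hcon
    have h4 : F \ H ⊆ insert β ((A.erase α).erase α') := by
      intro x hx
      rw [Finset.mem_sdiff, ← g.union_eq] at hx
      simp only [Finset.mem_union, Finset.notMem_empty, or_false] at hx
      rcases hx with ⟨hxA | hxB, hxH⟩
      · refine Finset.mem_insert_of_mem (Finset.mem_erase.2 ⟨?_, Finset.mem_erase.2 ⟨?_, hxA⟩⟩)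
        · exact fun he => hxH (he ▸ hαH')
        · exact fun he => hxH (he ▸ hαH)
      · refine Finset.mem_insert.2 (Or.inl ?_)
        by_contra hxβ
        exact hxH (hcon x hxB hxβ)
    have h5 := (Finset.card_le_card h4).trans (Finset.card_insert_le _ _)
    rw [Finset.card_erase_of_mem (Finset.mem_erase.2 ⟨hαα.symm, hα'⟩),
      Finset.card_erase_of_mem hα] at h5
    omega
  have d3 := hdeg H hG₂ β (out (g.B_subset hβ) hβ2) β' (out (g.B_subset hβ') hβH') hne.symm
  rw [deg_eq hF (pair (g.B_subset hβ) (g.B_subset hβ')), g.swap.deg_same hβ hβ' hne.symm, hA,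
    hB] at d3
  simp only [Finset.card_empty] at d3
  obtain ⟨K, hK⟩ := Finset.card_pos.1 (show 0 <
    ((nadj V F).filter fun G => ({β, β'} : Finset E) ⊆ G).card by omega)
  simp only [hn, Finset.mem_filter, Finset.mem_insert, Finset.mem_singleton,
    Finset.insert_subset_iff, Finset.singleton_subset_iff] at hK
  obtain ⟨rfl | rfl, hK, hK'⟩ := hK
  exacts [h3 hK, hβ2 hK]

theorem GaleType.exists_notMem {V F A B C G : Finset E} (hF : F ∈ facets V) (g : GaleType F A B C)
    (hC : C = ∅) (hG : G ∈ facets V) (hne : G ≠ F) : (∃ a ∈ A, a ∉ G) ∧ ∃ b ∈ B, b ∉ G := by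
  obtain ⟨x, hx, hxG⟩ := facets_antichain hF hG hne.symm
  have hf : IsFace F (G ∩ F) := (facets_isFace hG).restrict (facets_subset hF)
  obtain ⟨R, hR, hGR, -⟩ := hf.exists_facet_avoiding hx
    (fun h => hxG (Finset.mem_inter.1 h).1)
  rcases (g.mem_facets_iff R).1 hR with ⟨a, ha, b, hb, rfl⟩ | ⟨c, hc, -⟩
  · refine ⟨⟨a, ha, fun h => ?_⟩, b, hb, fun h => ?_⟩
    · have := hGR (Finset.mem_inter.2 ⟨h, g.A_subset ha⟩)
      simp at this
    · have := hGR (Finset.mem_inter.2 ⟨h, g.B_subset hb⟩)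
      simp at this
  · simp [hC] at hc

theorem Good.nine_false {V F : Finset E} (h : Good V) (hr : rk V = 6) (hn : V.card = 9)
    (hf : (facets V).card ≤ 12) (hs : ∀ G ∈ facets V, G.card ≤ 6) (hF : F ∈ facets V)
    (hFc : F.card = 6) : False := by
  obtain ⟨A, B, g, hA, hB, -⟩ := h.exists_galeType_nine hr (by omega) hf hs hF hFc
  have cnt := fun {F : Finset E} (hF : F ∈ facets V) (hFc : F.card = 6) =>
    h.nine_counting hr hn hf hs hF hFc
  obtain ⟨ht, -, hout, -⟩ := cnt hF hFc
  have hadj : ∀ {G H}, G ∈ facets V → H ∈ adj V G → G.card = 6 → H.card = 6 := by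
    intro G H hG hH hGc
    obtain ⟨hHV, hR⟩ := mem_adj.1 hH
    have := (cnt hG hGc).2.1 _ hR
    rwa [opp_inter_self hG hHV hR] at this
  have hall : ∀ G ∈ facets V, G.card = 6 := by
    intro G hG
    by_contra hGc
    have h1 : adj V G ⊆ nadj V F := by
      intro H hH
      have hHV := (mem_adj.1 hH).1
      have hHc : H.card ≠ 6 := fun hHc => hGc (hadj hHV (adj_symm hG hH) hHc)
      refine mem_nadj.2 ⟨hHV, fun he => hHc (he ▸ hFc), fun hR => ?_⟩
      exact hHc (hadj hF (mem_adj.2 ⟨hHV, hR⟩) hFc)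
    have h2 := Finset.card_le_card h1
    have h3 := card_adj hG
    have h4 := (h.mono (facets_subset hG)).1.rk_le_card_facets
    have := facets_rk hG
    omega
  have hdeg : ∀ G ∈ facets V, ∀ v ∈ V \ G, ∀ w ∈ V \ G, v ≠ w → deg V {v, w} = 5 :=
    fun G hG => (cnt hG (hall G hG)).2.2.2
  obtain ⟨G₁, G₂, hne, hG⟩ := Finset.card_eq_two.1 ht
  have hcard : ∀ G ∈ nadj V F, (F \ G).card = 3 := by
    intro G hG
    have h1 : F \ G = V \ G := by
      refine Finset.Subset.antisymm
        (Finset.sdiff_subset_sdiff (facets_subset hF) le_rfl) fun x hx => ?_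
      rw [Finset.mem_sdiff] at hx ⊢
      refine ⟨?_, hx.2⟩
      by_contra hxF
      exact hx.2 (hout G hG (Finset.mem_sdiff.2 ⟨hx.1, hxF⟩))
    have hGV := (mem_nadj.1 hG).1
    have := card_sdiff_of_facet hGV
    have := hall G hGV
    rw [h1]
    omega
  have hm1 : G₁ ∈ nadj V F := by simp [hG]
  have hm2 : G₂ ∈ nadj V F := by simp [hG]
  obtain ⟨⟨a, ha, haG⟩, b, hb, hbG⟩ := g.exists_notMem hF rfl (mem_nadj.1 hm1).1
    (mem_nadj.1 hm1).2.1
  by_cases hA2 : ∃ a' ∈ A, a ≠ a' ∧ a' ∉ G₁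
  · obtain ⟨a', ha', hne, haG'⟩ := hA2
    exact g.false_of_nadj hF hA hB hG hdeg (hcard _ hm2) ha ha' hne hb haG haG' hbG
  by_cases hB2 : ∃ b' ∈ B, b ≠ b' ∧ b' ∉ G₁
  · obtain ⟨b', hb', hne, hbG'⟩ := hB2
    exact g.swap.false_of_nadj hF hB hA hG hdeg (hcard _ hm2) hb hb' hne ha hbG hbG' haG
  push Not at hA2 hB2
  have h1 : F \ G₁ ⊆ {a, b} := by
    intro x hx
    rw [Finset.mem_sdiff, ← g.union_eq] at hx
    simp only [Finset.mem_union, Finset.notMem_empty, or_false] at hx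
    simp only [Finset.mem_insert, Finset.mem_singleton]
    rcases hx with ⟨hxA | hxB, hxG⟩
    · left
      by_contra hxa
      exact hxG (hA2 x hxA fun he => hxa he.symm)
    · right
      by_contra hxb
      exact hxG (hB2 x hxB fun he => hxb he.symm)
  have h2 := (Finset.card_le_card h1).trans Finset.card_le_two
  have := hcard _ hm1
  omega

theorem Good.card_facets_of_card_le {V F : Finset E} {d : ℕ} (h : Good V)
    (hr : rk V = d + 1) (hn : d + 4 ≤ V.card) (hs : ∀ G ∈ facets V, G.card ≤ d + 1)
    (hF : F ∈ facets V) (hFc : F.card = d + 1) : d + 8 ≤ (facets V).card := by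
  by_contra hf
  obtain ⟨A, B, g, -, -, rfl, hn, -⟩ := h.exists_galeType_nine hr hn (by omega) hs hF hFc
  exact h.nine_false hr hn (by omega) hs hF hFc

end FaceCone

namespace FaceCone

section Family

variable {α : Type*} [DecidableEq α]

/-- The members of `K` with exactly two elements outside `O`. -/
def related (K : Finset (Finset α)) (O : Finset α) : Finset (Finset α) :=
  K.filter fun C => (C \ O).card = 2

/-- The properties of the complements of the facets of a 2-neighborly 6-polytope with 13 facets
and `m + 8` vertices that has a facet with 8 vertices and no larger facets. -/
structure ComplementFamily (V : Finset α) (K : Finset (Finset α)) (m : ℕ) : Prop where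
  card_ground : V.card = m + 8
  card_eq : K.card = 13
  subset : ∀ C ∈ K, C ⊆ V
  le_card : ∀ C ∈ K, m ≤ C.card
  card_or : ∀ O ∈ K, O.card = m → ∀ C ∈ K, C ≠ O → (C \ O).card = 2 ∨ (C \ O).card = 3
  card_related : ∀ O ∈ K, O.card = m → (related K O).card = 4
  disjoint : ∀ O ∈ K, O.card = m → ∀ C ∈ related K O, ∀ D ∈ related K O, C ≠ D →
    Disjoint (C \ O) (D \ O)
  card_mem : ∀ O ∈ K, O.card = m → ∀ x ∈ V, x ∉ O → (K.filter fun C => x ∈ C).card = 4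
  antichain : ∀ O ∈ K, O.card = m → ∀ C ∈ K, ∀ D ∈ K, C ≠ O → D ≠ O → C \ O ⊆ D \ O → C = D
  card_single : ∀ O ∈ K, O.card = m →
    ((related K O).filter fun C => (O \ C).card ≤ 1).card ≤ 1

variable {V : Finset α} {K : Finset (Finset α)} {m : ℕ}

theorem mem_related {C O : Finset α} : C ∈ related K O ↔ C ∈ K ∧ (C \ O).card = 2 := by
  simp [related]

theorem card_sdiff_comm' {C O : Finset α} : (C \ O).card + O.card = (O \ C).card + C.card := by
  rw [Finset.card_sdiff_add_card, Finset.card_sdiff_add_card, Finset.union_comm]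

namespace ComplementFamily

theorem mem_related_of_subset (h : ComplementFamily V K m) {B O C : Finset α} (hO : O ∈ K)
    (hOm : O.card = m) (hC : C ∈ K) (hCm : C.card = m) (hne : C ≠ O) (hB : B.card + 2 = m)
    (hBO : B ⊆ O) (hBC : B ⊆ C) : C ∈ related K O ∧ C ∩ O = B := by
  have h1 := h.card_or O hO hOm C hC hne
  have h2 := Finset.card_inter_add_card_sdiff C O
  have h3 := Finset.card_le_card (Finset.subset_inter hBC hBO)
  exact ⟨mem_related.2 ⟨hC, by omega⟩,
    (Finset.eq_of_subset_of_card_le (Finset.subset_inter hBC hBO) (by omega)).symm⟩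

section Star

variable {B : Finset α}

/-- The smallest members of the family containing `B`. -/
def star (K : Finset (Finset α)) (m : ℕ) (B : Finset α) : Finset (Finset α) :=
  K.filter fun C => C.card = m ∧ B ⊆ C

theorem mem_star {C : Finset α} : C ∈ star K m B ↔ C ∈ K ∧ C.card = m ∧ B ⊆ C := by
  simp [star]

theorem star_erase_subset (h : ComplementFamily V K m) (hB : B.card + 2 = m) {O : Finset α}
    (hO : O ∈ star K m B) : (star K m B).erase O ⊆ related K O := by
  intro C hC
  obtain ⟨hne, hC⟩ := Finset.mem_erase.1 hC
  rw [mem_star] at hO hC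
  exact (h.mem_related_of_subset hO.1 hO.2.1 hC.1 hC.2.1 hne hB hO.2.2 hC.2.2).1

theorem star_pairwiseDisjoint (h : ComplementFamily V K m) (hB : B.card + 2 = m) :
    ((star K m B : Finset (Finset α)) : Set (Finset α)).PairwiseDisjoint fun C => C \ B := by
  intro C hC O hO hne
  rw [Finset.mem_coe, mem_star] at hC hO
  have h1 := (h.mem_related_of_subset hO.1 hO.2.1 hC.1 hC.2.1 hne hB hO.2.2 hC.2.2).2
  rw [Function.onFun, Finset.disjoint_left]
  intro x hx hx'
  rw [Finset.mem_sdiff] at hx hx'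
  exact hx.2 (h1 ▸ Finset.mem_inter.2 ⟨hx.1, hx'.1⟩)

theorem card_biUnion_star (h : ComplementFamily V K m) (hB : B.card + 2 = m) :
    ((star K m B).biUnion fun C => C \ B).card = (star K m B).card * 2 := by
  rw [Finset.card_biUnion (h.star_pairwiseDisjoint hB)]
  refine Finset.sum_const_nat fun C hC => ?_
  rw [mem_star] at hC
  have := Finset.card_sdiff_add_card_eq_card hC.2.2
  omega

theorem biUnion_star_subset (h : ComplementFamily V K m) :
    ((star K m B).biUnion fun C => C \ B) ⊆ V \ B := by
  refine Finset.biUnion_subset.2 fun C hC => ?_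
  exact Finset.sdiff_subset_sdiff (h.subset C (mem_star.1 hC).1) le_rfl

theorem card_star_ne_five (h : ComplementFamily V K m) (hB : B.card + 2 = m) (hBV : B ⊆ V)
    (h5 : (star K m B).card = 5) : False := by
  have hU : ((star K m B).biUnion fun C => C \ B) = V \ B := by
    refine Finset.eq_of_subset_of_card_le h.biUnion_star_subset ?_
    have h1 := Finset.card_sdiff_add_card_eq_card hBV
    have h2 := h.card_ground
    rw [h.card_biUnion_star hB, h5]
    omega
  obtain ⟨C, hC, hCs⟩ := Finset.exists_mem_notMem_of_card_lt_card
    (show (star K m B).card < K.card by rw [h5, h.card_eq]; norm_num)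
  have h3 : ∀ O ∈ star K m B, (C ∩ (O \ B)).card + (C ∩ B).card + 3 = C.card := by
    intro O hO
    have hO' := mem_star.1 hO
    have h4 := h.card_related O hO'.1 hO'.2.1
    have h6 := Finset.eq_of_subset_of_card_le (h.star_erase_subset hB hO)
      (by rw [Finset.card_erase_of_mem hO]; omega)
    have h7 : C ∉ related K O := by
      rw [← h6]
      exact fun hm => hCs (Finset.mem_of_mem_erase hm)
    have h8 := (h.card_or O hO'.1 hO'.2.1 C hC fun he => hCs (he ▸ hO)).resolve_left
      fun h9 => h7 (mem_related.2 ⟨hC, h9⟩)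
    have h9 := Finset.card_inter_add_card_sdiff C O
    have h10 := Finset.card_inter_add_card_sdiff (C ∩ O) B
    rw [Finset.inter_assoc, Finset.inter_eq_right.2 hO'.2.2, Finset.inter_sdiff_assoc] at h10
    omega
  have h4 : (C ∩ (V \ B)).card = ∑ O ∈ star K m B, (C ∩ (O \ B)).card := by
    rw [← hU, Finset.inter_biUnion, Finset.card_biUnion]
    intro O hO O' hO' hne
    exact (h.star_pairwiseDisjoint hB hO hO' hne).mono Finset.inter_subset_right
      Finset.inter_subset_right
  have h6 : C ∩ (V \ B) = C \ B := by
    rw [← Finset.inter_sdiff_assoc, Finset.inter_eq_left.2 (h.subset C hC)]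
  have h7 := Finset.card_inter_add_card_sdiff C B
  have h8 : ∑ O ∈ star K m B, ((C ∩ (O \ B)).card + (C ∩ B).card + 3) =
      ∑ _O ∈ star K m B, C.card := Finset.sum_congr rfl h3
  simp only [Finset.sum_add_distrib, Finset.sum_const, h5, smul_eq_mul] at h8
  rw [h6] at h4
  omega

theorem card_star_ne_four (h : ComplementFamily V K m) (hB : B.card + 2 = m) (hBV : B ⊆ V)
    (h4 : (star K m B).card = 4) : False := by
  set Z := (V \ B) \ ((star K m B).biUnion fun C => C \ B) with hZ
  have hZc : Z.card = 2 := by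
    have h1 := Finset.card_sdiff_add_card_eq_card hBV
    have h2 := h.card_ground
    have h3 := Finset.card_sdiff_add_card_eq_card (h.biUnion_star_subset (B := B))
    rw [← hZ, h.card_biUnion_star hB, h4] at h3
    omega
  have hZO : ∀ O ∈ star K m B, ∀ x ∈ Z, x ∉ O := by
    intro O hO x hx hxO
    rw [hZ, Finset.mem_sdiff, Finset.mem_sdiff] at hx
    exact hx.2 (Finset.mem_biUnion.2 ⟨O, hO, Finset.mem_sdiff.2 ⟨hxO, hx.1.2⟩⟩)
  have key : ∀ O ∈ star K m B, ∃ D ∈ K, D ∉ star K m B ∧ D \ O = Z := by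
    intro O hO
    have hO' := mem_star.1 hO
    have h5 := h.card_related O hO'.1 hO'.2.1
    obtain ⟨D, hD, hDs⟩ := Finset.exists_mem_notMem_of_card_lt_card
      (show ((star K m B).erase O).card < (related K O).card by
        rw [Finset.card_erase_of_mem hO]; omega)
    have hDO : D ≠ O := by
      rintro rfl
      simp [mem_related] at hD
    have hDs' : D ∉ star K m B := fun hm => hDs (Finset.mem_erase.2 ⟨hDO, hm⟩)
    have hD' := mem_related.1 hD
    refine ⟨D, hD'.1, hDs', Finset.eq_of_subset_of_card_le ?_ (by omega)⟩
    intro x hx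
    have hx' := Finset.mem_sdiff.1 hx
    rw [hZ, Finset.mem_sdiff, Finset.mem_sdiff]
    refine ⟨⟨h.subset D hD'.1 hx'.1, fun hxB => hx'.2 (hO'.2.2 hxB)⟩, fun hm => ?_⟩
    obtain ⟨C, hC, hxC⟩ := Finset.mem_biUnion.1 hm
    have hCO : C ≠ O := fun he => hx'.2 (he ▸ (Finset.mem_sdiff.1 hxC).1)
    exact Finset.disjoint_left.1 (h.disjoint O hO'.1 hO'.2.1 D hD C
      (h.star_erase_subset hB hO (Finset.mem_erase.2 ⟨hCO, hC⟩)) fun he => hDs' (he ▸ hC)) hx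
      (Finset.mem_sdiff.2 ⟨(Finset.mem_sdiff.1 hxC).1, hx'.2⟩)
  obtain ⟨O, hO, O', hO', hne⟩ := Finset.one_lt_card.1 (show 1 < (star K m B).card by omega)
  obtain ⟨D, hD, hDs, hDZ⟩ := key O hO
  obtain ⟨D', hD', hDs', hDZ'⟩ := key O' hO'
  have hOm := mem_star.1 hO
  have hOm' := mem_star.1 hO'
  obtain rfl : D = D' := by
    refine h.antichain O hOm.1 hOm.2.1 D hD D' hD' (fun he => hDs (he ▸ hO))
      (fun he => hDs' (he ▸ hO)) ?_
    rw [hDZ]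
    intro x hx
    refine Finset.mem_sdiff.2 ⟨?_, hZO O hO x hx⟩
    rw [← hDZ'] at hx
    exact (Finset.mem_sdiff.1 hx).1
  have hOO := (h.mem_related_of_subset hOm.1 hOm.2.1 hOm'.1 hOm'.2.1 hne.symm hB hOm.2.2
    hOm'.2.2).2
  have hsub : D ⊆ Z ∪ B := by
    intro x hx
    by_contra hn
    rw [Finset.mem_union, not_or] at hn
    have hxO : x ∈ O := by
      by_contra hxO
      exact hn.1 (hDZ ▸ Finset.mem_sdiff.2 ⟨hx, hxO⟩)
    have hxO' : x ∈ O' := by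
      by_contra hxO'
      exact hn.1 (hDZ' ▸ Finset.mem_sdiff.2 ⟨hx, hxO'⟩)
    exact hn.2 (hOO ▸ Finset.mem_inter.2 ⟨hxO', hxO⟩)
  have h5 := Finset.card_union_le Z B
  have h6 := h.le_card D hD
  have h7 := Finset.eq_of_subset_of_card_le hsub (by omega)
  have h8 := Finset.card_le_card hsub
  exact hDs (mem_star.2 ⟨hD, by omega, h7 ▸ Finset.subset_union_right⟩)

theorem card_star_le_three (h : ComplementFamily V K m) (hB : B.card + 2 = m) (hBV : B ⊆ V) :
    (star K m B).card ≤ 3 := by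
  by_contra hlt
  obtain ⟨O, hO⟩ := Finset.card_pos.1 (show 0 < (star K m B).card by omega)
  have h1 := Finset.card_le_card (h.star_erase_subset hB hO)
  rw [Finset.card_erase_of_mem hO,
    h.card_related O (mem_star.1 hO).1 (mem_star.1 hO).2.1] at h1
  by_cases h5 : (star K m B).card = 5
  · exact h.card_star_ne_five hB hBV h5
  · exact h.card_star_ne_four hB hBV (by omega)

end Star

theorem three_le_card_related (h : ComplementFamily V K m) {O : Finset α} (hO : O ∈ K)
    (hOm : O.card = m) : 3 ≤ ((related K O).filter fun C => C.card = m).card := by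
  have h1 := Finset.card_filter_add_card_filter_not (s := related K O) (fun C => C.card = m)
  have h2 : ((related K O).filter fun C => ¬ C.card = m) ⊆
      (related K O).filter fun C => (O \ C).card ≤ 1 := by
    intro C hC
    rw [Finset.mem_filter] at hC ⊢
    refine ⟨hC.1, ?_⟩
    have h3 := card_sdiff_comm' (C := C) (O := O)
    have h4 := mem_related.1 hC.1
    have h5 := h.le_card C h4.1
    omega
  have h3 := Finset.card_le_card h2
  have h4 := h.card_single O hO hOm
  have h5 := h.card_related O hO hOm
  omega

theorem false_of_two (h : ComplementFamily V K 2) {O : Finset α} (hO : O ∈ K)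
    (hOm : O.card = 2) : False := by
  have h1 := h.card_star_le_three (B := ∅) (by simp) (by simp)
  have h2 := h.three_le_card_related hO hOm
  have h3 : insert O ((related K O).filter fun C => C.card = 2) ⊆ star K 2 ∅ := by
    intro C hC
    rw [mem_star]
    rcases Finset.mem_insert.1 hC with rfl | hC
    · exact ⟨hO, hOm, by simp⟩
    · obtain ⟨hC, hCm⟩ := Finset.mem_filter.1 hC
      exact ⟨(mem_related.1 hC).1, hCm, by simp⟩
  have h4 := Finset.card_le_card h3
  rw [Finset.card_insert_of_notMem (by simp [mem_related])] at h4
  omega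

/-- The members of the family with three elements. -/
def triples (K : Finset (Finset α)) : Finset (Finset α) := K.filter fun C => C.card = 3

theorem mem_triples {C : Finset α} : C ∈ triples K ↔ C ∈ K ∧ C.card = 3 := by
  simp [triples]

/-- The number of triples containing `x`. -/
def tripleDeg (K : Finset (Finset α)) (x : α) : ℕ := ((triples K).filter fun C => x ∈ C).card

theorem tripleDeg_le (h : ComplementFamily V K 3) {x : α} (hx : x ∈ V) : tripleDeg K x ≤ 3 := by
  have h1 := h.card_star_le_three (B := {x}) (by simp) (by simpa using hx)
  refine le_trans (Finset.card_le_card fun C hC => ?_) h1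
  rw [Finset.mem_filter, mem_triples] at hC
  simpa [mem_star, and_assoc] using hC

theorem card_inter_le (h : ComplementFamily V K 3) {O C : Finset α} (hO : O ∈ triples K)
    (hC : C ∈ triples K) (hne : C ≠ O) :
    (C ∩ O).card = if C ∈ related K O then 1 else 0 := by
  rw [mem_triples] at hO hC
  have h1 := h.card_or O hO.1 hO.2 C hC.1 hne
  have h2 := Finset.card_inter_add_card_sdiff C O
  simp only [mem_related, hC.1, true_and]
  split_ifs <;> omega

theorem sum_tripleDeg_eq_sum_inter (O : Finset α) :
    ∑ x ∈ O, tripleDeg K x = ∑ C ∈ triples K, (C ∩ O).card := by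
  unfold tripleDeg
  simp only [Finset.card_filter]
  rw [Finset.sum_comm]
  refine Finset.sum_congr rfl fun C _ => ?_
  rw [← Finset.card_filter, Finset.filter_mem_eq_inter, Finset.inter_comm]

theorem sum_tripleDeg (h : ComplementFamily V K 3) {O : Finset α} (hO : O ∈ triples K) :
    6 ≤ ∑ x ∈ O, tripleDeg K x ∧ ∑ x ∈ O, tripleDeg K x ≤ 7 := by
  have hO' := mem_triples.1 hO
  rw [sum_tripleDeg_eq_sum_inter, ← Finset.add_sum_erase _ _ hO, Finset.inter_self, hO'.2,
    Finset.sum_congr rfl fun C hC =>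
      h.card_inter_le hO (Finset.mem_of_mem_erase hC) (Finset.ne_of_mem_erase hC),
    ← Finset.card_filter]
  have h1 : (((triples K).erase O).filter fun C => C ∈ related K O) =
      (related K O).filter fun C => C.card = 3 := by
    ext C
    simp only [Finset.mem_filter, Finset.mem_erase, mem_triples, mem_related]
    constructor
    · tauto
    · rintro ⟨⟨hC, h2⟩, h3⟩
      refine ⟨⟨?_, hC, h3⟩, hC, h2⟩
      rintro rfl
      simp at h2
  rw [h1]
  have h2 := h.three_le_card_related hO'.1 hO'.2
  have h3 := Finset.card_filter_le (related K O) fun C => C.card = 3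
  rw [h.card_related O hO'.1 hO'.2] at h3
  omega

theorem four_le_card_triples (h : ComplementFamily V K 3) {O : Finset α} (hO : O ∈ triples K) :
    4 ≤ (triples K).card := by
  have hO' := mem_triples.1 hO
  have h2 := h.three_le_card_related hO'.1 hO'.2
  have h3 : insert O ((related K O).filter fun C => C.card = 3) ⊆ triples K := by
    intro C hC
    rcases Finset.mem_insert.1 hC with rfl | hC
    · exact hO
    · obtain ⟨hC, hCm⟩ := Finset.mem_filter.1 hC
      exact mem_triples.2 ⟨(mem_related.1 hC).1, hCm⟩
  have h4 := Finset.card_le_card h3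
  rw [Finset.card_insert_of_notMem (by simp [mem_related])] at h4
  omega

theorem eight_le_card_triples (h : ComplementFamily V K 3) {O : Finset α} (hO : O ∈ triples K) :
    8 ≤ (triples K).card := by
  have h4 := h.four_le_card_triples hO
  have h1 : ∀ x ∈ V, (K.filter fun C => x ∈ C).card = 4 := by
    intro x hx
    obtain ⟨D, hD, hxD⟩ : ∃ D ∈ triples K, x ∉ D := by
      by_contra! hcon
      have h2 := h.tripleDeg_le hx
      rw [tripleDeg, Finset.filter_true_of_mem hcon] at h2
      omega
    exact h.card_mem D (mem_triples.1 hD).1 (mem_triples.1 hD).2 x hx hxD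
  have h2 : ∑ C ∈ K, C.card = 44 := by
    calc ∑ C ∈ K, C.card = ∑ C ∈ K, (V ∩ C).card :=
          Finset.sum_congr rfl fun C hC => by rw [Finset.inter_eq_right.2 (h.subset C hC)]
      _ = ∑ x ∈ V, (K.filter fun C => x ∈ C).card := by
          simp only [Finset.card_filter]
          rw [Finset.sum_comm]
          refine Finset.sum_congr rfl fun C _ => ?_
          rw [← Finset.card_filter, Finset.filter_mem_eq_inter]
      _ = 44 := by
          rw [Finset.sum_congr rfl h1, Finset.sum_const, h.card_ground]
          rfl
  have h3 : ∑ C ∈ K, (4 - if C.card = 3 then 1 else 0) ≤ ∑ C ∈ K, C.card := by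
    refine Finset.sum_le_sum fun C hC => ?_
    have := h.le_card C hC
    split_ifs <;> omega
  have h5 : ∑ C ∈ K, (4 - if C.card = 3 then 1 else 0) + (triples K).card = 52 := by
    rw [triples, Finset.card_filter, ← Finset.sum_add_distrib,
      Finset.sum_congr rfl (g := fun _ => 4), Finset.sum_const, h.card_eq]
    · rfl
    · intro C _
      split_ifs <;> rfl
  omega

theorem sum_tripleDeg_ground (h : ComplementFamily V K 3) :
    ∑ x ∈ V, tripleDeg K x = 3 * (triples K).card := by
  rw [sum_tripleDeg_eq_sum_inter, mul_comm]
  refine Finset.sum_const_nat fun C hC => ?_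
  rw [mem_triples] at hC
  rw [Finset.inter_eq_left.2 (h.subset C hC.1), hC.2]

theorem sum_tripleDeg_sq (h : ComplementFamily V K 3) :
    ∑ x ∈ V, tripleDeg K x * tripleDeg K x = ∑ O ∈ triples K, ∑ x ∈ O, tripleDeg K x := by
  have h1 : ∀ O ∈ triples K, ∑ x ∈ O, tripleDeg K x =
      ∑ x ∈ V, if x ∈ O then tripleDeg K x else 0 := by
    intro O hO
    rw [← Finset.sum_filter, Finset.filter_mem_eq_inter,
      Finset.inter_eq_right.2 (h.subset O (mem_triples.1 hO).1)]
  rw [Finset.sum_congr rfl h1, Finset.sum_comm]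
  refine Finset.sum_congr rfl fun x _ => ?_
  rw [← Finset.sum_filter, Finset.sum_const, smul_eq_mul, tripleDeg]

theorem five_mul_le (h : ComplementFamily V K 3) {x : α} (hx : x ∈ V) :
    5 * tripleDeg K x ≤ tripleDeg K x * tripleDeg K x + 6 := by
  have := h.tripleDeg_le hx
  interval_cases tripleDeg K x <;> norm_num

theorem card_triples_eq (h : ComplementFamily V K 3) {O : Finset α} (hO : O ∈ triples K) :
    (triples K).card = 8 := by
  have h1 := h.eight_le_card_triples hO
  have h2 := Finset.sum_le_sum fun x hx => h.five_mul_le (x := x) hx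
  rw [← Finset.mul_sum, h.sum_tripleDeg_ground, Finset.sum_add_distrib, h.sum_tripleDeg_sq,
    Finset.sum_const, h.card_ground, smul_eq_mul] at h2
  have h3 := Finset.sum_le_card_nsmul _ _ 7 fun O hO => (h.sum_tripleDeg (O := O) hO).2
  rw [smul_eq_mul] at h3
  omega

/-- The triples through a point of degree three have small total degree. -/
theorem sum_star_le (h : ComplementFamily V K 3) (h8 : (triples K).card = 8) {p : α}
    (hp : tripleDeg K p = 3) :
    ∑ C ∈ (triples K).filter (fun C => p ∈ C), ∑ x ∈ C, tripleDeg K x ≤ 20 := by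
  simp only [sum_tripleDeg_eq_sum_inter]
  rw [Finset.sum_comm]
  have h1 : ∀ O ∈ triples K, ∑ C ∈ (triples K).filter (fun C => p ∈ C), (O ∩ C).card ≤
      if p ∈ O then 5 else 1 := by
    intro O hO
    have hO' := mem_triples.1 hO
    split_ifs with hpO
    · have hm : O ∈ (triples K).filter fun C => p ∈ C := Finset.mem_filter.2 ⟨hO, hpO⟩
      rw [← Finset.add_sum_erase _ _ hm, Finset.inter_self, hO'.2]
      have h2 := Finset.sum_le_card_nsmul (((triples K).filter fun C => p ∈ C).erase O)
        (fun C => (O ∩ C).card) 1 fun C hC => by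
          obtain ⟨hne, hC⟩ := Finset.mem_erase.1 hC
          have := h.card_inter_le hO (Finset.mem_filter.1 hC).1 hne
          rw [Finset.inter_comm, this]
          split_ifs <;> norm_num
      rw [Finset.card_erase_of_mem hm, ← tripleDeg, hp] at h2
      simpa using Nat.add_le_add_left h2 3
    · have h2 : ∀ C ∈ (triples K).filter (fun C => p ∈ C), (O ∩ C).card =
          if C ∈ related K O then 1 else 0 := by
        intro C hC
        obtain ⟨hC, hpC⟩ := Finset.mem_filter.1 hC
        rw [Finset.inter_comm]
        exact h.card_inter_le hO hC fun he => hpO (he ▸ hpC)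
      rw [Finset.sum_congr rfl h2, ← Finset.card_filter, Finset.card_le_one]
      intro C hC D hD
      by_contra hne
      simp only [Finset.mem_filter] at hC hD
      exact Finset.disjoint_left.1 (h.disjoint O hO'.1 hO'.2 C hC.2 D hD.2 hne)
        (Finset.mem_sdiff.2 ⟨hC.1.2, hpO⟩) (Finset.mem_sdiff.2 ⟨hD.1.2, hpO⟩)
  refine (Finset.sum_le_sum h1).trans ?_
  have h2 := Finset.card_filter_add_card_filter_not (s := triples K) (fun C => p ∈ C)
  rw [← tripleDeg, hp, h8] at h2
  rw [Finset.sum_ite, Finset.sum_const, Finset.sum_const, ← tripleDeg, hp, smul_eq_mul,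
    smul_eq_mul]
  omega

theorem false_of_three (h : ComplementFamily V K 3) {O : Finset α} (hO : O ∈ K)
    (hOm : O.card = 3) : False := by
  have h8 := h.card_triples_eq (mem_triples.2 ⟨hO, hOm⟩)
  have h1 := h.sum_tripleDeg_ground
  rw [h8] at h1
  obtain ⟨p, hpV, hp⟩ : ∃ p ∈ V, tripleDeg K p = 3 := by
    by_contra! hcon
    have h2 := Finset.sum_le_card_nsmul V (fun x => tripleDeg K x) 2 fun x hx => by
      have := h.tripleDeg_le hx
      have := hcon x hx
      omega
    rw [h.card_ground, smul_eq_mul] at h2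
    omega
  obtain ⟨C, hC, hpC, hCs⟩ : ∃ C ∈ triples K, p ∈ C ∧ ∑ x ∈ C, tripleDeg K x = 6 := by
    by_contra! hcon
    have h2 := Finset.card_nsmul_le_sum ((triples K).filter fun C => p ∈ C)
      (fun C => ∑ x ∈ C, tripleDeg K x) 7 fun C hC => by
        obtain ⟨hC, hpC⟩ := Finset.mem_filter.1 hC
        have := h.sum_tripleDeg hC
        have := hcon C hC hpC
        omega
    have h3 := h.sum_star_le h8 hp
    rw [← tripleDeg, hp, smul_eq_mul] at h2
    omega
  have hCK := mem_triples.1 hC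
  obtain ⟨a, ha, ha1⟩ : ∃ a ∈ C, tripleDeg K a = 1 := by
    by_contra! hcon
    have h2 := Finset.card_nsmul_le_sum (C.erase p) (fun x => tripleDeg K x) 2 fun x hx => by
      have hxC := Finset.mem_of_mem_erase hx
      have h3 : 0 < tripleDeg K x := Finset.card_pos.2 ⟨C, Finset.mem_filter.2 ⟨hC, hxC⟩⟩
      have := hcon x hxC
      omega
    rw [Finset.card_erase_of_mem hpC, hCK.2, smul_eq_mul] at h2
    have h3 := Finset.add_sum_erase C (fun x => tripleDeg K x) hpC
    omega
  have haV := h.subset C hCK.1 ha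
  have h2 := Finset.sum_le_sum fun x (hx : x ∈ V.erase a) =>
    h.five_mul_le (Finset.mem_of_mem_erase hx)
  rw [← Finset.mul_sum, Finset.sum_add_distrib, Finset.sum_const, Finset.card_erase_of_mem haV,
    h.card_ground, smul_eq_mul] at h2
  have h3 := Finset.add_sum_erase V (fun x => tripleDeg K x) haV
  have h4 := Finset.add_sum_erase V (fun x => tripleDeg K x * tripleDeg K x) haV
  rw [h.sum_tripleDeg_sq] at h4
  have h5 := Finset.add_sum_erase (triples K) (fun O => ∑ x ∈ O, tripleDeg K x) hC
  have h6 := Finset.sum_le_card_nsmul ((triples K).erase C) (fun O => ∑ x ∈ O, tripleDeg K x) 7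
    fun O hO => (h.sum_tripleDeg (Finset.mem_of_mem_erase hO)).2
  rw [Finset.card_erase_of_mem hC, h8, smul_eq_mul] at h6
  simp only [ha1] at h3 h4
  omega

end ComplementFamily

end Family

end FaceCone

namespace FaceCone

variable {E : Type*} [AddCommGroup E] [Module ℝ E] [DecidableEq E]

section NoNadj

variable {V F : Finset E}

theorem inter_mem_facets_of_nadj_eq_empty (hn : nadj V F = ∅) {G : Finset E}
    (hG : G ∈ facets V) (hne : G ≠ F) : G ∩ F ∈ facets F := by
  by_contra hc
  have : G ∈ nadj V F := mem_nadj.2 ⟨hG, hne, hc⟩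
  simp [hn] at this

theorem exists_common_of_nadj_eq_empty (hF : F ∈ facets V) (hn : nadj V F = ∅) {R₁ R₂ : Finset E}
    (h1 : R₁ ∈ facets F) (h2 : R₂ ∈ facets F) (hne : R₁ ≠ R₂) (hr : rk (R₁ ∩ R₂) + 2 = rk F) :
    ∃ x, x ∈ opp V F R₁ ∧ x ∈ opp V F R₂ ∧ x ∉ F := by
  by_contra! hc
  obtain ⟨H, hH, -⟩ := exists_nadj_of_conflict hF h1 h2 hne hr fun x hx =>
    hc x (Finset.mem_inter.1 hx).1 (Finset.mem_inter.1 hx).2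
  simp [hn] at hH

theorem rk_inter_of_adj {R₁ R₂ : Finset E} (h1 : R₁ ∈ facets F) (h2 : R₂ ∈ facets F)
    (hne : R₂ ≠ R₁) (hn : R₂ ∉ nadj F R₁) : rk (R₁ ∩ R₂) + 2 = rk F := by
  have h3 : R₂ ∩ R₁ ∈ facets R₁ := by
    by_contra hc
    exact hn (mem_nadj.2 ⟨h2, hne, hc⟩)
  have h4 := facets_rk h3
  have h5 := facets_rk h1
  rw [Finset.inter_comm] at h4
  omega

theorem Good.extremal_of_card_facet {d : ℕ} (h : Good V) (hd : 4 ≤ d) (hr : rk V = d + 2)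
    (hn : d + 5 ≤ V.card) (hs : ∀ G ∈ facets V, G.card ≤ d + 3) (hf : (facets V).card ≤ d + 8)
    (hF : F ∈ facets V) (hFc : F.card = d + 3) :
    d = 5 ∧ Extremal F ∧ nadj V F = ∅ ∧ (facets V).card = 13 := by
  have hFV := facets_subset hF
  have hgF := h.mono hFV
  have hrF := facets_rk hF
  have h1 := card_facets_eq hF
  have h2 := hgF.card_facets_of_card_eq_add_two hd (by omega) hFc
  have hnadj : nadj V F = ∅ := Finset.card_eq_zero.1 (by omega)
  have hR : ∀ R ∈ facets F, R.card ≤ d + 1 := by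
    intro R hR
    by_contra hlt
    have h3 := card_facet_le hR
    have h4 := card_sdiff_opp hF hR
    have h5 := hs _ (opp_mem hF hR)
    have h6 := one_le_card_sdiff_opp hF hR
    obtain ⟨y, hy⟩ := Finset.card_eq_one.1 (show (opp V F R \ F).card = 1 by omega)
    have hyV : y ∈ opp V F R ∧ y ∉ F := by
      rw [← Finset.mem_sdiff, hy, Finset.mem_singleton]
    have h7 : ∀ H ∈ facets V, H ≠ F → y ∈ H := by
      intro H hH hne
      have h8 := inter_mem_facets_of_nadj_eq_empty hnadj hH hne
      rw [← opp_inter_self hF hH h8]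
      by_cases he : H ∩ F = R
      · rw [he]
        exact hyV.1
      · have h9 : ((H ∩ F) \ R).card ≤ 1 := by
          refine (Finset.card_le_card (Finset.sdiff_subset_sdiff Finset.inter_subset_right
            le_rfl)).trans ?_
          have := card_sdiff_of_facet hR
          omega
        obtain ⟨x, hx1, hx2, hxF⟩ := exists_common_of_nadj_eq_empty hF hnadj h8 hR he
          (rk_inter_of_sdiff h8 hR he h9)
        have hxy : x ∈ opp V F R \ F := Finset.mem_sdiff.2 ⟨hx2, hxF⟩
        rw [hy, Finset.mem_singleton] at hxy
        exact hxy ▸ hx1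
    have h10 := card_sdiff_of_facet hF
    obtain ⟨z, hz, hzy⟩ := Finset.exists_mem_ne (show 1 < (V \ F).card by omega) y
    obtain ⟨hzV, hzF⟩ := Finset.mem_sdiff.1 hz
    obtain ⟨H, hH, hzH, -, hyH⟩ := h.exists_facet_avoiding hzV hzV
      (facets_subset (opp_mem hF hR) hyV.1) hzy.symm hzy.symm
    exact hyH (h7 H hH fun he => hzF (he ▸ hzH))
  obtain ⟨h3, h4⟩ := hgF.extremal hd (by omega) hFc (by omega) hR
  have h5 := h4.card_facets
  rw [hnadj, Finset.card_empty] at h1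
  exact ⟨h3, h4, hnadj, by omega⟩

theorem Extremal.exists_notMem (h : Extremal F) {x : E} (hx : x ∈ F) :
    ∃ R ∈ facets F, R.card = 6 ∧ x ∉ R := by
  set S := (facets F).filter fun G => G.card = 6 with hS
  have h1 : S.biUnion (fun R => F \ R) = F := by
    refine Finset.eq_of_subset_of_card_le
      (Finset.biUnion_subset.2 fun R _ => Finset.sdiff_subset) ?_
    rw [Finset.card_biUnion, Finset.sum_const_nat (m := 2), h.card_six, h.card_eq]
    · intro R hR
      rw [hS, Finset.mem_filter] at hR
      have := card_sdiff_of_facet hR.1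
      have := h.card_eq
      omega
    · intro R hR R' hR' hne
      rw [hS, Finset.mem_coe, Finset.mem_filter] at hR hR'
      rw [Function.onFun, Finset.disjoint_left]
      intro y hy hy'
      rw [Finset.mem_sdiff] at hy hy'
      rcases h.mem_or R hR.1 R' hR'.1 hR.2 hR'.2 hne y hy.1 with h2 | h2
      exacts [hy.2 h2, hy'.2 h2]
  rw [← h1, Finset.mem_biUnion] at hx
  obtain ⟨R, hR, hxR⟩ := hx
  rw [hS, Finset.mem_filter] at hR
  exact ⟨R, hR.1, hR.2, (Finset.mem_sdiff.1 hxR).2⟩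

theorem Extremal.eq_of_nadj (h : Extremal F) {R R₁ R₂ : Finset E} (h1 : R₁ ∈ facets F)
    (h1c : R₁.card = 6) (h2 : R₂ ∈ facets F) (h2c : R₂.card = 6) (hn1 : R ∈ FaceCone.nadj F R₁)
    (hn2 : R ∈ FaceCone.nadj F R₂) : R₁ = R₂ := by
  by_contra hne
  obtain ⟨hRc, hR1⟩ := h.nadj R₁ h1 h1c R hn1
  obtain ⟨-, hR2⟩ := h.nadj R₂ h2 h2c R hn2
  have hR := (mem_nadj.1 hn1).1
  set S := (((facets F).filter fun G => G.card = 6).erase R₁).erase R₂ with hS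
  have hSc : S.card = 2 := by
    rw [hS, Finset.card_erase_of_mem, Finset.card_erase_of_mem, h.card_six]
    · simp [h1, h1c]
    · simp [h2, h2c, Ne.symm hne]
  have hsub : F \ R ⊆ S.biUnion fun R' => (F \ R) \ R' := by
    intro x hx
    obtain ⟨R', hR', hc, hxR'⟩ := h.exists_notMem (Finset.mem_sdiff.1 hx).1
    refine Finset.mem_biUnion.2 ⟨R', ?_, Finset.mem_sdiff.2 ⟨hx, hxR'⟩⟩
    rw [hS, Finset.mem_erase, Finset.mem_erase, Finset.mem_filter]
    exact ⟨fun he => hxR' (he ▸ hR2 hx), fun he => hxR' (he ▸ hR1 hx), hR', hc⟩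
  have h3 := Finset.card_biUnion_le_card_mul S (fun R' => (F \ R) \ R') 1 fun R' hR' => by
    rw [hS, Finset.mem_erase, Finset.mem_erase, Finset.mem_filter] at hR'
    obtain ⟨-, -, hR', hc⟩ := hR'
    by_contra hlt
    have h4 : (F \ R) \ R' ⊆ F \ R' := Finset.sdiff_subset_sdiff Finset.sdiff_subset le_rfl
    have h5 := card_sdiff_of_facet hR'
    have h6 := h.card_eq
    have h7 := Finset.eq_of_subset_of_card_le h4 (by omega)
    have h8 : R ⊆ R' := by
      intro x hx
      by_contra hxR'
      have h9 : x ∈ F \ R' := Finset.mem_sdiff.2 ⟨facets_subset hR hx, hxR'⟩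
      rw [← h7] at h9
      exact (Finset.mem_sdiff.1 (Finset.mem_sdiff.1 h9).1).2 hx
    have h9 := facets_eq_of_subset hR hR' h8
    rw [h9] at hRc
    omega
  have h4 := Finset.card_le_card hsub
  have h5 := card_sdiff_of_facet hR
  have h6 := h.card_eq
  omega

theorem Good.eq_of_card_sdiff_opp (h : Good V) (hF : F ∈ facets V) (hE : Extremal F)
    (hn : nadj V F = ∅) (hc : 2 ≤ (V \ F).card) {R₁ R₂ : Finset E} (h1 : R₁ ∈ facets F)
    (h1c : R₁.card = 6) (h2 : R₂ ∈ facets F) (h2c : R₂.card = 6)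
    (h1s : (opp V F R₁ \ F).card ≤ 1) (h2s : (opp V F R₂ \ F).card ≤ 1) : R₁ = R₂ := by
  by_contra hne
  have h3 : R₂ ∉ nadj F R₁ := fun hm => by
    have := (hE.nadj R₁ h1 h1c R₂ hm).1
    omega
  obtain ⟨x, hx1, hx2, hxF⟩ := exists_common_of_nadj_eq_empty hF hn h1 h2 hne
    (rk_inter_of_adj h1 h2 (Ne.symm hne) h3)
  obtain ⟨y, hy, hyx⟩ := Finset.exists_mem_ne (show 1 < (V \ F).card by omega) x
  obtain ⟨hyV, hyF⟩ := Finset.mem_sdiff.1 hy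
  obtain ⟨G, hG, hyG, -, hxG⟩ := h.exists_facet_avoiding hyV hyV
    (facets_subset (opp_mem hF h1) hx1) hyx.symm hyx.symm
  have hR := inter_mem_facets_of_nadj_eq_empty hn hG fun he => hyF (he ▸ hyG)
  have hGR := opp_inter_self hF hG hR
  have key : ∀ R' ∈ facets F, x ∈ opp V F R' → (opp V F R' \ F).card ≤ 1 →
      G ∩ F ∈ nadj F R' := by
    intro R' hR' hxR' hs
    by_contra hnn
    have hne' : G ∩ F ≠ R' := by
      intro he
      rw [he] at hGR
      exact hxG (hGR ▸ hxR')
    obtain ⟨z, hz1, hz2, hzF⟩ := exists_common_of_nadj_eq_empty hF hn hR' hR (Ne.symm hne')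
      (rk_inter_of_adj hR' hR hne' hnn)
    have : z = x := Finset.card_le_one.1 hs z (Finset.mem_sdiff.2 ⟨hz1, hzF⟩) x
      (Finset.mem_sdiff.2 ⟨hxR', hxF⟩)
    rw [hGR, this] at hz2
    exact hxG hz2
  exact hne (hE.eq_of_nadj h1 h1c h2 h2c (key R₁ h1 hx1 h1s) (key R₂ h2 hx2 h2s))

theorem Good.card_le_eleven (h : Good V) (hr : rk V = 7) (hs : ∀ G ∈ facets V, G.card ≤ 8)
    (hF : F ∈ facets V) (hE : Extremal F) (hn : nadj V F = ∅) : (V \ F).card ≤ 3 := by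
  have h1 := h.mul_le_sum_offDiag (X := V \ F) Finset.sdiff_subset
  rw [sum_offDiag, sum_offDiag_outside hF, hn, Finset.sum_empty, add_zero, hr] at h1
  have h2 : ∑ R ∈ facets F,
      ((opp V F R \ F).card * (opp V F R \ F).card - (opp V F R \ F).card) ≤
      ∑ R ∈ facets F, if R.card = 6 then 2 else 6 := by
    refine Finset.sum_le_sum fun R hR => ?_
    have h3 := card_sdiff_opp hF hR
    have h4 := hs _ (opp_mem hF hR)
    have h5 := hE.card_or R hR
    split_ifs with h6
    · exact sub_self_sq_mono (b := 2) (by omega)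
    · exact sub_self_sq_mono (b := 3) (by omega)
  have h3 := Finset.card_filter_add_card_filter_not (s := facets F) (fun R => R.card = 6)
  rw [Finset.sum_ite, Finset.sum_const, Finset.sum_const, smul_eq_mul, smul_eq_mul,
    hE.card_six] at h2
  rw [hE.card_six, hE.card_facets] at h3
  by_contra hlt
  have h4 := sub_self_sq_mono (show 4 ≤ (V \ F).card by omega)
  omega

end NoNadj

section Complements

variable {V F : Finset E}

/-- The complements of the facets. -/
noncomputable def complements (V : Finset E) : Finset (Finset E) :=
  (facets V).image fun G => V \ G

theorem injOn_complement (V : Finset E) :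
    Set.InjOn (fun G => V \ G) (facets V : Set (Finset E)) := by
  intro G hG H hH he
  have h1 := Finset.sdiff_sdiff_eq_self (facets_subset (Finset.mem_coe.1 hG))
  have h2 := Finset.sdiff_sdiff_eq_self (facets_subset (Finset.mem_coe.1 hH))
  rw [← h1, ← h2]
  exact congrArg (fun S => V \ S) he

theorem card_filter_complements (V : Finset E) (p : Finset E → Prop) [DecidablePred p] :
    ((complements V).filter p).card = ((facets V).filter fun G => p (V \ G)).card := by
  rw [complements, Finset.filter_image, Finset.card_image_of_injOn]
  exact (injOn_complement V).mono (Finset.coe_subset.2 (Finset.filter_subset _ _))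

theorem sdiff_complements (hF : F ⊆ V) (G : Finset E) : (V \ G) \ (V \ F) = F \ G := by
  ext x
  have := @hF x
  simp only [Finset.mem_sdiff]
  tauto

theorem card_sdiff_opp_self {R : Finset E} (hF : F ∈ facets V) (hR : R ∈ facets F) :
    (F \ opp V F R).card + R.card = F.card := by
  have h1 := Finset.card_sdiff_add_card_inter F (opp V F R)
  rwa [Finset.inter_comm, opp_inter hF hR] at h1

theorem Good.complementFamily {m : ℕ} (h : Good V) (hn : V.card = m + 8) (hm : 2 ≤ m)
    (hs : ∀ G ∈ facets V, G.card ≤ 8) (hc : (facets V).card = 13)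
    (hE : ∀ F ∈ facets V, F.card = 8 → Extremal F ∧ nadj V F = ∅) :
    ComplementFamily V (complements V) m := by
  have key : ∀ O ∈ complements V, O.card = m → ∃ F ∈ facets V, O = V \ F ∧ F.card = 8 ∧
      Extremal F ∧ nadj V F = ∅ := by
    intro O hO hOm
    obtain ⟨F, hF, rfl⟩ := Finset.mem_image.1 hO
    have h1 := card_sdiff_of_facet hF
    have h2 : F.card = 8 := by omega
    exact ⟨F, hF, rfl, h2, hE F hF h2⟩
  have hridge : ∀ F ∈ facets V, nadj V F = ∅ → ∀ G ∈ facets V, V \ G ≠ V \ F →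
      G ∩ F ∈ facets F ∧ opp V F (G ∩ F) = G ∧ (F \ G).card + (G ∩ F).card = F.card := by
    intro F hF hn G hG hne
    have h1 := inter_mem_facets_of_nadj_eq_empty hn hG fun he => hne (by rw [he])
    have h2 := opp_inter_self hF hG h1
    refine ⟨h1, h2, ?_⟩
    have h3 := card_sdiff_opp_self hF h1
    rwa [h2] at h3
  have hne : ∀ {C O : Finset E}, C ∈ related (complements V) O → C ≠ O := by
    rintro C O hC rfl
    simp [mem_related] at hC
  refine ⟨hn, ?_, ?_, ?_, ?_, ?_, ?_, ?_, ?_, ?_⟩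
  · rw [complements, Finset.card_image_of_injOn (injOn_complement V), hc]
  · intro C hC
    obtain ⟨G, -, rfl⟩ := Finset.mem_image.1 hC
    exact Finset.sdiff_subset
  · intro C hC
    obtain ⟨G, hG, rfl⟩ := Finset.mem_image.1 hC
    have h1 := card_sdiff_of_facet hG
    have h2 := hs G hG
    omega
  · intro O hO hOm C hC hCO
    obtain ⟨F, hF, rfl, hF8, hEF, hnF⟩ := key O hO hOm
    obtain ⟨G, hG, rfl⟩ := Finset.mem_image.1 hC
    obtain ⟨h1, h2, h3⟩ := hridge F hF hnF G hG hCO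
    rw [sdiff_complements (facets_subset hF)]
    have := hEF.card_or _ h1
    omega
  · intro O hO hOm
    obtain ⟨F, hF, rfl, hF8, hEF, hnF⟩ := key O hO hOm
    rw [related, card_filter_complements]
    simp only [sdiff_complements (facets_subset hF)]
    rw [Finset.card_filter, sum_facets hF, hnF, ← hEF.card_six, Finset.card_filter]
    simp only [Finset.sum_empty, add_zero]
    rw [if_neg (by norm_num), zero_add]
    refine Finset.sum_congr rfl fun R hR => ?_
    have := card_sdiff_opp_self hF hR
    split_ifs <;> omega
  · intro O hO hOm C hC D hD hCD
    obtain ⟨F, hF, rfl, hF8, hEF, hnF⟩ := key O hO hOm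
    have hC' := mem_related.1 hC
    have hD' := mem_related.1 hD
    have hCO := hne hC
    have hDO := hne hD
    obtain ⟨G, hG, rfl⟩ := Finset.mem_image.1 hC'.1
    obtain ⟨H, hH, rfl⟩ := Finset.mem_image.1 hD'.1
    obtain ⟨h1, h2, h3⟩ := hridge F hF hnF G hG hCO
    obtain ⟨h4, h5, h6⟩ := hridge F hF hnF H hH hDO
    rw [sdiff_complements (facets_subset hF)] at hC' hD' ⊢
    rw [sdiff_complements (facets_subset hF), Finset.disjoint_left]
    intro x hx hx'
    rw [Finset.mem_sdiff] at hx hx'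
    rcases hEF.mem_or _ h1 _ h4 (by omega) (by omega)
      (fun he => hCD (by rw [← h2, ← h5, he])) x hx.1 with h7 | h7
    · exact hx.2 (Finset.mem_inter.1 h7).1
    · exact hx'.2 (Finset.mem_inter.1 h7).1
  · intro O hO hOm x hx hxO
    obtain ⟨F, hF, rfl, hF8, hEF, hnF⟩ := key O hO hOm
    have hxF : x ∈ F := by
      by_contra hxF
      exact hxO (Finset.mem_sdiff.2 ⟨hx, hxF⟩)
    rw [card_filter_complements]
    simp only [Finset.mem_sdiff, hx, true_and]
    rw [Finset.card_filter, sum_facets hF, hnF, ← hEF.card_avoid x hxF, Finset.card_filter]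
    simp only [hxF, not_true_eq_false, if_false, Finset.sum_empty, add_zero, zero_add]
    refine Finset.sum_congr rfl fun R hR => ?_
    simp only [mem_opp_iff hF hR hxF]
  · intro O hO hOm C hC D hD hCO hDO hsub
    obtain ⟨F, hF, rfl, hF8, hEF, hnF⟩ := key O hO hOm
    obtain ⟨G, hG, rfl⟩ := Finset.mem_image.1 hC
    obtain ⟨H, hH, rfl⟩ := Finset.mem_image.1 hD
    obtain ⟨h1, h2, h3⟩ := hridge F hF hnF G hG hCO
    obtain ⟨h4, h5, h6⟩ := hridge F hF hnF H hH hDO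
    rw [sdiff_complements (facets_subset hF), sdiff_complements (facets_subset hF)] at hsub
    have h7 : H ∩ F ⊆ G ∩ F := by
      intro x hx
      obtain ⟨hxH, hxF⟩ := Finset.mem_inter.1 hx
      refine Finset.mem_inter.2 ⟨?_, hxF⟩
      by_contra hxG
      exact (Finset.mem_sdiff.1 (hsub (Finset.mem_sdiff.2 ⟨hxF, hxG⟩))).2 hxH
    rw [← h2, ← h5, facets_eq_of_subset h4 h1 h7]
  · intro O hO hOm
    obtain ⟨F, hF, rfl, hF8, hEF, hnF⟩ := key O hO hOm
    rw [Finset.card_le_one]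
    intro C hC D hD
    obtain ⟨hC, hCs⟩ := Finset.mem_filter.1 hC
    obtain ⟨hD, hDs⟩ := Finset.mem_filter.1 hD
    have hC' := mem_related.1 hC
    have hD' := mem_related.1 hD
    have hCO := hne hC
    have hDO := hne hD
    obtain ⟨G, hG, rfl⟩ := Finset.mem_image.1 hC'.1
    obtain ⟨H, hH, rfl⟩ := Finset.mem_image.1 hD'.1
    obtain ⟨h1, h2, h3⟩ := hridge F hF hnF G hG hCO
    obtain ⟨h4, h5, h6⟩ := hridge F hF hnF H hH hDO
    rw [sdiff_complements (facets_subset hF)] at hC' hD'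
    rw [sdiff_complements (facets_subset hG)] at hCs
    rw [sdiff_complements (facets_subset hH)] at hDs
    have h7 := h.eq_of_card_sdiff_opp hF hEF hnF (by omega) h1 (by omega) h4 (by omega)
      (by rwa [h2]) (by rwa [h5])
    rw [← h2, ← h5, h7]

end Complements

theorem Good.card_facets_of_card_facet {V F : Finset E} {d : ℕ} (h : Good V) (hd : 4 ≤ d)
    (hr : rk V = d + 2) (hn : d + 5 ≤ V.card) (hs : ∀ G ∈ facets V, G.card ≤ d + 3)
    (hF : F ∈ facets V) (hFc : F.card = d + 3) : d + 9 ≤ (facets V).card := by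
  by_contra hlt
  have hE : ∀ G ∈ facets V, G.card = d + 3 → d = 5 ∧ Extremal G ∧ nadj V G = ∅ ∧
      (facets V).card = 13 := fun G hG hGc =>
    h.extremal_of_card_facet hd hr hn hs (by omega) hG hGc
  obtain ⟨rfl, hEF, hnF, hf⟩ := hE F hF hFc
  have h1 := h.card_le_eleven hr hs hF hEF hnF
  have h2 := card_sdiff_of_facet hF
  have h3 : ∀ m, V.card = m + 8 → 2 ≤ m → ComplementFamily V (complements V) m :=
    fun m hm hm2 => h.complementFamily hm hm2 hs hf fun G hG hGc =>
      ⟨(hE G hG hGc).2.1, (hE G hG hGc).2.2.1⟩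
  have hO : V \ F ∈ complements V := Finset.mem_image_of_mem _ hF
  rcases (show V.card = 2 + 8 ∨ V.card = 3 + 8 by omega) with h4 | h4
  · exact (h3 2 h4 le_rfl).false_of_two hO (by omega)
  · exact (h3 3 h4 (by norm_num)).false_of_three hO (by omega)

theorem Good.card_facets_of_add_four_le {d : ℕ} (hd : 4 ≤ d) {V : Finset E} (h : Good V)
    (hr : rk V = d + 1) (hn : d + 4 ≤ V.card) : d + 8 ≤ (facets V).card := by
  induction d, hd using Nat.le_induction generalizing V with
  | base =>
    exact h.card_facets_of_simplicial le_rfl hr (fun G hG => h.card_facet_of_rk_five hr hG) hn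
  | succ d hd ih =>
    by_cases h1 : ∃ F ∈ facets V, d + 4 ≤ F.card
    · obtain ⟨F, hF, hFc⟩ := h1
      have h2 := ih (h.mono (facets_subset hF)) (by have := facets_rk hF; omega) hFc
      have h3 := card_facets_eq hF
      omega
    push Not at h1
    by_cases h2 : ∃ F ∈ facets V, F.card = d + 3
    · obtain ⟨F, hF, hFc⟩ := h2
      have := h.card_facets_of_card_facet hd hr (by omega)
        (fun G hG => by have := h1 G hG; omega) hF hFc
      omega
    push Not at h2
    have h3 : ∀ G ∈ facets V, G.card ≤ d + 1 + 1 := fun G hG => by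
      have := h1 G hG
      have := h2 G hG
      omega
    by_cases h4 : ∃ F ∈ facets V, F.card = d + 1 + 1
    · obtain ⟨F, hF, hFc⟩ := h4
      exact h.card_facets_of_card_le hr hn h3 hF hFc
    push Not at h4
    refine h.card_facets_of_simplicial (by omega) hr (fun G hG => ?_) hn
    have := h3 G hG
    have := h4 G hG
    have := facets_card hG
    omega

end FaceCone

namespace FaceCone

section Homogenization

variable {X : Type*} [NormedAddCommGroup X] [NormedSpace ℝ X] [DecidableEq X]

/-- The embedding of `X` as the affine hyperplane at height one. -/
def homog (v : X) : X × ℝ := (v, 1)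

theorem homog_injective : Function.Injective (homog : X → X × ℝ) := fun _ _ h =>
  (Prod.mk.inj h).1

theorem rk_image_homog [FiniteDimensional ℝ X] {S : Finset X} (hS : S.Nonempty) :
    rk (S.image homog) = Module.finrank ℝ (vectorSpan ℝ (S : Set X)) + 1 := by
  obtain ⟨p, hp⟩ := hS
  have hspan : Submodule.span ℝ ((S.image homog : Finset (X × ℝ)) : Set (X × ℝ)) =
      (vectorSpan ℝ (S : Set X)).map (LinearMap.inl ℝ X ℝ) ⊔ Submodule.span ℝ {homog p} := by
    apply le_antisymm
    · rw [Submodule.span_le]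
      intro y hy
      obtain ⟨v, hv, rfl⟩ := Finset.mem_image.1 (Finset.mem_coe.1 hy)
      refine Submodule.mem_sup.2 ⟨LinearMap.inl ℝ X ℝ (v -ᵥ p),
        Submodule.mem_map_of_mem (vsub_mem_vectorSpan ℝ (Finset.mem_coe.2 hv)
          (Finset.mem_coe.2 hp)), homog p, Submodule.mem_span_singleton_self _, ?_⟩
      simp [homog]
    · have hmem : ∀ v ∈ S, homog v ∈
          Submodule.span ℝ ((S.image homog : Finset (X × ℝ)) : Set (X × ℝ)) := fun v hv =>
        Submodule.subset_span (Finset.mem_coe.2 (Finset.mem_image_of_mem _ hv))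
      refine sup_le ?_ ((Submodule.span_singleton_le_iff_mem _ _).2 (hmem p hp))
      rw [vectorSpan_eq_span_vsub_set_right ℝ (Finset.mem_coe.2 hp), Submodule.map_span_le]
      rintro _ ⟨v, hv, rfl⟩
      have h1 : LinearMap.inl ℝ X ℝ (v -ᵥ p) = homog v - homog p := by simp [homog]
      change LinearMap.inl ℝ X ℝ (v -ᵥ p) ∈ _
      rw [h1]
      exact Submodule.sub_mem _ (hmem v hv) (hmem p hp)
  have hinf : (vectorSpan ℝ (S : Set X)).map (LinearMap.inl ℝ X ℝ) ⊓
      Submodule.span ℝ {homog p} = ⊥ := by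
    rw [eq_bot_iff]
    rintro y ⟨hy1, hy2⟩
    obtain ⟨z, -, rfl⟩ := hy1
    obtain ⟨c, hc⟩ := Submodule.mem_span_singleton.1 hy2
    have h1 := congrArg Prod.snd hc
    simp only [homog, Prod.smul_snd, smul_eq_mul, mul_one, LinearMap.inl_apply] at h1
    rw [Submodule.mem_bot, ← hc, h1, zero_smul]
  have h1 := Submodule.finrank_sup_add_finrank_inf_eq
    ((vectorSpan ℝ (S : Set X)).map (LinearMap.inl ℝ X ℝ)) (Submodule.span ℝ {homog p})
  rw [hinf, finrank_bot, finrank_span_singleton (by simp [homog]),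
    ← (Submodule.equivMapOfInjective (LinearMap.inl ℝ X ℝ) LinearMap.inl_injective
      (vectorSpan ℝ (S : Set X))).finrank_eq] at h1
  rw [rk, hspan]
  omega

theorem convexHull_filter_eq {S : Finset X} (l : StrongDual ℝ X) {c : ℝ}
    (h : ∀ v ∈ S, l v ≤ c) :
    convexHull ℝ ((S.filter fun v => l v = c : Finset X) : Set X) =
      {x ∈ convexHull ℝ (S : Set X) | l x = c} := by
  apply subset_antisymm
  · intro x hx
    refine ⟨convexHull_mono (Finset.coe_subset.2 (Finset.filter_subset _ _)) hx, ?_⟩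
    have hconv : Convex ℝ {x : X | l x = c} := convex_hyperplane l.toLinearMap.isLinear c
    exact convexHull_min (fun v hv => (Finset.mem_filter.1 (Finset.mem_coe.1 hv)).2) hconv hx
  · rintro x ⟨hx, hxc⟩
    obtain ⟨w, hw0, hw1, rfl⟩ := Finset.mem_convexHull'.1 hx
    have h1 : ∑ v ∈ S, w v * (c - l v) = 0 := by
      simp only [mul_sub, Finset.sum_sub_distrib, ← Finset.sum_mul, hw1]
      rw [map_sum] at hxc
      simp only [map_smul, smul_eq_mul] at hxc
      rw [hxc]
      ring
    have h2 := (Finset.sum_eq_zero_iff_of_nonneg fun v hv =>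
      mul_nonneg (hw0 v hv) (sub_nonneg.2 (h v hv))).1 h1
    have h3 : ∀ v ∈ S, w v ≠ 0 → l v = c := by
      intro v hv hne
      have := (mul_eq_zero.1 (h2 v hv)).resolve_left hne
      linarith
    refine Finset.mem_convexHull'.2 ⟨w, fun v hv => hw0 v (Finset.mem_filter.1 hv).1, ?_, ?_⟩
    · rw [Finset.sum_filter_of_ne h3, hw1]
    · exact Finset.sum_filter_of_ne fun v hv hne => h3 v hv fun h0 => hne (by rw [h0, zero_smul])

theorem exists_irredundant (S : Finset X) : ∃ T : Finset X,
    convexHull ℝ (S : Set X) = convexHull ℝ (T : Set X) ∧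
      ∀ v ∈ T, v ∉ convexHull ℝ ((T.erase v : Finset X) : Set X) := by
  induction S using Finset.strongInduction with
  | H S ih =>
    by_cases h : ∀ v ∈ S, v ∉ convexHull ℝ ((S.erase v : Finset X) : Set X)
    · exact ⟨S, rfl, h⟩
    · push Not at h
      obtain ⟨v, hv, hvS⟩ := h
      obtain ⟨T, hT, hT'⟩ := ih _ (Finset.erase_ssubset hv)
      refine ⟨T, ?_, hT'⟩
      rw [← hT]
      refine subset_antisymm (convexHull_min (fun x hx => ?_) (convex_convexHull ℝ _))
        (convexHull_mono (Finset.coe_subset.2 (Finset.erase_subset _ _)))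
      by_cases hxv : x = v
      · exact hxv ▸ hvS
      · exact subset_convexHull ℝ _ (Finset.mem_coe.2 (Finset.mem_erase.2 ⟨hxv, hx⟩))

variable {T : Finset X}

theorem le_of_mem_convexHull (l : StrongDual ℝ X) {c : ℝ} (h : ∀ v ∈ T, l v ≤ c) {x : X}
    (hx : x ∈ convexHull ℝ (T : Set X)) : l x ≤ c :=
  convexHull_min (fun v hv => h v hv) (convex_halfSpace_le l.toLinearMap.isLinear c) hx

theorem isExposed_of_le (l : StrongDual ℝ X) {c : ℝ} (h : ∀ v ∈ T, l v ≤ c) :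
    IsExposed ℝ (convexHull ℝ (T : Set X)) {x ∈ convexHull ℝ (T : Set X) | l x = c} := by
  rintro ⟨x, hx, hxc⟩
  refine ⟨l, ?_⟩
  ext y
  constructor
  · rintro ⟨hy, hyc⟩
    exact ⟨hy, fun z hz => hyc ▸ le_of_mem_convexHull l h hz⟩
  · rintro ⟨hy, hyc⟩
    exact ⟨hy, le_antisymm (le_of_mem_convexHull l h hy) (hxc ▸ hyc x hx)⟩

theorem exists_of_isExposed {B : Set X} (hB : IsExposed ℝ (convexHull ℝ (T : Set X)) B)
    (hne : B.Nonempty) : ∃ (l : StrongDual ℝ X) (c : ℝ), (∀ v ∈ T, l v ≤ c) ∧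
      B = {x ∈ convexHull ℝ (T : Set X) | l x = c} := by
  obtain ⟨l, hl⟩ := hB hne
  obtain ⟨x, hx⟩ := hne
  have hx' := hx
  rw [hl] at hx'
  refine ⟨l, l x, fun v hv => hx'.2 v (subset_convexHull ℝ _ hv), ?_⟩
  rw [hl]
  ext y
  constructor
  · rintro ⟨hy, hyc⟩
    exact ⟨hy, le_antisymm (hx'.2 y hy) (hyc x hx'.1)⟩
  · rintro ⟨hy, hyc⟩
    exact ⟨hy, fun z hz => hyc ▸ hx'.2 z hz⟩

theorem isExposed_singleton_iff (hT : ∀ v ∈ T, v ∉ convexHull ℝ ((T.erase v : Finset X) : Set X))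
    {v : X} : IsExposed ℝ (convexHull ℝ (T : Set X)) {v} ↔ v ∈ T := by
  constructor
  · intro h
    obtain ⟨l, c, hl, hv⟩ := exists_of_isExposed h (Set.singleton_nonempty v)
    rw [← convexHull_filter_eq l hl] at hv
    have hne : (convexHull ℝ ((T.filter fun v => l v = c : Finset X) : Set X)).Nonempty := by
      rw [← hv]
      exact Set.singleton_nonempty v
    obtain ⟨w, hw⟩ := convexHull_nonempty_iff.1 hne
    have hw' := subset_convexHull ℝ _ hw
    rw [← hv, Set.mem_singleton_iff] at hw'
    exact hw' ▸ (Finset.mem_filter.1 (Finset.mem_coe.1 hw)).1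
  · intro hv
    obtain ⟨l, u, hl, hu⟩ := geometric_hahn_banach_closed_point (convex_convexHull ℝ _)
      ((T.erase v).finite_toSet.isClosed_convexHull ℝ) (hT v hv)
    have h1 : ∀ w ∈ T, w ≠ v → l w < l v := fun w hw hne =>
      (hl w (subset_convexHull ℝ _ (Finset.mem_coe.2 (Finset.mem_erase.2 ⟨hne, hw⟩)))).trans hu
    have h2 : ∀ w ∈ T, l w ≤ l v := fun w hw => by
      by_cases hne : w = v
      · rw [hne]
      · exact (h1 w hw hne).le
    have h3 := isExposed_of_le l h2
    rw [← convexHull_filter_eq l h2] at h3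
    have h4 : T.filter (fun w => l w = l v) = {v} := by
      ext w
      rw [Finset.mem_filter, Finset.mem_singleton]
      constructor
      · rintro ⟨hw, he⟩
        by_contra hne
        exact (h1 w hw hne).ne he
      · rintro rfl
        exact ⟨hv, rfl⟩
    rwa [h4, Finset.coe_singleton, convexHull_singleton] at h3

/-- The linear functional on the homogenization induced by an affine functional. -/
noncomputable def homogFunctional (l : StrongDual ℝ X) (c : ℝ) : X × ℝ →ₗ[ℝ] ℝ :=
  c • LinearMap.snd ℝ X ℝ - l.toLinearMap ∘ₗ LinearMap.fst ℝ X ℝ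

theorem homogFunctional_apply (l : StrongDual ℝ X) (c : ℝ) (v : X) :
    homogFunctional l c (homog v) = c - l v := by
  simp [homogFunctional, homog]

theorem isFace_of_isExposed {S : Finset X}
    (hT : ∀ v ∈ T, v ∉ convexHull ℝ ((T.erase v : Finset X) : Set X)) (hS : S ⊆ T)
    (hne : S.Nonempty)
    (hB : IsExposed ℝ (convexHull ℝ (T : Set X)) (convexHull ℝ (S : Set X))) :
    IsFace (T.image homog) (S.image homog) := by
  obtain ⟨l, c, hl, hv⟩ := exists_of_isExposed hB
    (convexHull_nonempty_iff.2 (Finset.coe_nonempty.2 hne))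
  refine ⟨Finset.image_subset_image hS, homogFunctional l c, ?_⟩
  intro y hy
  obtain ⟨v, hvT, rfl⟩ := Finset.mem_image.1 hy
  rw [homogFunctional_apply, homog_injective.mem_finset_image, sub_eq_zero]
  refine ⟨sub_nonneg.2 (hl v hvT), fun h => ?_, fun h => ?_⟩
  · have h1 : v ∈ convexHull ℝ (S : Set X) := by
      rw [hv]
      exact ⟨subset_convexHull ℝ _ hvT, h.symm⟩
    by_contra hvS
    refine hT v hvT (convexHull_mono ?_ h1)
    intro w hw
    exact Finset.mem_coe.2 (Finset.mem_erase.2 ⟨fun he => hvS (he ▸ hw), hS hw⟩)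
  · have h1 := subset_convexHull ℝ (S : Set X) (Finset.mem_coe.2 h)
    rw [hv] at h1
    exact h1.2.symm

theorem isFace_empty_homog : IsFace (T.image homog) ∅ := by
  refine ⟨Finset.empty_subset _, LinearMap.snd ℝ X ℝ, ?_⟩
  intro y hy
  obtain ⟨v, -, rfl⟩ := Finset.mem_image.1 hy
  simp [homog]

theorem good_homog (hT : ∀ v ∈ T, v ∉ convexHull ℝ ((T.erase v : Finset X) : Set X))
    (h : ∀ u ∈ T, ∀ v ∈ T, u ≠ v →
      IsExposed ℝ (convexHull ℝ (T : Set X)) (convexHull ℝ {u, v})) :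
    Good (T.image homog) := by
  refine ⟨isFace_empty_homog, ?_⟩
  intro x hx y hy
  obtain ⟨u, hu, rfl⟩ := Finset.mem_image.1 hx
  obtain ⟨v, hv, rfl⟩ := Finset.mem_image.1 hy
  have h1 : ({homog u, homog v} : Finset (X × ℝ)) = ({u, v} : Finset X).image homog := by
    rw [Finset.image_insert, Finset.image_singleton]
  rw [h1]
  refine isFace_of_isExposed hT ?_ (Finset.insert_nonempty _ _) ?_
  · intro w hw
    rcases Finset.mem_insert.1 hw with rfl | hw
    · exact hu
    · exact Finset.mem_singleton.1 hw ▸ hv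
  · rw [Finset.coe_pair]
    by_cases hne : u = v
    · rw [hne, Set.pair_eq_singleton, convexHull_singleton]
      exact (isExposed_singleton_iff hT).2 hv
    · exact h u hu v hv hne

theorem IsFace.exists_functional_homog [FiniteDimensional ℝ X] {S : Finset (X × ℝ)}
    (h : IsFace (T.image homog) S) :
    ∃ (l : StrongDual ℝ X) (c : ℝ), (∀ v ∈ T, l v ≤ c) ∧
      (T.filter fun v => l v = c).image homog = S := by
  obtain ⟨hS, f, hf⟩ := h
  have hfv : ∀ v : X, f (homog v) = f (0, 1) + f (v, 0) := fun v => by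
    rw [← map_add]
    simp [homog]
  have hl : ∀ v : X, LinearMap.toContinuousLinearMap (-(f ∘ₗ LinearMap.inl ℝ X ℝ)) v =
      -f (v, 0) := fun v => rfl
  refine ⟨LinearMap.toContinuousLinearMap (-(f ∘ₗ LinearMap.inl ℝ X ℝ)), f (0, 1), ?_, ?_⟩
  · intro v hv
    have h1 := (hf _ (Finset.mem_image_of_mem homog hv)).1
    rw [hfv] at h1
    rw [hl]
    linarith
  · ext y
    rw [Finset.mem_image]
    constructor
    · rintro ⟨v, hv, rfl⟩
      rw [Finset.mem_filter, hl] at hv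
      refine (hf _ (Finset.mem_image_of_mem homog hv.1)).2.1 ?_
      rw [hfv, ← hv.2]
      ring
    · intro hy
      obtain ⟨v, hv, rfl⟩ := Finset.mem_image.1 (hS hy)
      have h1 := (hf _ (hS hy)).2.2 hy
      rw [hfv] at h1
      refine ⟨v, Finset.mem_filter.2 ⟨hv, ?_⟩, rfl⟩
      rw [hl]
      linarith

theorem finite_exposed (T : Finset X) :
    {B : Set X | IsExposed ℝ (convexHull ℝ (T : Set X)) B ∧ B.Nonempty}.Finite := by
  refine (T.powerset.finite_toSet.image fun S : Finset X => convexHull ℝ (S : Set X)).subset ?_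
  rintro B ⟨hB, hne⟩
  obtain ⟨l, c, hl, hv⟩ := exists_of_isExposed hB hne
  refine ⟨T.filter fun v => l v = c, ?_, ?_⟩
  · exact Finset.mem_coe.2 (Finset.mem_powerset.2 (Finset.filter_subset _ _))
  · rw [hv]
    exact convexHull_filter_eq l hl

/-- The convex hull of the points of `T` whose homogenization lies in `S`. -/
def hullOf (T : Finset X) (S : Finset (X × ℝ)) : Set X :=
  convexHull ℝ ((T.filter fun v => homog v ∈ S : Finset X) : Set X)

theorem filter_homog_mem {S : Finset X} (hS : S ⊆ T) :
    (T.filter fun v => homog v ∈ S.image homog) = S := by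
  ext v
  rw [Finset.mem_filter, homog_injective.mem_finset_image]
  exact ⟨And.right, fun h => ⟨hS h, h⟩⟩

theorem isExposed_hullOf [FiniteDimensional ℝ X] {S : Finset (X × ℝ)}
    (h : IsFace (T.image homog) S) :
    IsExposed ℝ (convexHull ℝ (T : Set X)) (hullOf T S) := by
  obtain ⟨l, c, hl, rfl⟩ := h.exists_functional_homog
  rw [hullOf, filter_homog_mem (Finset.filter_subset _ _), convexHull_filter_eq l hl]
  exact isExposed_of_le l hl

theorem image_filter_mem_hullOf [FiniteDimensional ℝ X] {S : Finset (X × ℝ)}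
    (h : IsFace (T.image homog) S) :
    homog '' {v | v ∈ T ∧ v ∈ hullOf T S} = (S : Set (X × ℝ)) := by
  obtain ⟨l, c, hl, rfl⟩ := h.exists_functional_homog
  rw [hullOf, filter_homog_mem (Finset.filter_subset _ _), convexHull_filter_eq l hl,
    Finset.coe_image]
  congr 1
  ext v
  simp only [Set.mem_ofPred_eq, Finset.coe_filter]
  exact ⟨fun h => ⟨h.1, h.2.2⟩, fun h => ⟨h.1, subset_convexHull ℝ _ h.1, h.2⟩⟩

end Homogenization

section Polytope

variable {N : ℕ}

theorem pdim_convexHull (S : Finset (Fin N → ℝ)) :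
    pdim (convexHull ℝ (S : Set (Fin N → ℝ))) =
      Module.finrank ℝ (vectorSpan ℝ (S : Set (Fin N → ℝ))) := by
  rw [pdim, affineSpan_convexHull, direction_affineSpan]

theorem isFacetOf_hullOf {T : Finset (Fin N → ℝ)} {S : Finset ((Fin N → ℝ) × ℝ)}
    (hT : T.Nonempty) (h : S ∈ facets (T.image homog)) (hS : S.Nonempty) :
    IsFacetOf (convexHull ℝ (T : Set (Fin N → ℝ))) (hullOf T S) := by
  have h1 := facets_isFace h
  have h2 := facets_rk h
  have h3 := isExposed_hullOf h1
  obtain ⟨l, c, hl, rfl⟩ := h1.exists_functional_homog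
  rw [Finset.image_nonempty] at hS
  rw [hullOf, filter_homog_mem (Finset.filter_subset _ _)] at h3 ⊢
  rw [rk_image_homog hS, rk_image_homog hT] at h2
  refine ⟨h3, convexHull_nonempty_iff.2 (Finset.coe_nonempty.2 hS), ?_⟩
  rw [pdim_convexHull, pdim_convexHull]
  omega

theorem card_facets_homog_le {T : Finset (Fin N → ℝ)} (hT : T.Nonempty)
    (hr : 2 ≤ rk (T.image homog)) :
    (facets (T.image homog)).card ≤
      (facetSet (convexHull ℝ (T : Set (Fin N → ℝ)))).ncard := by
  rw [← Set.ncard_coe_finset]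
  refine Set.ncard_le_ncard_of_injOn (hullOf T) ?_ ?_ ?_
  · intro S hS
    refine isFacetOf_hullOf hT hS (Finset.nonempty_iff_ne_empty.2 ?_)
    rintro rfl
    have h1 := facets_rk (Finset.mem_coe.1 hS)
    rw [rk_empty] at h1
    omega
  · intro S hS S' hS' he
    rw [← Finset.coe_inj, ← image_filter_mem_hullOf (facets_isFace (Finset.mem_coe.1 hS)),
      ← image_filter_mem_hullOf (facets_isFace (Finset.mem_coe.1 hS')), he]
  · exact (finite_exposed T).subset fun F hF => ⟨hF.1, hF.2.1⟩

end Polytope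

end FaceCone

/-- For every integer `d ≥ 4`, every 2-neighborly `d`-polytope with at least `d + 4`
vertices has at least `d + 8` facets. -/
theorem two_neighborly_many_vertices_facet_bound
    (d : ℕ) (hd : 4 ≤ d) {N : ℕ} (P : Set (Fin N → ℝ))
    (hP : IsPolytope P) (hdim : pdim P = d) (hnb : TwoNeighborly P)
    (hv : d + 4 ≤ (vertexSet P).ncard) :
    d + 8 ≤ (facetSet P).ncard := by
  obtain ⟨S, rfl⟩ := hP
  obtain ⟨T, hST, hT⟩ := FaceCone.exists_irredundant S
  rw [hST] at hdim hnb hv ⊢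
  have hvert : ∀ v, IsVertex (convexHull ℝ (T : Set (Fin N → ℝ))) v ↔ v ∈ T := fun v =>
    FaceCone.isExposed_singleton_iff hT
  have hset : vertexSet (convexHull ℝ (T : Set (Fin N → ℝ))) = T := by
    ext v
    exact hvert v
  rw [hset, Set.ncard_coe_finset] at hv
  have hne : T.Nonempty := Finset.card_pos.1 (by omega)
  have hgood : FaceCone.Good (T.image FaceCone.homog) := FaceCone.good_homog hT
    fun u hu v hv huv => (hnb u v ((hvert u).2 hu) ((hvert v).2 hv) huv).1
  have hr : FaceCone.rk (T.image FaceCone.homog) = d + 1 := by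
    rw [FaceCone.rk_image_homog hne, ← FaceCone.pdim_convexHull, hdim]
  refine (hgood.card_facets_of_add_four_le hd hr ?_).trans
    (FaceCone.card_facets_homog_le hne (by omega))
  rwa [Finset.card_image_of_injective _ FaceCone.homog_injective]
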